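/- arXiv:2104.04476 — 2 statements merged into one kernel-verified Lean document; each statement's English description precedes it below -/
import Mathlib

section
/- Let Δ be a ⌊d/2⌋-neighborly PL (d-1)-sphere on vertex set [n] and let B ⊆ Δ be a (⌊d/2⌋−1)-neighborly (w.r.t. [n]) and (⌊d/2⌋−1)-stacked PL (d-1)-ball. Then the complex Δ(B) obtained from Δ by removing the facets of B and adding the join ∂B * {n+1} is a ⌊d/2⌋-neighborly PL (d-1)-sphere on vertex set [n+1]. -/
/-- An (abstract) simplicial complex: a family of finite sets closed under subsets. -/
def IsComplex (K : Set (Finset ℕ)) : Prop :=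
  ∀ s ∈ K, ∀ t ⊆ s, t ∈ K

/-- The geometric realization of a family of finite subsets of `ℕ`:
convex combinations of vertices supported on a face. -/
def spaceOf (K : Set (Finset ℕ)) : Set (ℕ → ℝ) :=
  {f | (∀ i, 0 ≤ f i) ∧ ∃ s ∈ K, (∀ i, f i ≠ 0 → i ∈ s) ∧ ∑ i ∈ s, f i = 1}

/-- `K` is a (topological/PL) `d`-ball: its realization is homeomorphic to the
closed unit ball in `ℝ^d`. -/
def IsBall (d : ℕ) (K : Set (Finset ℕ)) : Prop :=
  Nonempty (spaceOf K ≃ₜ (Metric.closedBall (0 : EuclideanSpace ℝ (Fin d)) 1))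

/-- `K` is a (topological/PL) `d`-sphere: its realization is homeomorphic to the
unit sphere in `ℝ^{d+1}`. -/
def IsSphere (d : ℕ) (K : Set (Finset ℕ)) : Prop :=
  Nonempty (spaceOf K ≃ₜ (Metric.sphere (0 : EuclideanSpace ℝ (Fin (d + 1))) 1))

/-- The boundary complex of a pure `d`-dimensional ball (facets have `d+1`
vertices): faces contained in a `d`-element face lying in exactly one facet. -/
def bdry (d : ℕ) (K : Set (Finset ℕ)) : Set (Finset ℕ) :=
  {τ | ∃ ρ ∈ K, τ ⊆ ρ ∧ ρ.card = d ∧ ∃! F, F ∈ K ∧ F.card = d + 1 ∧ ρ ⊆ F}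

/-- A `d`-ball `K` is `i`-stacked if all faces of dimension `≤ d - i - 1`
(i.e. with at most `d - i` vertices) lie in the boundary. -/
def IsStacked (i d : ℕ) (K : Set (Finset ℕ)) : Prop :=
  ∀ τ ∈ K, τ.card + i ≤ d → τ ∈ bdry d K

/-- The vertex set of a complex. -/
def vertexSet (K : Set (Finset ℕ)) : Set ℕ := {v | {v} ∈ K}

/-- `K` is `s`-neighborly w.r.t. `V`: every subset of `V` with at most `s`
elements is a face. -/
def Nbrly (s : ℕ) (V : Set ℕ) (K : Set (Finset ℕ)) : Prop :=
  ∀ τ : Finset ℕ, ↑τ ⊆ V → τ.card ≤ s → τ ∈ K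

/-- `fnum K i` is the number of faces of `K` with `i` vertices, i.e. `f_{i-1}`. -/
noncomputable def fnum (K : Set (Finset ℕ)) (i : ℕ) : ℕ :=
  Nat.card {s : Finset ℕ // s ∈ K ∧ s.card = i}

/-- The `h`-numbers of a `(d-1)`-dimensional complex:
`h_j = ∑_{i=0}^{j} (-1)^{j-i} C(d-i, j-i) f_{i-1}`. -/
noncomputable def hnum (d : ℕ) (K : Set (Finset ℕ)) (j : ℕ) : ℤ :=
  ∑ i ∈ Finset.range (j + 1),
    (-1) ^ (j - i) * (Nat.choose (d - i) (j - i)) * (fnum K i : ℤ)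

/-- The join of two complexes on disjoint vertex sets. -/
def joinC (K1 K2 : Set (Finset ℕ)) : Set (Finset ℕ) :=
  {u | ∃ s ∈ K1, ∃ t ∈ K2, u = s ∪ t}

section

open Set Metric Topology MeasureTheory
open scoped RealInnerProductSpace

section Brouwer

open Polynomial in
/-- `t ↦ det (1 + t A)` is a polynomial of degree at most `dim E`, hence is recovered by Lagrange
interpolation. -/
lemma ContinuousLinearMap.det_one_add_smul_eq_sum {E : Type*} [NormedAddCommGroup E]
    [NormedSpace ℝ E] [FiniteDimensional ℝ E] (A : E →L[ℝ] E) {v : ℕ → ℝ}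
    (hv : Set.InjOn v (Finset.range (Module.finrank ℝ E + 1))) (t : ℝ) :
    (1 + t • A).det = ∑ i ∈ Finset.range (Module.finrank ℝ E + 1),
      (1 + v i • A).det * (Lagrange.basis (Finset.range (Module.finrank ℝ E + 1)) v i).eval t := by
  let b := Module.finBasis ℝ E
  let M := LinearMap.toMatrix b b (A : E →ₗ[ℝ] E)
  let P : ℝ[X] := ((X : ℝ[X]) • M.map C + (1 : Matrix _ _ ℝ).map C).det
  have hP : ∀ s : ℝ, P.eval s = (1 + s • A).det := by
    intro s
    have h1 : P.eval s = (s • M + 1).det := by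
      change (evalRingHom s) P = _
      rw [RingHom.map_det]
      congr 1
      ext i j
      rcases eq_or_ne i j with rfl | hij
      · simp [mul_comm s]
      · simp [Matrix.one_apply_ne hij, mul_comm s]
    rw [h1, ContinuousLinearMap.det, ← LinearMap.det_toMatrix b]
    congr 1
    rw [add_comm]
    simp [M, LinearMap.toMatrix_one]
  have hdeg : P.degree < ((Finset.range (Module.finrank ℝ E + 1)).card : WithBot ℕ) := by
    refine lt_of_le_of_lt degree_le_natDegree ?_
    have := natDegree_det_X_add_C_le M 1
    simp only [Fintype.card_fin, Finset.card_range] at this ⊢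
    exact_mod_cast Nat.lt_succ_of_le this
  have := congrArg (eval t) (Lagrange.eq_interpolate hv hdeg)
  rw [Lagrange.interpolate_apply, eval_finsetSum] at this
  simpa [hP] using this

variable {E : Type*} [NormedAddCommGroup E] [InnerProductSpace ℝ E] [FiniteDimensional ℝ E]

lemma det_fderiv_eq_zero_of_norm_eq_one {r : E → E} {x : E} (hr : DifferentiableAt ℝ r x)
    (h1 : ∀ᶠ y in 𝓝 x, ‖r y‖ = 1) : (fderiv ℝ r x).det = 0 := by
  have hx : ‖r x‖ = 1 := h1.self_of_nhds
  by_contra hdet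
  have hsurj : Function.Surjective (fderiv ℝ r x) := by
    have hu : IsUnit (fderiv ℝ r x : E →ₗ[ℝ] E) :=
      (LinearMap.isUnit_iff_isUnit_det _).2 (isUnit_iff_ne_zero.2 hdet)
    exact ((Module.End.isUnit_iff _).1 hu).2
  obtain ⟨w, hw⟩ := hsurj (r x)
  have hd : HasFDerivAt (fun y => ⟪r y, r y⟫) _ x := hr.hasFDerivAt.inner ℝ hr.hasFDerivAt
  have hc : HasFDerivAt (fun y => ⟪r y, r y⟫) (0 : E →L[ℝ] ℝ) x := by
    refine (hasFDerivAt_const (1 : ℝ) x).congr_of_eventuallyEq ?_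
    filter_upwards [h1] with y hy
    rw [real_inner_self_eq_norm_sq, hy, one_pow]
  have := congrArg (fun L : E →L[ℝ] ℝ => L w) (hd.unique hc)
  simp [fderivInnerCLM_apply, hw, hx] at this

/-- For small `t`, the map `x ↦ x + t h x` permutes the unit ball when `h` is `C¹`, vanishes on the
sphere and `x + h x` stays in the ball. -/
lemma integral_det_one_add_smul_fderiv [MeasurableSpace E] [BorelSpace E] {h : E → E} {K : NNReal}
    (hC : ∀ x ∈ closedBall (0 : E) 1, ContDiffAt ℝ 1 h x)
    (hK : LipschitzOnWith K h (closedBall 0 1))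
    (hKd : ∀ x ∈ closedBall (0 : E) 1, ‖fderiv ℝ h x‖ ≤ K)
    (hS : ∀ x ∈ sphere (0 : E) 1, h x = 0)
    (hB : ∀ x ∈ closedBall (0 : E) 1, ‖x + h x‖ ≤ 1)
    {t : ℝ} (ht0 : 0 ≤ t) (ht1 : t < 1) (htK : t * K < 1) :
    ∫ x in ball (0 : E) 1, (1 + t • fderiv ℝ h x).det = volume.real (ball (0 : E) 1) := by
  set g : E → E := fun x => x + t • h x with hg
  have hbc : ball (0 : E) 1 ⊆ closedBall 0 1 := ball_subset_closedBall
  have hinj : InjOn g (closedBall 0 1) := by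
    intro x hx y hy hxy
    have h1 : x - y = t • (h y - h x) := by
      simp only [hg] at hxy
      rw [smul_sub, sub_eq_sub_iff_add_eq_add, hxy, add_comm]
    have h2 : ‖x - y‖ ≤ t * K * ‖x - y‖ := by
      conv_lhs => rw [h1]
      rw [norm_smul, Real.norm_of_nonneg ht0, mul_assoc]
      gcongr
      have := hK.dist_le_mul y hy x hx
      rwa [dist_eq_norm, dist_eq_norm, norm_sub_rev y x] at this
    have h3 : ‖x - y‖ ≤ 0 := by nlinarith [norm_nonneg (x - y)]
    exact sub_eq_zero.1 (norm_le_zero_iff.1 h3)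
  have hstrict : ∀ x ∈ closedBall (0 : E) 1,
      HasStrictFDerivAt g (1 + t • fderiv ℝ h x) x := fun x hx =>
    (hasStrictFDerivAt_id x).add (((hC x hx).hasStrictFDerivAt one_ne_zero).const_smul t)
  have hne : ∀ x ∈ closedBall (0 : E) 1, ∀ s ∈ Icc 0 t, (1 + s • fderiv ℝ h x).det ≠ 0 := by
    intro x hx s hs
    have hn : ‖-(s • fderiv ℝ h x)‖ < 1 := by
      rw [norm_neg, norm_smul, Real.norm_of_nonneg hs.1]
      calc s * ‖fderiv ℝ h x‖ ≤ t * K := by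
            gcongr
            exacts [hs.2, hKd x hx]
        _ < 1 := htK
    have hu : IsUnit (1 + s • fderiv ℝ h x) := by
      have := isUnit_one_sub_of_norm_lt_one hn
      rwa [sub_neg_eq_add] at this
    have := (hu.map (ContinuousLinearMap.toLinearMapRingHom (R₁ := ℝ) (M₁ := E)))
    exact ((LinearMap.isUnit_iff_isUnit_det _).1 this).ne_zero
  have hpos : ∀ x ∈ closedBall (0 : E) 1, 0 < (1 + t • fderiv ℝ h x).det := by
    intro x hx
    by_contra hle
    have hcont : ContinuousOn (fun s : ℝ => (1 + s • fderiv ℝ h x).det) (Icc 0 t) :=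
      (ContinuousLinearMap.continuous_det.comp (by fun_prop)).continuousOn
    have h0 : (1 + (0 : ℝ) • fderiv ℝ h x).det = 1 := by
      simp [ContinuousLinearMap.det]
    obtain ⟨s, hs, hs0⟩ := intermediate_value_Icc' ht0 hcont
      (show (0 : ℝ) ∈ Icc _ _ from ⟨not_lt.1 hle, by rw [h0]; exact zero_le_one⟩)
    exact hne x hx s hs hs0
  have hopen : IsOpen (g '' ball 0 1) := by
    rw [isOpen_iff_mem_nhds]
    rintro _ ⟨x, hx, rfl⟩
    have hu : IsUnit ((1 + t • fderiv ℝ h x : E →L[ℝ] E) : E →ₗ[ℝ] E) :=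
      (LinearMap.isUnit_iff_isUnit_det _).2 (isUnit_iff_ne_zero.2 (hpos x (hbc hx)).ne')
    have hr := LinearMap.range_eq_top.2 ((Module.End.isUnit_iff _).1 hu).2
    rw [← (hstrict x (hbc hx)).map_nhds_eq_of_surj hr]
    exact Filter.image_mem_map (isOpen_ball.mem_nhds hx)
  have hgcont : ContinuousOn g (closedBall 0 1) := fun x hx =>
    (hstrict x hx).hasFDerivAt.continuousAt.continuousWithinAt
  have hgS : ∀ x ∈ sphere (0 : E) 1, g x = x := fun x hx => by simp [hg, hS x hx]
  have hsub : g '' ball 0 1 ⊆ ball 0 1 := by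
    rintro _ ⟨x, hx, rfl⟩
    have h1 : g x = (1 - t) • x + t • (x + h x) := by
      simp only [hg]; module
    rw [mem_ball_zero_iff] at hx ⊢
    calc ‖g x‖ ≤ ‖(1 - t) • x‖ + ‖t • (x + h x)‖ := by rw [h1]; exact norm_add_le _ _
      _ = (1 - t) * ‖x‖ + t * ‖x + h x‖ := by
        rw [norm_smul, norm_smul, Real.norm_of_nonneg ht0, Real.norm_of_nonneg (by linarith)]
      _ < 1 := by
        have := hB x (by rw [mem_closedBall_zero_iff]; exact hx.le)
        nlinarith
  have himg : g '' ball 0 1 = ball 0 1 := by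
    refine hsub.antisymm ?_
    have hcl : IsClosed (g '' closedBall 0 1) :=
      ((isCompact_closedBall _ _).image_of_continuousOn hgcont).isClosed
    refine IsPreconnected.subset_left_of_subset_union hopen hcl.isOpen_compl ?_ ?_ ?_
      (convex_ball _ _).isPreconnected
    · exact disjoint_compl_right_iff_subset.2 (image_mono hbc)
    · intro y hy
      by_contra hcon
      simp only [mem_union, mem_compl_iff, not_or, not_not] at hcon
      obtain ⟨x, hx, rfl⟩ := hcon.2
      rcases (mem_closedBall_zero_iff.1 hx).lt_or_eq with hlt | heq
      · exact hcon.1 ⟨x, mem_ball_zero_iff.2 hlt, rfl⟩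
      · have hxS : x ∈ sphere (0 : E) 1 := mem_sphere_zero_iff_norm.2 heq
        rw [hgS x hxS, mem_ball_zero_iff] at hy
        linarith
    · exact ⟨g 0, hsub ⟨0, by simp, rfl⟩, 0, by simp, rfl⟩
  have hcv := integral_image_eq_integral_abs_det_fderiv_smul volume measurableSet_ball
    (fun x hx => (hstrict x (hbc hx)).hasFDerivAt.hasFDerivWithinAt) (hinj.mono hbc)
    (fun _ => (1 : ℝ))
  rw [himg] at hcv
  simp only [setIntegral_const, smul_eq_mul, mul_one] at hcv
  rw [hcv]
  refine setIntegral_congr_fun measurableSet_ball fun x hx => ?_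
  exact (abs_of_pos (hpos x (hbc hx))).symm

/-- There is no `C¹` retraction of the unit ball onto the unit sphere. -/
lemma no_contDiff_retraction {r : E → E}
    (hC : ∀ x ∈ closedBall (0 : E) 1, ContDiffAt ℝ 1 r x)
    (h1 : ∀ x ∈ closedBall (0 : E) 1, ‖r x‖ = 1)
    (hS : ∀ x ∈ sphere (0 : E) 1, r x = x) : False := by
  borelize E
  set h : E → E := fun x => r x - x with hh
  have hCh : ∀ x ∈ closedBall (0 : E) 1, ContDiffAt ℝ 1 h x := fun x hx =>
    (hC x hx).sub contDiffAt_id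
  have hfc : ContinuousOn (fderiv ℝ h) (closedBall 0 1) := fun x hx =>
    ((hCh x hx).continuousAt_fderiv one_ne_zero).continuousWithinAt
  obtain ⟨K₀, hK₀⟩ := (isCompact_closedBall (0 : E) 1).exists_bound_of_continuousOn hfc
  set K : NNReal := K₀.toNNReal
  have hKd : ∀ x ∈ closedBall (0 : E) 1, ‖fderiv ℝ h x‖ ≤ K := fun x hx =>
    (hK₀ x hx).trans (Real.le_coe_toNNReal _)
  have hK : LipschitzOnWith K h (closedBall 0 1) :=
    (convex_closedBall _ _).lipschitzOnWith_of_nnnorm_fderiv_le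
      (fun x hx => (hCh x hx).differentiableAt one_ne_zero) hKd
  set n := Module.finrank ℝ E
  let v : ℕ → ℝ := fun i => i / ((n + 1) * (K + 1))
  have hden : (0 : ℝ) < (n + 1) * (K + 1) := by positivity
  have hv : InjOn v (Finset.range (n + 1)) := by
    intro i _ j _ hij
    simpa [v, div_left_inj' hden.ne'] using hij
  have hvi : ∀ i ∈ Finset.range (n + 1), 0 ≤ v i ∧ v i < 1 ∧ v i * K < 1 := by
    intro i hi
    have hi' : (i : ℝ) + 1 ≤ n + 1 := by exact_mod_cast Finset.mem_range.1 hi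
    have hK0 : (0 : ℝ) ≤ K := K.2
    refine ⟨by positivity, ?_, ?_⟩
    · rw [div_lt_one hden]; nlinarith
    · simp only [v]
      rw [div_mul_eq_mul_div, div_lt_one hden]; nlinarith
  have h_int : ∀ t : ℝ, IntegrableOn (fun x => (1 + t • fderiv ℝ h x).det) (ball (0 : E) 1) := by
    intro t
    refine (ContinuousOn.integrableOn_compact (isCompact_closedBall _ _) ?_).mono_set
      ball_subset_closedBall
    exact ContinuousLinearMap.continuous_det.comp_continuousOn
      (continuousOn_const.add (hfc.const_smul t))
  have hvol : ∀ i ∈ Finset.range (n + 1),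
      ∫ x in ball (0 : E) 1, (1 + v i • fderiv ℝ h x).det = volume.real (ball (0 : E) 1) :=
    fun i hi => integral_det_one_add_smul_fderiv hCh hK hKd
      (fun x hx => by simp [hh, hS x hx]) (fun x hx => by simp [hh, h1 x hx])
      (hvi i hi).1 (hvi i hi).2.1 (hvi i hi).2.2
  have hone : ∫ x in ball (0 : E) 1, (1 + (1 : ℝ) • fderiv ℝ h x).det
      = volume.real (ball (0 : E) 1) := by
    simp_rw [ContinuousLinearMap.det_one_add_smul_eq_sum _ hv 1]
    rw [integral_finsetSum _ fun i _ => (h_int _).mul_const _]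
    simp_rw [integral_mul_const]
    rw [Finset.sum_congr rfl fun i hi => by rw [hvol i hi], ← Finset.mul_sum,
      ← Polynomial.eval_finsetSum, Lagrange.sum_basis hv ⟨0, by simp⟩]
    simp
  have hzero : ∫ x in ball (0 : E) 1, (1 + (1 : ℝ) • fderiv ℝ h x).det = 0 := by
    rw [setIntegral_congr_fun (g := fun _ => (0 : ℝ)) measurableSet_ball, integral_zero]
    intro x hx
    have hx' := ball_subset_closedBall hx
    have hd := (hC x hx').differentiableAt one_ne_zero
    have : (1 + (1 : ℝ) • fderiv ℝ h x) = fderiv ℝ r x := by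
      rw [hh, fderiv_fun_sub hd differentiableAt_fun_id, one_smul]
      simp only [fderiv_fun_id]
      change (1 : E →L[ℝ] E) + (fderiv ℝ r x - 1) = _
      abel
    simp only [this]
    exact det_fderiv_eq_zero_of_norm_eq_one hd
      (Filter.eventually_of_mem (isOpen_ball.mem_nhds hx) fun y hy =>
        h1 y (ball_subset_closedBall hy))
  have hpos : 0 < volume.real (ball (0 : E) 1) :=
    ENNReal.toReal_pos (measure_ball_pos _ _ one_pos).ne' measure_ball_lt_top.ne
  linarith

end Brouwer

section InvarianceOfDomain

variable {E : Type*} [NormedAddCommGroup E] [InnerProductSpace ℝ E] [FiniteDimensional ℝ E]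

lemma no_contDiff_nonvanishing_of_inner_pos {u : E → E} (hu : ContDiff ℝ 1 u)
    (h0 : ∀ x ∈ closedBall (0 : E) 1, u x ≠ 0)
    (hS : ∀ x ∈ sphere (0 : E) 1, 0 < ⟪x, u x⟫) : False := by
  set D : E → ℝ := fun x => ⟪x, u x⟫ ^ 2 + ‖u x‖ ^ 2 * (1 - ‖x‖ ^ 2) with hD
  set l : E → ℝ := fun x => (-⟪x, u x⟫ + √(D x)) / ‖u x‖ ^ 2 with hl
  have hDpos : ∀ x ∈ closedBall (0 : E) 1, 0 < D x := by
    intro x hx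
    have hux : 0 < ‖u x‖ ^ 2 := by have := norm_pos_iff.2 (h0 x hx); positivity
    rcases (mem_closedBall_zero_iff.1 hx).lt_or_eq with hlt | heq
    · have : 0 < 1 - ‖x‖ ^ 2 := by nlinarith [norm_nonneg x]
      have := mul_pos hux this
      have := sq_nonneg ⟪x, u x⟫
      simp only [hD]; linarith
    · have := hS x (mem_sphere_zero_iff_norm.2 heq)
      simp only [hD, heq]; nlinarith
  refine no_contDiff_retraction (r := fun x => x + l x • u x) ?_ ?_ ?_
  · intro x hx
    have hDc : ContDiff ℝ 1 D :=
      ((contDiff_id.inner ℝ hu).pow 2).add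
        ((hu.norm_sq ℝ).mul (contDiff_const.sub (contDiff_norm_sq ℝ)))
    have hn : ‖u x‖ ^ 2 ≠ 0 := by simpa using h0 x hx
    have hlc : ContDiffAt ℝ 1 l x :=
      (((contDiff_id.inner ℝ hu).contDiffAt.neg).add
        (hDc.contDiffAt.sqrt (hDpos x hx).ne')).div (hu.norm_sq ℝ).contDiffAt hn
    exact contDiffAt_id.add (hlc.smul hu.contDiffAt)
  · intro x hx
    have hn : ‖u x‖ ^ 2 ≠ 0 := by simpa using h0 x hx
    have hsq := Real.sq_sqrt (hDpos x hx).le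
    have : ‖x + l x • u x‖ ^ 2 = 1 := by
      rw [norm_add_sq_real, inner_smul_right, norm_smul, mul_pow, Real.norm_eq_abs, sq_abs]
      have h1 : l x * ‖u x‖ ^ 2 = -⟪x, u x⟫ + √(D x) := div_mul_cancel₀ _ hn
      have h2 : (l x * ‖u x‖ ^ 2 + ⟪x, u x⟫) ^ 2 = D x := by
        rw [h1]; linear_combination hsq
      have h3 : ‖u x‖ ^ 2 * (‖x‖ ^ 2 + 2 * (l x * ⟪x, u x⟫) + l x ^ 2 * ‖u x‖ ^ 2)
          = ‖u x‖ ^ 2 * 1 := by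
        simp only [hD] at h2; linarith
      exact mul_left_cancel₀ hn h3
    exact (pow_eq_one_iff_of_nonneg (norm_nonneg _) two_ne_zero).1 this
  · intro x hx
    have hp := hS x hx
    have : l x = 0 := by
      simp [hl, hD, mem_sphere_zero_iff_norm.1 hx, Real.sqrt_sq hp.le]
    simp [this]

/-- A continuous vector field pointing outwards along the unit sphere vanishes in the ball. -/
lemma exists_zero_of_inner_pos {H : E → E} (hH : Continuous H)
    (hS : ∀ x ∈ sphere (0 : E) 1, 0 < ⟪x, H x⟫) : ∃ x ∈ closedBall (0 : E) 1, H x = 0 := by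
  by_contra! h0
  have hlow : ∀ {s : Set E} {φ : E → ℝ}, IsCompact s → Continuous φ → (∀ x ∈ s, 0 < φ x) →
      ∃ δ > 0, ∀ x ∈ s, δ ≤ φ x := by
    intro s φ hs hφ hpos
    rcases s.eq_empty_or_nonempty with rfl | hne
    · exact ⟨1, one_pos, by simp⟩
    · obtain ⟨x, hx, hmin⟩ := hs.exists_isMinOn hne hφ.continuousOn
      exact ⟨φ x, hpos x hx, fun y hy => hmin hy⟩
  obtain ⟨δ₁, h₁, hδ₁⟩ := hlow (isCompact_closedBall (0 : E) 1) hH.norm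
    fun x hx => norm_pos_iff.2 (h0 x hx)
  obtain ⟨δ₂, h₂, hδ₂⟩ := hlow (isCompact_sphere (0 : E) 1) (continuous_id.inner hH) hS
  obtain ⟨u, hu, hdist, -⟩ := hH.exists_contDiff_approx 1 (ε := fun _ => min δ₁ δ₂)
    continuous_const (fun _ => lt_min h₁ h₂)
  refine no_contDiff_nonvanishing_of_inner_pos hu ?_ ?_
  · intro x hx hux
    have h3 := (hdist x).trans_le (min_le_left _ _)
    rw [hux, dist_zero_left] at h3
    exact absurd (hδ₁ x hx) (not_le.2 h3)
  · intro x hx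
    have h3 := (hdist x).trans_le (min_le_right _ _)
    have h4 : |⟪x, u x - H x⟫| ≤ ‖x‖ * ‖u x - H x‖ := abs_real_inner_le_norm _ _
    rw [mem_sphere_zero_iff_norm.1 hx, one_mul, ← dist_eq_norm] at h4
    have h5 := hδ₂ x hx
    rw [inner_sub_right] at h4
    have h6 := neg_le_of_abs_le h4
    simp only [id] at h5
    linarith

lemma exists_zero_of_continuousOn_of_dist_lt {H : E → E} (hH : ContinuousOn H (closedBall 0 1))
    (h1 : ∀ x ∈ closedBall (0 : E) 1, ‖H x - x‖ < 1) : ∃ x ∈ closedBall (0 : E) 1, H x = 0 := by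
  let p : E → E := fun x => (max 1 ‖x‖)⁻¹ • x
  have hmax : ∀ x : E, 0 < max 1 ‖x‖ := fun x => lt_max_of_lt_left one_pos
  have hp : Continuous p :=
    ((continuous_const.max continuous_norm).inv₀ fun x => (hmax x).ne').smul continuous_id
  have hpm : ∀ x, p x ∈ closedBall (0 : E) 1 := by
    intro x
    rw [mem_closedBall_zero_iff, norm_smul, norm_inv, Real.norm_of_nonneg (hmax x).le,
      inv_mul_le_one₀ (hmax x)]
    exact le_max_right _ _
  have hpid : ∀ x ∈ closedBall (0 : E) 1, p x = x := by
    intro x hx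
    simp [p, max_eq_left (mem_closedBall_zero_iff.1 hx)]
  obtain ⟨x, hx, hx0⟩ := exists_zero_of_inner_pos (H := H ∘ p)
    (hH.comp_continuous hp hpm) (by
      intro x hx
      have hx1 := mem_sphere_zero_iff_norm.1 hx
      have hxb := sphere_subset_closedBall hx
      simp only [Function.comp, hpid x hxb]
      have h2 : |⟪x, H x - x⟫| ≤ ‖x‖ * ‖H x - x‖ := abs_real_inner_le_norm _ _
      have h3 := h1 x hxb
      rw [inner_sub_right, real_inner_self_eq_norm_sq, hx1] at h2
      have := neg_le_of_abs_le h2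
      linarith)
  exact ⟨x, hx, by simpa [hpid x hx] using hx0⟩

/-- The image of the unit ball under a continuous injection is a neighbourhood of the image of the
centre. -/
lemma image_closedBall_mem_nhds {f : E → E} (hf : ContinuousOn f (closedBall 0 1))
    (hinj : InjOn f (closedBall 0 1)) : f '' closedBall 0 1 ∈ 𝓝 (f 0) := by
  rcases subsingleton_or_nontrivial E with hE | hE
  · have : f '' closedBall 0 1 = univ := by
      refine Set.eq_univ_of_forall fun y => ⟨0, by simp, Subsingleton.elim _ _⟩
    rw [this]; exact Filter.univ_mem
  borelize E
  set K := closedBall (0 : E) 1 with hKdef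
  have hKc : IsCompact K := isCompact_closedBall _ _
  have h0K : (0 : E) ∈ K := by simp [hKdef]
  have : TietzeExtension E := TietzeExtension.of_tvs ℝ
  have : CompactSpace K := isCompact_iff_compactSpace.1 hKc
  have hemb : IsClosedEmbedding (K.domRestrict f) :=
    (continuousOn_iff_continuous_domRestrict.1 hf).isClosedEmbedding (injOn_iff_injective.1 hinj)
  obtain ⟨G, hG⟩ := ContinuousMap.exists_extension' hemb
    (⟨Subtype.val, continuous_subtype_val⟩ : C(K, E))
  have hGf : ∀ x ∈ K, G (f x) = x := fun x hx => congrFun hG ⟨x, hx⟩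
  have hfKc : IsCompact (f '' K) := hKc.image_of_continuousOn hf
  by_contra hnot
  have hG0 : G (f 0) = 0 := hGf 0 h0K
  obtain ⟨ε, hε, hGε⟩ : ∃ ε > 0, ∀ y, dist y (f 0) < 2 * ε → ‖G y‖ < 1 / 10 := by
    have := Metric.continuous_iff.1 G.continuous (f 0) (1 / 10) (by norm_num)
    obtain ⟨η, hη, h⟩ := this
    refine ⟨η / 2, by positivity, fun y hy => ?_⟩
    have := h y (by linarith)
    rwa [hG0, dist_zero_right] at this
  obtain ⟨c, hcK, hc⟩ : ∃ c, c ∉ f '' K ∧ dist c (f 0) < ε := by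
    by_contra! hcon
    exact hnot (Filter.mem_of_superset (ball_mem_nhds (f 0) hε)
      fun y hy => by_contra fun hy' => absurd (hcon y hy') (not_le.2 hy))
  have hS1 : IsCompact (f '' K \ ball c ε) := hfKc.diff isOpen_ball
  have hGne : ∀ y ∈ f '' K \ ball c ε, G y ≠ 0 := by
    rintro _ ⟨⟨x, hx, rfl⟩, hy⟩ h
    rw [hGf x hx] at h
    subst h
    exact hy (by rwa [mem_ball, dist_comm])
  obtain ⟨δ, hδ, hδ10, hδG⟩ : ∃ δ > 0, δ ≤ 1 / 10 ∧ ∀ y ∈ f '' K \ ball c ε, δ ≤ ‖G y‖ := by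
    rcases (f '' K \ ball c ε).eq_empty_or_nonempty with he | hne
    · exact ⟨1 / 10, by norm_num, le_rfl, by simp [he]⟩
    · obtain ⟨x, hx, hmin⟩ := hS1.exists_isMinOn hne G.continuous.norm.continuousOn
      exact ⟨min ‖G x‖ (1 / 10), lt_min (norm_pos_iff.2 (hGne x hx)) (by norm_num),
        min_le_right _ _, fun y hy => (min_le_left _ _).trans (hmin hy)⟩
  obtain ⟨P, hP, hPG, -⟩ := G.continuous.exists_contDiff_approx 1 (ε := fun _ => δ / 2)
    continuous_const (fun _ => by positivity)
  have hnull : volume (P '' sphere c ε) = 0 :=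
    addHaar_image_eq_zero_of_differentiableOn_of_addHaar_eq_zero volume
      (hP.differentiable one_ne_zero).differentiableOn (Measure.addHaar_sphere volume c ε)
  obtain ⟨v, hvδ, hvP⟩ : ∃ v ∈ ball (0 : E) (δ / 2), v ∉ P '' sphere c ε := by
    by_contra! hcon
    have := measure_mono_null (fun v hv => hcon v hv) hnull
    exact (measure_ball_pos volume (0 : E) (half_pos hδ)).ne' this
  rw [mem_ball_zero_iff] at hvδ
  set Q : E → E := fun y => P y - v with hQ
  have hQG : ∀ y, ‖Q y - G y‖ < δ := by
    intro y
    have := hPG y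
    rw [dist_eq_norm] at this
    calc ‖Q y - G y‖ = ‖(P y - G y) - v‖ := by congr 1; simp only [hQ]; abel
      _ ≤ ‖P y - G y‖ + ‖v‖ := norm_sub_le _ _
      _ < δ := by linarith
  set Φ : E → E := fun y => c + max (ε / ‖y - c‖) 1 • (y - c) with hΦ
  have hne : ∀ x ∈ K, f x - c ≠ 0 := fun x hx h =>
    hcK ⟨x, hx, sub_eq_zero.1 h⟩
  have hΦfar : ∀ x ∈ K, ε ≤ dist (f x) c → Φ (f x) = f x := by
    intro x hx hd
    have : max (ε / ‖f x - c‖) 1 = 1 := by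
      refine max_eq_right ((div_le_one (norm_pos_iff.2 (hne x hx))).2 ?_)
      rwa [← dist_eq_norm]
    simp [hΦ, this]
  have hΦnear : ∀ x ∈ K, dist (f x) c < ε → Φ (f x) ∈ sphere c ε := by
    intro x hx hd
    have hn := norm_pos_iff.2 (hne x hx)
    rw [dist_eq_norm] at hd
    have : max (ε / ‖f x - c‖) 1 = ε / ‖f x - c‖ :=
      max_eq_left ((one_le_div hn).2 hd.le)
    rw [mem_sphere, dist_eq_norm, hΦ]
    simp only [this, add_sub_cancel_left]
    rw [norm_smul, Real.norm_of_nonneg (by positivity), div_mul_cancel₀ _ hn.ne']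
  have hΦc : ContinuousOn (fun x => Φ (f x)) K := by
    have h1 : ContinuousOn (fun x => f x - c) K := hf.sub continuousOn_const
    have h2 : ContinuousOn (fun x => ε / ‖f x - c‖) K :=
      continuousOn_const.div h1.norm fun x hx => norm_ne_zero_iff.2 (hne x hx)
    exact continuousOn_const.add ((h2.sup continuousOn_const).smul h1)
  obtain ⟨x, hx, hx0⟩ := exists_zero_of_continuousOn_of_dist_lt (H := fun x => Q (Φ (f x)))
    ((hP.continuous.sub continuous_const).comp_continuousOn hΦc) (by
      intro x hx
      rcases le_or_gt ε (dist (f x) c) with hd | hd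
      · have := hQG (f x)
        rw [hGf x hx] at this
        rw [hΦfar x hx hd]
        linarith
      · have h1 := hΦnear x hx hd
        have h2 := hGε (Φ (f x)) (by
          calc dist (Φ (f x)) (f 0) ≤ dist (Φ (f x)) c + dist c (f 0) := dist_triangle _ _ _
            _ < 2 * ε := by rw [mem_sphere.1 h1]; linarith)
        have h3 := hGε (f x) (by
          calc dist (f x) (f 0) ≤ dist (f x) c + dist c (f 0) := dist_triangle _ _ _
            _ < 2 * ε := by linarith)
        rw [hGf x hx] at h3
        have h4 := hQG (Φ (f x))
        calc ‖Q (Φ (f x)) - x‖ = ‖(Q (Φ (f x)) - G (Φ (f x))) + G (Φ (f x)) - x‖ := by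
              congr 1; abel
          _ ≤ ‖Q (Φ (f x)) - G (Φ (f x))‖ + ‖G (Φ (f x))‖ + ‖x‖ :=
              (norm_sub_le _ _).trans (by gcongr; exact norm_add_le _ _)
          _ < 1 := by linarith)
  rcases le_or_gt ε (dist (f x) c) with hd | hd
  · simp only [hΦfar x hx hd] at hx0
    have h1 := hQG (f x)
    rw [hx0, zero_sub, norm_neg] at h1
    exact absurd (hδG (f x) ⟨⟨x, hx, rfl⟩, by simpa using hd⟩) (not_le.2 h1)
  · exact hvP ⟨_, hΦnear x hx hd, sub_eq_zero.1 hx0⟩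

/-- **Invariance of domain.** -/
theorem isOpen_image_of_continuousOn_injOn {E F : Type*} [NormedAddCommGroup E] [NormedSpace ℝ E]
    [FiniteDimensional ℝ E] [NormedAddCommGroup F] [NormedSpace ℝ F] [FiniteDimensional ℝ F]
    (hEF : Module.finrank ℝ E = Module.finrank ℝ F) {U : Set E} (hU : IsOpen U) {f : E → F}
    (hf : ContinuousOn f U) (hinj : InjOn f U) : IsOpen (f '' U) := by
  let e : E ≃L[ℝ] EuclideanSpace ℝ (Fin (Module.finrank ℝ E)) :=
    ContinuousLinearEquiv.ofFinrankEq (by simp)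
  let e' : F ≃L[ℝ] EuclideanSpace ℝ (Fin (Module.finrank ℝ E)) :=
    ContinuousLinearEquiv.ofFinrankEq (by simp [hEF])
  rw [isOpen_iff_mem_nhds]
  rintro _ ⟨x, hx, rfl⟩
  have hU' : e.symm ⁻¹' U ∈ 𝓝 (e x) :=
    (hU.preimage e.symm.continuous).mem_nhds (by simpa using hx)
  obtain ⟨δ, hδ, hball⟩ := Metric.nhds_basis_closedBall.mem_iff.1 hU'
  let a : EuclideanSpace ℝ (Fin (Module.finrank ℝ E)) → E := fun z => e.symm (e x + δ • z)
  have ha : Continuous a := by fun_prop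
  have hmaps : MapsTo a (closedBall 0 1) U := by
    intro z hz
    refine hball (a := e x + δ • z) ?_
    rw [mem_closedBall, dist_eq_norm, add_sub_cancel_left, norm_smul, Real.norm_of_nonneg hδ.le]
    have := mem_closedBall_zero_iff.1 hz
    nlinarith
  have hainj : Function.Injective a := by
    intro z w hzw
    have := add_left_cancel (e.symm.injective hzw)
    exact smul_right_injective _ hδ.ne' this
  have key := image_closedBall_mem_nhds (f := fun z => e' (f (a z)))
    (e'.continuous.comp_continuousOn (hf.comp ha.continuousOn hmaps))
    (e'.injective.injOn.comp (hinj.comp hainj.injOn hmaps) (mapsTo_univ _ _))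
  have ha0 : a 0 = x := by simp [a]
  rw [ha0] at key
  have h2 := e'.continuous.continuousAt.preimage_mem_nhds key
  refine Filter.mem_of_superset h2 ?_
  rintro y ⟨z, hz, hzy⟩
  exact ⟨a z, hmaps hz, e'.injective hzy⟩

/-- **Invariance of dimension.** -/
theorem not_injOn_of_finrank_lt {E F : Type*} [NormedAddCommGroup E] [NormedSpace ℝ E]
    [FiniteDimensional ℝ E] [NormedAddCommGroup F] [NormedSpace ℝ F] [FiniteDimensional ℝ F]
    (hEF : Module.finrank ℝ F < Module.finrank ℝ E) {U : Set E} (hU : IsOpen U)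
    (hne : U.Nonempty) {f : E → F} (hf : ContinuousOn f U) : ¬ InjOn f U := by
  intro hinj
  obtain ⟨j, hj⟩ : ∃ j : F →ₗ[ℝ] E, Function.Injective j :=
    Module.Free.exists_linearMap_injective_of_lift_rank_lt (by
      rw [← Module.finrank_eq_rank, ← Module.finrank_eq_rank]
      simp only [Cardinal.lift_natCast]
      exact_mod_cast hEF)
  have hjc : Continuous j := j.continuous_of_finiteDimensional
  have hopen := isOpen_image_of_continuousOn_injOn rfl hU
    (hjc.comp_continuousOn hf) (hj.injOn.comp hinj (mapsTo_univ _ _))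
  have hsub : (fun x => j (f x)) '' U ⊆ (LinearMap.range j : Set E) := by
    rintro _ ⟨x, -, rfl⟩
    exact ⟨f x, rfl⟩
  have htop : LinearMap.range j = ⊤ :=
    (LinearMap.range j).eq_top_of_nonempty_interior'
      ((hne.image _).mono (interior_maximal hsub hopen))
  have := LinearMap.finrank_range_of_inj hj
  rw [htop, finrank_top] at this
  omega

end InvarianceOfDomain

section HomeoOn

/-- `φ` and `ψ` restrict to mutually inverse homeomorphisms between `X` and `T`. -/
structure HomeoOn {α β : Type*} [TopologicalSpace α] [TopologicalSpace β] (φ : α → β) (ψ : β → α)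
    (X : Set α) (T : Set β) : Prop where
  mapsTo : MapsTo φ X T
  mapsTo_symm : MapsTo ψ T X
  continuousOn : ContinuousOn φ X
  continuousOn_symm : ContinuousOn ψ T
  left_inv : LeftInvOn ψ φ X
  right_inv : LeftInvOn φ ψ T

lemma Homeomorph.exists_homeoOn {α β : Type*} [TopologicalSpace α] [TopologicalSpace β]
    [Nonempty α] [Nonempty β] {X : Set α} {T : Set β} (e : X ≃ₜ T) :
    ∃ φ ψ, HomeoOn φ ψ X T := by
  classical
  obtain ⟨a⟩ := ‹Nonempty α›
  obtain ⟨b⟩ := ‹Nonempty β›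
  have h1 : ∀ x : X, (if h : (x : α) ∈ X then (e ⟨x, h⟩ : β) else b) = e x := fun x => by simp
  have h2 : ∀ y : T, (if h : (y : β) ∈ T then (e.symm ⟨y, h⟩ : α) else a) = e.symm y :=
    fun x => by simp
  refine ⟨fun x => if h : x ∈ X then e ⟨x, h⟩ else b,
    fun y => if h : y ∈ T then e.symm ⟨y, h⟩ else a, ?_, ?_, ?_, ?_, ?_, ?_⟩
  · intro x hx; simp [hx]
  · intro x hx; simp [hx]
  · rw [continuousOn_iff_continuous_domRestrict]
    refine (continuous_subtype_val.comp e.continuous).congr fun x => (h1 x).symm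
  · rw [continuousOn_iff_continuous_domRestrict]
    refine (continuous_subtype_val.comp e.symm.continuous).congr fun x => (h2 x).symm
  · intro x hx; simp [hx]
  · intro x hx; simp [hx]

lemma HomeoOn.injOn {α β : Type*} [TopologicalSpace α] [TopologicalSpace β] {φ : α → β} {ψ : β → α}
    {X : Set α} {T : Set β} (h : HomeoOn φ ψ X T) : InjOn φ X := h.left_inv.injOn

lemma HomeoOn.injOn_symm {α β : Type*} [TopologicalSpace α] [TopologicalSpace β] {φ : α → β}
    {ψ : β → α} {X : Set α} {T : Set β} (h : HomeoOn φ ψ X T) : InjOn ψ T := h.right_inv.injOn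

end HomeoOn

section Cone

/-- The punctured cone over the realization of `K`: nonzero nonnegative vectors supported on a face
of `K`. -/
def coneOver (K : Set (Finset ℕ)) : Set (ℕ → ℝ) :=
  {f | (∀ i, 0 ≤ f i) ∧ f ≠ 0 ∧ ∃ s ∈ K, ∀ i, f i ≠ 0 → i ∈ s}

/-- `f` is positive on `s` and vanishes elsewhere. -/
def PosOn (s : Finset ℕ) (f : ℕ → ℝ) : Prop :=
  (∀ i ∈ s, 0 < f i) ∧ ∀ i ∉ s, f i = 0

variable {K : Set (Finset ℕ)} {N : Finset ℕ} {f g : ℕ → ℝ} {s : Finset ℕ}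

lemma PosOn.mem_coneOver (hf : PosOn s f) (hs : s ∈ K) (hne : s.Nonempty) : f ∈ coneOver K := by
  refine ⟨fun i => ?_, ?_, s, hs, fun i hi => by_contra fun h => hi (hf.2 i h)⟩
  · by_cases hi : i ∈ s
    exacts [(hf.1 i hi).le, (hf.2 i hi).ge]
  · obtain ⟨i, hi⟩ := hne
    intro h
    have := hf.1 i hi
    simp [h] at this

lemma exists_posOn_of_mem_coneOver (hK : IsComplex K) (hf : f ∈ coneOver K) :
    ∃ s ∈ K, s.Nonempty ∧ PosOn s f := by
  obtain ⟨h0, hne, t, ht, hsup⟩ := hf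
  refine ⟨t.filter fun i => f i ≠ 0, hK t ht _ (Finset.filter_subset _ _), ?_, ?_, ?_⟩
  · obtain ⟨i, hi⟩ := Function.ne_iff.1 hne
    exact ⟨i, Finset.mem_filter.2 ⟨hsup i hi, hi⟩⟩
  · intro i hi
    exact lt_of_le_of_ne (h0 i) (Finset.mem_filter.1 hi).2.symm
  · intro i hi
    by_contra hfi
    exact hi (Finset.mem_filter.2 ⟨hsup i hfi, hfi⟩)

lemma smul_mem_coneOver {r : ℝ} (hr : 0 < r) (hf : f ∈ coneOver K) : r • f ∈ coneOver K := by
  obtain ⟨h0, hne, s, hs, hsup⟩ := hf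
  refine ⟨fun i => mul_nonneg hr.le (h0 i), smul_ne_zero hr.ne' hne, s, hs, fun i hi => hsup i ?_⟩
  intro h
  simp [h] at hi

lemma sum_pos_of_mem_coneOver (hN : ∀ s ∈ K, s ⊆ N) (hf : f ∈ coneOver K) :
    0 < ∑ i ∈ N, f i := by
  obtain ⟨h0, hne, s, hs, hsup⟩ := hf
  obtain ⟨i, hi⟩ := Function.ne_iff.1 hne
  exact Finset.sum_pos' (fun j _ => h0 j) ⟨i, hN s hs (hsup i hi), lt_of_le_of_ne (h0 i) hi.symm⟩

lemma mem_spaceOf_iff (hN : ∀ s ∈ K, s ⊆ N) :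
    f ∈ spaceOf K ↔ f ∈ coneOver K ∧ ∑ i ∈ N, f i = 1 := by
  have hsum : ∀ s ∈ K, (∀ i, f i ≠ 0 → i ∈ s) → ∑ i ∈ s, f i = ∑ i ∈ N, f i :=
    fun s hs hsup => Finset.sum_subset (hN s hs) fun i _ hi =>
      by_contra fun h => hi (hsup i h)
  constructor
  · rintro ⟨h0, s, hs, hsup, h1⟩
    refine ⟨⟨h0, ?_, s, hs, hsup⟩, by rw [← hsum s hs hsup, h1]⟩
    rintro rfl
    simp at h1
  · rintro ⟨⟨h0, -, s, hs, hsup⟩, h1⟩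
    exact ⟨h0, s, hs, hsup, by rw [hsum s hs hsup, h1]⟩

lemma inv_sum_smul_mem_spaceOf (hN : ∀ s ∈ K, s ⊆ N) (hf : f ∈ coneOver K) :
    (∑ i ∈ N, f i)⁻¹ • f ∈ spaceOf K := by
  have hp := sum_pos_of_mem_coneOver hN hf
  refine (mem_spaceOf_iff hN).2 ⟨smul_mem_coneOver (inv_pos.2 hp) hf, ?_⟩
  simp [← Finset.mul_sum, inv_mul_cancel₀ hp.ne']

lemma continuous_sum_coord (N : Finset ℕ) : Continuous fun f : ℕ → ℝ => ∑ i ∈ N, f i :=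
  continuous_finsetSum _ fun i _ => continuous_apply i

lemma continuousOn_inv_sum_smul (hN : ∀ s ∈ K, s ⊆ N) :
    ContinuousOn (fun f : ℕ → ℝ => (∑ i ∈ N, f i)⁻¹ • f) (coneOver K) :=
  ((continuous_sum_coord N).continuousOn.inv₀
    fun _ hf => (sum_pos_of_mem_coneOver hN hf).ne').smul continuousOn_id

variable {V : Type*} [NormedAddCommGroup V] {φ : (ℕ → ℝ) → V}
  {ψ : V → (ℕ → ℝ)}

lemma HomeoOn.cone_sphere [NormedSpace ℝ V] (hN : ∀ s ∈ K, s ⊆ N)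
    (h : HomeoOn φ ψ (spaceOf K) (sphere 0 1)) :
    HomeoOn (fun f => (∑ i ∈ N, f i) • φ ((∑ i ∈ N, f i)⁻¹ • f)) (fun y => ‖y‖ • ψ (‖y‖⁻¹ • y))
      (coneOver K) {0}ᶜ := by
  have hφ1 : ∀ f ∈ coneOver K, ‖φ ((∑ i ∈ N, f i)⁻¹ • f)‖ = 1 := fun f hf =>
    mem_sphere_zero_iff_norm.1 (h.mapsTo (inv_sum_smul_mem_spaceOf hN hf))
  have hy1 : ∀ y ∈ ({0}ᶜ : Set V), ‖y‖⁻¹ • y ∈ sphere (0 : V) 1 := by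
    intro y hy
    rw [mem_sphere_zero_iff_norm, norm_smul, norm_inv, norm_norm,
      inv_mul_cancel₀ (norm_ne_zero_iff.2 hy)]
  have hψ : ∀ y ∈ ({0}ᶜ : Set V), ψ (‖y‖⁻¹ • y) ∈ coneOver K ∧ ∑ i ∈ N, ψ (‖y‖⁻¹ • y) i = 1 :=
    fun y hy => (mem_spaceOf_iff hN).1 (h.mapsTo_symm (hy1 y hy))
  refine ⟨?_, ?_, ?_, ?_, ?_, ?_⟩
  · intro f hf
    exact smul_ne_zero (sum_pos_of_mem_coneOver hN hf).ne' (norm_ne_zero_iff.1 (by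
      rw [hφ1 f hf]; exact one_ne_zero))
  · intro y hy
    exact smul_mem_coneOver (norm_pos_iff.2 hy) (hψ y hy).1
  · exact (continuous_sum_coord N).continuousOn.smul (h.continuousOn.comp
      (continuousOn_inv_sum_smul hN) fun f hf => inv_sum_smul_mem_spaceOf hN hf)
  · exact continuousOn_id.norm.smul (h.continuousOn_symm.comp
      ((continuousOn_id.norm.inv₀ fun y hy => norm_ne_zero_iff.2 hy).smul continuousOn_id) hy1)
  · intro f hf
    have hp := sum_pos_of_mem_coneOver hN hf
    simp only [norm_smul, hφ1 f hf, Real.norm_of_nonneg hp.le, mul_one, smul_smul,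
      inv_mul_cancel₀ hp.ne', one_smul]
    rw [h.left_inv (inv_sum_smul_mem_spaceOf hN hf), smul_smul, mul_inv_cancel₀ hp.ne', one_smul]
  · intro y hy
    have hn := norm_ne_zero_iff.2 hy
    simp only [Pi.smul_apply, smul_eq_mul, ← Finset.mul_sum, (hψ y hy).2, mul_one, smul_smul,
      inv_mul_cancel₀ hn, one_smul]
    rw [h.right_inv (hy1 y hy), smul_smul, mul_inv_cancel₀ hn, one_smul]

lemma HomeoOn.cone_closedBall (hN : ∀ s ∈ K, s ⊆ N)
    (h : HomeoOn φ ψ (spaceOf K) (closedBall 0 1)) :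
    HomeoOn (fun f => (φ ((∑ i ∈ N, f i)⁻¹ • f), ∑ i ∈ N, f i)) (fun y : V × ℝ => y.2 • ψ y.1)
      (coneOver K) (closedBall 0 1 ×ˢ Ioi 0) := by
  refine ⟨?_, ?_, ?_, ?_, ?_, ?_⟩
  · intro f hf
    exact ⟨h.mapsTo (inv_sum_smul_mem_spaceOf hN hf), sum_pos_of_mem_coneOver hN hf⟩
  · intro y hy
    exact smul_mem_coneOver hy.2 ((mem_spaceOf_iff hN).1 (h.mapsTo_symm hy.1)).1
  · exact (h.continuousOn.comp (continuousOn_inv_sum_smul hN)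
      fun f hf => inv_sum_smul_mem_spaceOf hN hf).prodMk (continuous_sum_coord N).continuousOn
  · exact continuousOn_snd.smul (h.continuousOn_symm.comp continuousOn_fst fun y hy => hy.1)
  · intro f hf
    have hp := sum_pos_of_mem_coneOver hN hf
    simp only
    rw [h.left_inv (inv_sum_smul_mem_spaceOf hN hf), smul_smul, mul_inv_cancel₀ hp.ne', one_smul]
  · intro y hy
    have h1 := ((mem_spaceOf_iff hN).1 (h.mapsTo_symm hy.1)).2
    have h2 : y.2 ≠ 0 := ne_of_gt hy.2
    ext1
    · simp only [Pi.smul_apply, smul_eq_mul, ← Finset.mul_sum, h1, mul_one, smul_smul,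
        inv_mul_cancel₀ h2, one_smul]
      exact h.right_inv hy.1
    · simp only [Pi.smul_apply, smul_eq_mul, ← Finset.mul_sum, h1, mul_one]

end Cone

section Faces

open Module

/-- Extension by zero of a vector indexed by `s`. -/
noncomputable def extendZero (s : Finset ℕ) (x : s → ℝ) (i : ℕ) : ℝ :=
  if h : i ∈ s then x ⟨i, h⟩ else 0

lemma extendZero_of_mem {s : Finset ℕ} (x : s → ℝ) {i : ℕ} (h : i ∈ s) :
    extendZero s x i = x ⟨i, h⟩ := dif_pos h

lemma extendZero_of_notMem {s : Finset ℕ} (x : s → ℝ) {i : ℕ} (h : i ∉ s) :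
    extendZero s x i = 0 := dif_neg h

lemma continuous_extendZero (s : Finset ℕ) : Continuous (extendZero s) := by
  refine continuous_pi fun i => ?_
  by_cases h : i ∈ s
  · simp only [extendZero, h, dite_true]
    exact continuous_apply _
  · simp only [extendZero, h, dite_false]
    exact continuous_const

lemma extendZero_injective (s : Finset ℕ) : Function.Injective (extendZero s) := by
  intro x y h
  ext i
  have := congr_fun h i
  rwa [extendZero_of_mem x i.2, extendZero_of_mem y i.2] at this

lemma posOn_extendZero {s : Finset ℕ} {x : s → ℝ} (hx : ∀ i, 0 < x i) :
    PosOn s (extendZero s x) :=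
  ⟨fun i hi => by rw [extendZero_of_mem x hi]; exact hx _,
    fun i hi => extendZero_of_notMem x hi⟩

lemma PosOn.extendZero_eq {s : Finset ℕ} {f : ℕ → ℝ} (hf : PosOn s f) :
    extendZero s (fun i => f i) = f := by
  ext i
  by_cases hi : i ∈ s
  · rw [extendZero_of_mem _ hi]
  · rw [extendZero_of_notMem _ hi, hf.2 i hi]

lemma isOpen_forall_pos {ι : Type*} [Finite ι] : IsOpen {x : ι → ℝ | ∀ i, 0 < x i} := by
  simp only [ofPred_forall]
  exact isOpen_iInter_of_finite fun i => isOpen_lt continuous_const (continuous_apply i)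

lemma ContinuousOn.isOpen_inter_forall_pos {X : Type*} [TopologicalSpace X] {O : Set X}
    {Ψ : X → ℕ → ℝ} (hO : IsOpen O) (hΨ : ContinuousOn Ψ O) (s : Finset ℕ) :
    IsOpen {y ∈ O | ∀ i ∈ s, 0 < Ψ y i} := by
  have h1 : IsOpen {f : ℕ → ℝ | ∀ i ∈ s, 0 < f i} := by
    simp only [ofPred_forall]
    exact isOpen_biInter_finset fun i _ => isOpen_lt continuous_const (continuous_apply i)
  exact hΨ.isOpen_inter_preimage hO h1

lemma injOn_restrict {X : Type*} {Ψ : X → ℕ → ℝ} {O : Set X} {F : Finset ℕ} (hi : InjOn Ψ O) 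
    (hsup : ∀ y ∈ O, ∀ i, Ψ y i ≠ 0 → i ∈ F) :
    InjOn (fun y (i : F) => Ψ y i) O := by
  intro y hy z hz h
  refine hi hy hz (funext fun i => ?_)
  by_cases hiF : i ∈ F
  · exact congr_fun h ⟨i, hiF⟩
  · rw [by_contra fun h => hiF (hsup y hy i h), by_contra fun h => hiF (hsup z hz i h)]

lemma continuousOn_restrict {X : Type*} [TopologicalSpace X] {Ψ : X → ℕ → ℝ} {O : Set X}
    {F : Finset ℕ} (hc : ContinuousOn Ψ O) :
    ContinuousOn (fun y (i : F) => Ψ y i) O :=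
  continuousOn_pi.2 fun i => continuousOn_pi.1 hc i

variable {K : Set (Finset ℕ)} {N s F ρ : Finset ℕ} {f : ℕ → ℝ}
  {E : Type*} [NormedAddCommGroup E] [NormedSpace ℝ E] [FiniteDimensional ℝ E]
  {Φ : (ℕ → ℝ) → E} {Ψ : E → (ℕ → ℝ)} {T O : Set E}

lemma PosOn.subset_of_support_subset (hf : PosOn s f) (h : ∀ i, f i ≠ 0 → i ∈ F) : s ⊆ F :=
  fun i hi => h i (hf.1 i hi).ne'

lemma PosOn.support_subset (hf : PosOn s f) : ∀ i, f i ≠ 0 → i ∈ s :=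
  fun i hi => by_contra fun h => hi (hf.2 i h)

lemma exists_posOn_map_mem {X : Type*} [TopologicalSpace X] {Φ : (ℕ → ℝ) → X} {U : Set X}
    (hΦ : ContinuousOn Φ (coneOver K)) (hs : s ∈ K)
    (hf : f ∈ coneOver K) (hsup : ∀ i, f i ≠ 0 → i ∈ s) (hU : IsOpen U) (hfU : Φ f ∈ U) :
    ∃ g, PosOn s g ∧ Φ g ∈ U := by
  classical
  obtain ⟨h0, hne, -⟩ := hf
  obtain ⟨j, hj⟩ := Function.ne_iff.1 hne
  let γ : ℝ → ℕ → ℝ := fun ε i => f i + if i ∈ s then ε else 0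
  have hγ0 : γ 0 = f := by ext i; simp [γ]
  have hγc : Continuous γ := by
    refine continuous_pi fun i => ?_
    by_cases hi : i ∈ s
    · simp only [γ, hi, if_true]; fun_prop
    · simp only [γ, hi, if_false]; fun_prop
  have hmem : MapsTo γ (Ici 0) (coneOver K) := by
    intro ε hε
    refine ⟨fun i => ?_, ?_, s, hs, fun i hi => ?_⟩
    · refine add_nonneg (h0 i) ?_
      split_ifs
      exacts [hε, le_rfl]
    · refine Function.ne_iff.2 ⟨j, ?_⟩
      have h1 : 0 < f j := lt_of_le_of_ne (h0 j) hj.symm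
      have h2 : (0 : ℝ) ≤ ε := hε
      simp only [γ, hsup j hj, if_true, Pi.zero_apply]
      positivity
    · by_contra his
      have : f i = 0 := by_contra fun h => his (hsup i h)
      exact hi (by simp [γ, his, this])
  have hc : ContinuousWithinAt (Φ ∘ γ) (Ici 0) 0 :=
    (hΦ.comp hγc.continuousOn hmem) 0 self_mem_Ici
  have hev : ∀ᶠ ε in 𝓝[>] (0 : ℝ), Φ (γ ε) ∈ U := by
    have h1 : (Φ ∘ γ) 0 ∈ U := by simpa [hγ0] using hfU
    exact nhdsWithin_mono 0 Ioi_subset_Ici_self (hc.eventually (hU.mem_nhds h1))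
  obtain ⟨ε, hε, hε0⟩ := (hev.and self_mem_nhdsWithin).exists
  have hε0 : 0 < ε := hε0
  refine ⟨γ ε, ⟨fun i hi => ?_, fun i hi => ?_⟩, hε⟩
  · have := h0 i
    simp only [γ, hi, if_true]
    positivity
  · have : f i = 0 := by_contra fun h => hi (hsup i h)
    simp [γ, hi, this]

lemma finrank_le_card_of_support_subset (hO : IsOpen O) (hne : O.Nonempty) (hc : ContinuousOn Ψ O)
    (hi : InjOn Ψ O) (hsup : ∀ y ∈ O, ∀ i, Ψ y i ≠ 0 → i ∈ F) : finrank ℝ E ≤ F.card := by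
  by_contra! h
  refine not_injOn_of_finrank_lt (F := F → ℝ) ?_ hO hne (continuousOn_restrict hc)
    (injOn_restrict hi hsup)
  rwa [finrank_fintype_fun_eq_card, Fintype.card_coe]

lemma HomeoOn.card_le (h : HomeoOn Φ Ψ (coneOver K) T) (hs : s ∈ K) : s.card ≤ finrank ℝ E := by
  rcases s.eq_empty_or_nonempty with rfl | hne
  · simp
  by_contra! hlt
  have hm : MapsTo (extendZero s) {x | ∀ i, 0 < x i} (coneOver K) :=
    fun x hx => (posOn_extendZero hx).mem_coneOver hs hne
  refine not_injOn_of_finrank_lt (E := s → ℝ) (F := E) (f := Φ ∘ extendZero s) ?_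
    isOpen_forall_pos ⟨1, fun i => one_pos⟩
    (h.continuousOn.comp (continuous_extendZero s).continuousOn hm)
    (h.injOn.comp (extendZero_injective s).injOn hm)
  rwa [finrank_fintype_fun_eq_card, Fintype.card_coe]

lemma HomeoOn.card_eq_of_maximal (hK : IsComplex K) (h : HomeoOn Φ Ψ (coneOver K) T)
    (hT : T ⊆ closure (interior T)) (hF : F ∈ K) (hne : F.Nonempty)
    (hmax : ∀ G ∈ K, F ⊆ G → G = F) : F.card = finrank ℝ E := by
  refine (h.card_le hF).antisymm ?_
  have hp : PosOn F (extendZero F fun _ => 1) := posOn_extendZero fun _ => one_pos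
  have hmem := hp.mem_coneOver hF hne
  have hcont : ContinuousOn Ψ (interior T) := h.continuousOn_symm.mono interior_subset
  have hO := hcont.isOpen_inter_forall_pos isOpen_interior F
  refine finrank_le_card_of_support_subset hO ?_ (hcont.mono fun y hy => hy.1)
    (h.injOn_symm.mono fun y hy => interior_subset hy.1) ?_
  · have h1 : ∀ᶠ y in 𝓝[T] (Φ (extendZero F fun _ => 1)), ∀ i ∈ F, 0 < Ψ y i := by
      rw [Filter.eventually_all_finset]
      intro i hi
      have h2 := continuousOn_pi.1 h.continuousOn_symm i _ (h.mapsTo hmem)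
      refine h2.eventually (lt_mem_nhds ?_)
      simpa only [h.left_inv hmem] using hp.1 i hi
    have h3 := hT (h.mapsTo hmem)
    rw [mem_closure_iff_nhdsWithin_neBot] at h3
    have h4 := h1.filter_mono (nhdsWithin_mono _ interior_subset)
    obtain ⟨y, hy, hy'⟩ := (h4.and self_mem_nhdsWithin).exists
    exact ⟨y, hy', hy⟩
  · intro y hy
    obtain ⟨t, ht, -, hpt⟩ := exists_posOn_of_mem_coneOver hK (h.mapsTo_symm (interior_subset hy.1))
    have := hmax t ht fun i hi => hpt.support_subset i (hy.2 i hi).ne'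
    rw [← this]
    exact hpt.support_subset

lemma HomeoOn.exists_facet (hK : IsComplex K) (hN : ∀ s ∈ K, s ⊆ N)
    (h : HomeoOn Φ Ψ (coneOver K) T) (hT : T ⊆ closure (interior T)) (hT0 : T.Nonempty)
    (hs : s ∈ K) : ∃ F ∈ K, s ⊆ F ∧ F.card = finrank ℝ E := by
  classical
  obtain ⟨F, hF, hmax⟩ := (N.powerset.filter fun F => F ∈ K ∧ s ⊆ F).exists_max_image Finset.card
    ⟨s, by simp [hs, hN s hs]⟩
  simp only [Finset.mem_filter, Finset.mem_powerset] at hF hmax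
  have hmax' : ∀ G ∈ K, F ⊆ G → G = F := fun G hG hFG =>
    (Finset.eq_of_subset_of_card_le hFG (hmax G ⟨hN G hG, hG, hF.2.2.trans hFG⟩)).symm
  refine ⟨F, hF.2.1, hF.2.2, h.card_eq_of_maximal hK hT hF.2.1 ?_ hmax'⟩
  obtain ⟨y, hy⟩ := hT0
  obtain ⟨t, ht, hne, -⟩ := exists_posOn_of_mem_coneOver hK (h.mapsTo_symm hy)
  by_contra hFe
  rw [Finset.not_nonempty_iff_eq_empty] at hFe
  rw [hmax' t ht (by simp [hFe]), hFe] at hne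
  exact Finset.not_nonempty_empty hne

lemma HomeoOn.map_mem_interior_of_facet (h : HomeoOn Φ Ψ (coneOver K) T) (hF : F ∈ K)
    (hne : F.Nonempty) (hcard : F.card = finrank ℝ E) (hf : PosOn F f) : Φ f ∈ interior T := by
  have hm : MapsTo (extendZero F) {x | ∀ i, 0 < x i} (coneOver K) :=
    fun x hx => (posOn_extendZero hx).mem_coneOver hF hne
  have hopen := isOpen_image_of_continuousOn_injOn (E := F → ℝ) (F := E) (f := Φ ∘ extendZero F)
    (by rw [finrank_fintype_fun_eq_card, Fintype.card_coe, hcard])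
    isOpen_forall_pos
    (h.continuousOn.comp (continuous_extendZero F).continuousOn hm)
    (h.injOn.comp (extendZero_injective F).injOn hm)
  refine mem_interior.2 ⟨_, ?_, hopen, ⟨fun i => f i, fun i => hf.1 i i.2, ?_⟩⟩
  · rintro _ ⟨x, hx, rfl⟩
    exact h.mapsTo (hm hx)
  · simp [hf.extendZero_eq]

lemma HomeoOn.map_mem_interior_of_ridge (h : HomeoOn Φ Ψ (coneOver K) T) {a b : ℕ} (hab : a ≠ b)
    (ha : a ∉ ρ) (hb : b ∉ ρ) (haK : insert a ρ ∈ K) (hbK : insert b ρ ∈ K) (hne : ρ.Nonempty)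
    (hcard : ρ.card + 1 = finrank ℝ E) (hf : PosOn ρ f) : Φ f ∈ interior T := by
  let G : (ρ → ℝ) × ℝ → ℕ → ℝ := fun p i =>
    extendZero ρ p.1 i + (if i = a then max p.2 0 else 0) + (if i = b then max (-p.2) 0 else 0)
  let U : Set ((ρ → ℝ) × ℝ) := {x | ∀ i, 0 < x i} ×ˢ univ
  have hGc : Continuous G := by
    refine continuous_pi fun i => ?_
    refine (((continuous_apply i).comp ((continuous_extendZero ρ).comp continuous_fst)).add ?_).add
      ?_ <;> split_ifs <;> fun_prop
  have hGρ : ∀ p, ∀ i (hi : i ∈ ρ), G p i = p.1 ⟨i, hi⟩ := by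
    intro p i hi
    have h1 : i ≠ a := fun h => ha (h ▸ hi)
    have h2 : i ≠ b := fun h => hb (h ▸ hi)
    simp [G, h1, h2, extendZero_of_mem _ hi]
  have hGa : ∀ p, G p a = max p.2 0 := fun p => by simp [G, hab, extendZero_of_notMem _ ha]
  have hGb : ∀ p, G p b = max (-p.2) 0 := fun p => by
    simp [G, hab.symm, extendZero_of_notMem _ hb]
  have hG0 : ∀ p, ∀ i ∉ ρ, i ≠ a → i ≠ b → G p i = 0 := fun p i hi h1 h2 => by
    simp [G, h1, h2, extendZero_of_notMem _ hi]
  have hGi : Function.Injective G := by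
    rintro ⟨x, t⟩ ⟨y, u⟩ hxy
    have h1 := congr_fun hxy a
    have h2 := congr_fun hxy b
    rw [hGa, hGa] at h1
    rw [hGb, hGb] at h2
    refine Prod.ext (funext fun i => ?_) ?_
    · have := congr_fun hxy i
      rwa [hGρ _ _ i.2, hGρ _ _ i.2] at this
    · simp only at h1 h2 ⊢
      rcases max_cases t 0 with h3 | h3 <;> rcases max_cases u 0 with h4 | h4 <;>
        rcases max_cases (-t) 0 with h5 | h5 <;> rcases max_cases (-u) 0 with h6 | h6 <;> linarith
  have hm : MapsTo G U (coneOver K) := by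
    rintro p ⟨hp, -⟩
    refine ⟨fun i => ?_, ?_, ?_⟩
    · by_cases hi : i ∈ ρ
      · rw [hGρ p i hi]; exact (hp _).le
      by_cases h1 : i = a
      · rw [h1, hGa]; exact le_max_right _ _
      by_cases h2 : i = b
      · rw [h2, hGb]; exact le_max_right _ _
      exact (hG0 p i hi h1 h2).ge
    · obtain ⟨j, hj⟩ := hne
      refine Function.ne_iff.2 ⟨j, ?_⟩
      rw [hGρ p j hj]
      exact (hp _).ne'
    · rcases le_total 0 p.2 with ht | ht
      · refine ⟨_, haK, fun i hi => ?_⟩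
        by_contra hcon
        rw [Finset.mem_insert, not_or] at hcon
        by_cases h2 : i = b
        · exact hi (by rw [h2, hGb, max_eq_right (by linarith)])
        · exact hi (hG0 p i hcon.2 hcon.1 h2)
      · refine ⟨_, hbK, fun i hi => ?_⟩
        by_contra hcon
        rw [Finset.mem_insert, not_or] at hcon
        by_cases h2 : i = a
        · exact hi (by rw [h2, hGa, max_eq_right ht])
        · exact hi (hG0 p i hcon.2 h2 hcon.1)
  have hopen := isOpen_image_of_continuousOn_injOn (F := E) (f := Φ ∘ G) (U := U)
    (by rw [finrank_prod, finrank_fintype_fun_eq_card, Fintype.card_coe, finrank_self, hcard])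
    (isOpen_forall_pos.prod isOpen_univ)
    (h.continuousOn.comp hGc.continuousOn hm) (h.injOn.comp hGi.injOn hm)
  refine mem_interior.2 ⟨_, ?_, hopen, ⟨(fun i => f i, 0), ⟨fun i => hf.1 i i.2, trivial⟩, ?_⟩⟩
  · rintro _ ⟨x, hx, rfl⟩
    exact h.mapsTo (hm hx)
  · have : G (fun i => f i, 0) = f := by
      ext i
      by_cases hi : i ∈ ρ
      · rw [hGρ _ i hi]
      rw [hf.2 i hi]
      by_cases h1 : i = a
      · rw [h1, hGa]; simp
      by_cases h2 : i = b
      · rw [h2, hGb]; simp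
      exact hG0 _ i hi h1 h2
    simp [this]

lemma HomeoOn.map_notMem_interior_of_existsUnique (hK : IsComplex K)
    (h : HomeoOn Φ Ψ (coneOver K) T) (hρ : ρ ∈ K) (hcard : ρ.card + 1 = finrank ℝ E)
    (hu : ∃! F, F ∈ K ∧ F.card = finrank ℝ E ∧ ρ ⊆ F) (hf : f ∈ coneOver K)
    (hsup : ∀ i, f i ≠ 0 → i ∈ ρ) : Φ f ∉ interior T := by
  classical
  intro hmem
  obtain ⟨g, hg, hgT⟩ := exists_posOn_map_mem h.continuousOn hρ hf hsup isOpen_interior hmem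
  obtain ⟨F, ⟨hFK, hFc, hρF⟩, huF⟩ := hu
  obtain ⟨a, haF, haρ⟩ : ∃ a ∈ F, a ∉ ρ := by
    by_contra! hcon
    have := Finset.card_le_card (show F ⊆ ρ from hcon)
    omega
  have hgne : ρ.Nonempty := by
    obtain ⟨i, hi⟩ := Function.ne_iff.1 hf.2.1
    exact ⟨i, hsup i hi⟩
  have hcont : ContinuousOn Ψ (interior T) := h.continuousOn_symm.mono interior_subset
  have hO := hcont.isOpen_inter_forall_pos isOpen_interior ρ
  have hsupp : ∀ y ∈ {y ∈ interior T | ∀ i ∈ ρ, 0 < Ψ y i}, ∀ i, Ψ y i ≠ 0 → i ∈ F := by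
    intro y hy i hi
    obtain ⟨t, ht, -, hpt⟩ := exists_posOn_of_mem_coneOver hK (h.mapsTo_symm (interior_subset hy.1))
    have hρt : ρ ⊆ t := fun i hi => hpt.support_subset i (hy.2 i hi).ne'
    have hit := hpt.support_subset i hi
    have h1 := h.card_le ht
    rcases (Finset.card_le_card hρt).eq_or_lt with h2 | h2
    · rw [← Finset.eq_of_subset_of_card_le hρt h2.ge] at hit
      exact hρF hit
    · rw [← huF t ⟨ht, by omega, hρt⟩]
      exact hit
  have hopen := isOpen_image_of_continuousOn_injOn (F := F → ℝ) (f := fun y (i : F) => Ψ y i)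
    (by rw [finrank_fintype_fun_eq_card, Fintype.card_coe, hFc]) hO
    (continuousOn_restrict (hcont.mono fun y hy => hy.1))
    (injOn_restrict (h.injOn_symm.mono fun y hy => interior_subset hy.1) hsupp)
  have hΨg : Ψ (Φ g) = g := h.left_inv (hg.mem_coneOver hρ hgne)
  have hw : (fun i : F => g i) ∈
      (fun y (i : F) => Ψ y i) '' {y ∈ interior T | ∀ i ∈ ρ, 0 < Ψ y i} :=
    ⟨Φ g, ⟨hgT, by rw [hΨg]; exact hg.1⟩, by simp only [hΨg]⟩
  have hcu : Continuous fun t : ℝ => Function.update (fun i : F => g i) ⟨a, haF⟩ t :=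
    continuous_const.update _ continuous_id
  have h0 : Function.update (fun i : F => g i) ⟨a, haF⟩ 0 = fun i : F => g i := by
    rw [Function.update_eq_self_iff, hg.2 a haρ]
  have hev : ∀ᶠ t in 𝓝[<] (0 : ℝ), Function.update (fun i : F => g i) ⟨a, haF⟩ t ∈
      (fun y (i : F) => Ψ y i) '' {y ∈ interior T | ∀ i ∈ ρ, 0 < Ψ y i} :=
    nhdsWithin_le_nhds (hcu.continuousAt.eventually (hopen.mem_nhds (by simpa only [h0] using hw)))
  obtain ⟨t, ⟨y, hy, hyt⟩, ht⟩ := (hev.and self_mem_nhdsWithin).exists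
  have h1 := congr_fun hyt ⟨a, haF⟩
  simp only [Function.update_self] at h1
  have h2 := (h.mapsTo_symm (interior_subset hy.1)).1 a
  have h3 : t < 0 := ht
  linarith

lemma HomeoOn.map_notMem_interior_of_notMem {L : Set (Finset ℕ)} {E' : Type*}
    [NormedAddCommGroup E'] [NormedSpace ℝ E'] [FiniteDimensional ℝ E'] {Φ' : (ℕ → ℝ) → E'}
    {Ψ' : E' → (ℕ → ℝ)} {T' : Set E'} (hK : IsComplex K) (hKL : K ⊆ L)
    (h : HomeoOn Φ Ψ (coneOver K) T)
    (h' : HomeoOn Φ' Ψ' (coneOver L) T') (hE : finrank ℝ E = finrank ℝ E') (hF : F ∈ L)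
    (hFK : F ∉ K) (hf : f ∈ coneOver K) (hsup : ∀ i, f i ≠ 0 → i ∈ F) : Φ f ∉ interior T := by
  intro hmem
  have hKL' : coneOver K ⊆ coneOver L := fun x hx =>
    ⟨hx.1, hx.2.1, hx.2.2.choose, hKL hx.2.2.choose_spec.1, hx.2.2.choose_spec.2⟩
  have hm : MapsTo Ψ (interior T) (coneOver L) :=
    fun y hy => hKL' (h.mapsTo_symm (interior_subset hy))
  have hopen := isOpen_image_of_continuousOn_injOn (f := Φ' ∘ Ψ) hE isOpen_interior
    (h'.continuousOn.comp (h.continuousOn_symm.mono interior_subset) hm)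
    (h'.injOn.comp (h.injOn_symm.mono interior_subset) hm)
  obtain ⟨g, hg, y, hy, hgy⟩ := exists_posOn_map_mem h'.continuousOn hF (hKL' hf) hsup hopen
    ⟨Φ f, hmem, by simp [h.left_inv hf]⟩
  have hne : F.Nonempty := by
    obtain ⟨i, hi⟩ := Function.ne_iff.1 hf.2.1
    exact ⟨i, hsup i hi⟩
  have : Ψ y = g := h'.injOn (hm hy) (hg.mem_coneOver hF hne) hgy
  obtain ⟨-, -, s, hs, hss⟩ := h.mapsTo_symm (interior_subset hy)
  rw [this] at hss
  exact hFK (hK s hs F (hg.subset_of_support_subset hss))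

end Faces

section Ball

open Module

variable {K : Set (Finset ℕ)} {N : Finset ℕ} {V : Type*} [NormedAddCommGroup V] [NormedSpace ℝ V]
  {φ : (ℕ → ℝ) → V} {ψ : V → (ℕ → ℝ)} {f : ℕ → ℝ}

lemma interior_closedBall_prod_Ioi :
    interior (closedBall (0 : V) 1 ×ˢ Ioi (0 : ℝ)) = ball 0 1 ×ˢ Ioi 0 := by
  rw [interior_prod_eq, interior_closedBall _ one_ne_zero, interior_Ioi]

lemma closedBall_prod_Ioi_subset_closure_interior :
    closedBall (0 : V) 1 ×ˢ Ioi (0 : ℝ) ⊆ closure (interior (closedBall (0 : V) 1 ×ˢ Ioi 0)) := by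
  rw [interior_closedBall_prod_Ioi, closure_prod_eq, closure_ball _ one_ne_zero]
  exact prod_mono_right subset_closure

lemma bdry_subset {m : ℕ} (hK : IsComplex K) : bdry m K ⊆ K := by
  rintro τ ⟨ρ, hρ, hτ, -⟩
  exact hK ρ hρ τ hτ

lemma coord_le_one (hf : f ∈ spaceOf K) (i : ℕ) : f i ≤ 1 := by
  obtain ⟨h0, s, hs, hsup, h1⟩ := hf
  by_cases hi : i ∈ s
  · rw [← h1]
    exact Finset.single_le_sum (fun j _ => h0 j) hi
  · rw [by_contra fun h => hi (hsup i h)]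
    exact zero_le_one

lemma isClosed_setOf_support_subset (s : Finset ℕ) :
    IsClosed {f : ℕ → ℝ | ∀ i, f i ≠ 0 → i ∈ s} := by
  have : {f : ℕ → ℝ | ∀ i, f i ≠ 0 → i ∈ s} = ⋂ i ∈ {i | i ∉ s}, {f : ℕ → ℝ | f i = 0} := by
    ext f
    simp only [mem_ofPred_eq, mem_iInter]
    exact forall_congr' fun i => not_imp_comm
  rw [this]
  exact isClosed_biInter fun i _ => isClosed_eq (continuous_apply i) continuous_const

lemma finite_of_subset_powerset (hN : ∀ s ∈ K, s ⊆ N) : K.Finite :=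
  N.powerset.finite_toSet.subset fun s hs => by simpa using hN s hs

lemma isClosed_spaceOf (hN : ∀ s ∈ K, s ⊆ N) : IsClosed (spaceOf K) := by
  have : spaceOf K = ⋃ s ∈ K, ({f : ℕ → ℝ | ∀ i, 0 ≤ f i} ∩ {f | ∀ i, f i ≠ 0 → i ∈ s}) ∩
      {f | ∑ i ∈ s, f i = 1} := by
    ext f
    simp only [spaceOf, mem_ofPred_eq, mem_iUnion, mem_inter_iff, exists_prop]
    constructor
    · rintro ⟨h0, s, hs, h1, h2⟩
      exact ⟨s, hs, ⟨h0, h1⟩, h2⟩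
    · rintro ⟨s, hs, ⟨h0, h1⟩, h2⟩
      exact ⟨h0, s, hs, h1, h2⟩
  rw [this]
  refine (finite_of_subset_powerset hN).isClosed_biUnion fun s _ =>
    (IsClosed.inter ?_ (isClosed_setOf_support_subset s)).inter
      (isClosed_eq (continuous_sum_coord s) continuous_const)
  simp only [ofPred_forall]
  exact isClosed_iInter fun i => isClosed_le continuous_const (continuous_apply i)

/-- The radial extension of a bounded map on the unit sphere is continuous. -/
lemma continuous_norm_smul_comp_normalize (hc : ContinuousOn ψ (sphere 0 1))
    (hb : ∀ y ∈ sphere (0 : V) 1, ∀ i, |ψ y i| ≤ 1) :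
    Continuous fun y : V => ‖y‖ • ψ (‖y‖⁻¹ • y) := by
  have hy1 : ∀ y ∈ ({0}ᶜ : Set V), ‖y‖⁻¹ • y ∈ sphere (0 : V) 1 := by
    intro y hy
    rw [mem_sphere_zero_iff_norm, norm_smul, norm_inv, norm_norm,
      inv_mul_cancel₀ (norm_ne_zero_iff.2 hy)]
  rw [continuous_iff_continuousAt]
  intro y
  by_cases hy : y = 0
  · subst hy
    refine continuousAt_pi.2 fun i => ?_
    have h0 : (‖(0 : V)‖ • ψ (‖(0 : V)‖⁻¹ • (0 : V))) i = 0 := by simp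
    rw [ContinuousAt, h0]
    refine squeeze_zero_norm (a := fun y : V => ‖y‖) (fun y => ?_)
      (by simpa using (continuous_norm (E := V)).tendsto 0)
    by_cases hy : y = 0
    · simp [hy]
    · simp only [Pi.smul_apply, smul_eq_mul, norm_mul, norm_norm]
      exact mul_le_of_le_one_right (norm_nonneg y) (hb _ (hy1 y hy) i)
  · have h1 : ContinuousOn (fun y : V => ‖y‖ • ψ (‖y‖⁻¹ • y)) {0}ᶜ :=
      continuousOn_id.norm.smul (hc.comp
        ((continuousOn_id.norm.inv₀ fun y hy => norm_ne_zero_iff.2 hy).smul continuousOn_id) hy1)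
    exact h1.continuousAt (isOpen_compl_singleton.mem_nhds hy)

lemma norm_eq_one_of_notMem_interior (h : HomeoOn φ ψ (spaceOf K) (closedBall 0 1))
    (hN : ∀ s ∈ K, s ⊆ N) (hf : f ∈ spaceOf K)
    (h_int : (φ ((∑ i ∈ N, f i)⁻¹ • f), ∑ i ∈ N, f i) ∉
      interior (closedBall (0 : V) 1 ×ˢ Ioi (0 : ℝ))) : ‖φ f‖ = 1 := by
  have h1 := ((mem_spaceOf_iff hN).1 hf).2
  rw [interior_closedBall_prod_Ioi, h1, inv_one, one_smul] at h_int
  have h2 := mem_closedBall_zero_iff.1 (h.mapsTo hf)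
  refine h2.antisymm ?_
  by_contra! h3
  exact h_int ⟨mem_ball_zero_iff.2 h3, mem_Ioi.2 one_pos⟩

variable [FiniteDimensional ℝ V]

lemma finrank_prod_real : finrank ℝ (V × ℝ) = finrank ℝ V + 1 := by
  rw [finrank_prod, finrank_self]

lemma norm_eq_one_of_support_subset_bdry (hK : IsComplex K) (hN : ∀ s ∈ K, s ⊆ N)
    (h : HomeoOn φ ψ (spaceOf K) (closedBall 0 1)) (hf : f ∈ spaceOf K) {σ : Finset ℕ}
    (hσ : σ ∈ bdry (finrank ℝ V) K) (hsup : ∀ i, f i ≠ 0 → i ∈ σ) : ‖φ f‖ = 1 := by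
  obtain ⟨ρ, hρ, hσρ, hcard, hu⟩ := hσ
  refine norm_eq_one_of_notMem_interior h hN hf
    ((h.cone_closedBall hN).map_notMem_interior_of_existsUnique hK hρ ?_ ?_
      ((mem_spaceOf_iff hN).1 hf).1 fun i hi => hσρ (hsup i hi))
  · rw [finrank_prod_real, hcard]
  · rwa [finrank_prod_real]

lemma norm_eq_one_of_support_subset_notMem {L : Set (Finset ℕ)} {E' : Type*}
    [NormedAddCommGroup E'] [NormedSpace ℝ E'] [FiniteDimensional ℝ E'] {Φ' : (ℕ → ℝ) → E'}
    {Ψ' : E' → (ℕ → ℝ)} {T' : Set E'} (hK : IsComplex K) (hN : ∀ s ∈ K, s ⊆ N) (hKL : K ⊆ L)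
    (h : HomeoOn φ ψ (spaceOf K) (closedBall 0 1)) (h' : HomeoOn Φ' Ψ' (coneOver L) T')
    (hE : finrank ℝ V + 1 = finrank ℝ E') {F : Finset ℕ} (hF : F ∈ L) (hFK : F ∉ K)
    (hf : f ∈ spaceOf K) (hsup : ∀ i, f i ≠ 0 → i ∈ F) : ‖φ f‖ = 1 :=
  norm_eq_one_of_notMem_interior h hN hf
    ((h.cone_closedBall hN).map_notMem_interior_of_notMem hK hKL h'
      (by rw [finrank_prod_real, hE]) hF hFK ((mem_spaceOf_iff hN).1 hf).1 hsup)

lemma support_card_lt_of_norm_eq_one (hK : IsComplex K) (hN : ∀ s ∈ K, s ⊆ N)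
    (h : HomeoOn φ ψ (spaceOf K) (closedBall 0 1)) {y : V} (hy : ‖y‖ = 1) {s : Finset ℕ}
    (hs : s ∈ K) (hsne : s.Nonempty) (hp : PosOn s (ψ y)) (hsb : s ∉ bdry (finrank ℝ V) K) :
    s.card < finrank ℝ V := by
  classical
  have hyb : y ∈ closedBall (0 : V) 1 := mem_closedBall_zero_iff.2 hy.le
  have hc := h.cone_closedBall hN
  have hsum := ((mem_spaceOf_iff hN).1 (h.mapsTo_symm hyb)).2
  have h_int : (φ ((∑ i ∈ N, ψ y i)⁻¹ • ψ y), ∑ i ∈ N, ψ y i) ∉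
      interior (closedBall (0 : V) 1 ×ˢ Ioi (0 : ℝ)) := by
    rw [interior_closedBall_prod_Ioi, hsum, inv_one, one_smul, h.right_inv hyb]
    rintro ⟨h1, -⟩
    rw [mem_ball_zero_iff, hy] at h1
    exact lt_irrefl _ h1
  have hle := hc.card_le hs
  rw [finrank_prod_real] at hle
  by_contra! hge
  rcases hle.eq_or_lt with heq | hlt
  · exact h_int (hc.map_mem_interior_of_facet hs hsne (by rw [heq, finrank_prod_real]) hp)
  have hsc : s.card = finrank ℝ V := by omega
  obtain ⟨F, hF, hsF, hFc⟩ := hc.exists_facet hK hN closedBall_prod_Ioi_subset_closure_interior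
    ⟨(0, 1), by simp, by simp⟩ hs
  rw [finrank_prod_real] at hFc
  refine hsb ⟨s, hs, subset_rfl, hsc, F, ⟨hF, hFc, hsF⟩, ?_⟩
  rintro G ⟨hG, hGc, hsG⟩
  obtain ⟨a, ha, rfl⟩ := Finset.exists_eq_insert_iff.2 ⟨hsF, by omega⟩
  obtain ⟨b, hb, rfl⟩ := Finset.exists_eq_insert_iff.2 ⟨hsG, by omega⟩
  by_contra hne
  have hab : a ≠ b := fun hab => hne (by rw [hab])
  exact h_int (hc.map_mem_interior_of_ridge hab ha hb hF hG hsne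
    (by rw [finrank_prod_real, hsc]) hp)

lemma exists_mem_bdry_of_norm_eq_one (hK : IsComplex K) (hN : ∀ s ∈ K, s ⊆ N)
    (h : HomeoOn φ ψ (spaceOf K) (closedBall 0 1)) {y : V} (hy : ‖y‖ = 1) :
    ∃ σ ∈ bdry (finrank ℝ V) K, ∀ i, ψ y i ≠ 0 → i ∈ σ := by
  classical
  by_contra hcon
  have hsb : sphere (0 : V) 1 ⊆ closedBall 0 1 := sphere_subset_closedBall
  have hnorm : ∀ z : V, z ≠ 0 → ‖z‖⁻¹ • z ∈ sphere (0 : V) 1 := by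
    intro z hz
    rw [mem_sphere_zero_iff_norm, norm_smul, norm_inv, norm_norm,
      inv_mul_cancel₀ (norm_ne_zero_iff.2 hz)]
  let Ψ : V → ℕ → ℝ := fun z => ‖z‖ • ψ (‖z‖⁻¹ • z)
  have hΨc : Continuous Ψ := continuous_norm_smul_comp_normalize (h.continuousOn_symm.mono hsb)
    fun z hz i => by
      have h1 := h.mapsTo_symm (hsb hz)
      rw [abs_of_nonneg (h1.1 i)]
      exact coord_le_one h1 i
  have hΨs : ∀ z, z ≠ 0 → ∀ i, Ψ z i ≠ 0 ↔ ψ (‖z‖⁻¹ • z) i ≠ 0 := fun z hz i => by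
    simp [Ψ, hz]
  have hΨi : InjOn Ψ {0}ᶜ := by
    intro z hz w hw hzw
    have hsum : ∀ z : V, z ≠ 0 → ∑ i ∈ N, Ψ z i = ‖z‖ := by
      intro z hz
      simp only [Ψ, Pi.smul_apply, smul_eq_mul, ← Finset.mul_sum]
      rw [((mem_spaceOf_iff hN).1 (h.mapsTo_symm (hsb (hnorm z hz)))).2, mul_one]
    have h1 : ‖z‖ = ‖w‖ := by rw [← hsum z hz, hzw, hsum w hw]
    have h2 : ‖w‖ ≠ 0 := norm_ne_zero_iff.2 hw
    have h3 : ‖z‖⁻¹ • z = ‖w‖⁻¹ • w := by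
      refine h.injOn_symm (hsb (hnorm z hz)) (hsb (hnorm w hw)) (smul_right_injective _ h2 ?_)
      simpa only [Ψ, h1] using hzw
    rw [h1] at h3
    exact smul_right_injective _ (inv_ne_zero h2) h3
  let W : Set V := {z | z ≠ 0 ∧ ∀ σ ∈ bdry (finrank ℝ V) K, ¬ ∀ i, Ψ z i ≠ 0 → i ∈ σ}
  have hWo : IsOpen W := by
    have hcl : IsClosed (⋃ σ ∈ bdry (finrank ℝ V) K, {f : ℕ → ℝ | ∀ i, f i ≠ 0 → i ∈ σ}) :=
      ((finite_of_subset_powerset hN).subset (bdry_subset hK)).isClosed_biUnion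
        fun σ _ => isClosed_setOf_support_subset σ
    have : W = {0}ᶜ ∩ Ψ ⁻¹' (⋃ σ ∈ bdry (finrank ℝ V) K,
        {f : ℕ → ℝ | ∀ i, f i ≠ 0 → i ∈ σ})ᶜ := by
      ext z
      simp [W]
    rw [this]
    exact isOpen_compl_singleton.inter (hcl.isOpen_compl.preimage hΨc)
  have hsupp : ∀ z ∈ W, ∃ s ∈ K, PosOn s (Ψ z) ∧ s.card < finrank ℝ V := by
    rintro z ⟨hz, hzb⟩
    have h1 := hnorm z hz
    obtain ⟨s, hs, hsne, hp⟩ := exists_posOn_of_mem_coneOver hK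
      ((mem_spaceOf_iff hN).1 (h.mapsTo_symm (hsb h1))).1
    have hp' : PosOn s (Ψ z) := ⟨fun i hi => mul_pos (norm_pos_iff.2 hz) (hp.1 i hi),
      fun i hi => by simp [Ψ, hp.2 i hi]⟩
    exact ⟨s, hs, hp', support_card_lt_of_norm_eq_one hK hN h (mem_sphere_zero_iff_norm.1 h1) hs
      hsne hp fun hsb => hzb s hsb hp'.support_subset⟩
  have hyW : y ∈ W := by
    have hy0 : y ≠ 0 := norm_ne_zero_iff.1 (by rw [hy]; exact one_ne_zero)
    refine ⟨hy0, fun σ hσ hsup => hcon ⟨σ, hσ, fun i hi => hsup i ?_⟩⟩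
    simpa [Ψ, hy] using hi
  obtain ⟨s, hs, hmax⟩ := (N.powerset.filter fun s => ∃ z ∈ W, PosOn s (Ψ z)).exists_max_image
    Finset.card (by
      obtain ⟨s, hs, hp, -⟩ := hsupp y hyW
      exact ⟨s, by simpa using ⟨hN s hs, y, hyW, hp⟩⟩)
  simp only [Finset.mem_filter, Finset.mem_powerset] at hs hmax
  obtain ⟨hsN, z, hz, hp⟩ := hs
  have hO := (hΨc.continuousOn (s := W)).isOpen_inter_forall_pos hWo s
  have hle := finrank_le_card_of_support_subset (F := s) hO ⟨z, hz, hp.1⟩ hΨc.continuousOn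
    (hΨi.mono fun w hw => hw.1.1) (by
      intro w hw
      obtain ⟨t, ht, hpt, -⟩ := hsupp w hw.1
      have hst : s ⊆ t := fun i hi => hpt.support_subset i (hw.2 i hi).ne'
      rw [Finset.eq_of_subset_of_card_le hst (hmax t ⟨hN t ht, w, hw.1, hpt⟩)]
      exact hpt.support_subset)
  obtain ⟨t, -, hpt, hlt⟩ := hsupp z hz
  rw [(hp.subset_of_support_subset hpt.support_subset).antisymm
    (hpt.subset_of_support_subset hp.support_subset)] at hle
  omega

end Ball

section Sewing

open Module

variable {K : Set (Finset ℕ)} {N : Finset ℕ} {v : ℕ} {V : Type*} [NormedAddCommGroup V]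
  [NormedSpace ℝ V] {φ : (ℕ → ℝ) → V} {ψ : V → (ℕ → ℝ)}

/-- The extension of `ψ` from the unit sphere to the unit ball that is affine on radii and sends
the centre to the vertex `v`. -/
noncomputable def coneMap (v : ℕ) (ψ : V → ℕ → ℝ) (y : V) : ℕ → ℝ :=
  (1 - ‖y‖) • Pi.single v 1 + ‖y‖ • ψ (‖y‖⁻¹ • y)

lemma coneMap_apply_self {y : V} (hv : ψ (‖y‖⁻¹ • y) v = 0) : coneMap v ψ y v = 1 - ‖y‖ := by
  simp [coneMap, hv]

lemma coneMap_apply_of_ne {y : V} {i : ℕ} (hi : i ≠ v) :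
    coneMap v ψ y i = ‖y‖ * ψ (‖y‖⁻¹ • y) i := by
  simp [coneMap, hi]

lemma coneMap_zero : coneMap v ψ 0 = Pi.single v 1 := by
  simp [coneMap]

lemma coneMap_of_norm_eq_one {y : V} (hy : ‖y‖ = 1) : coneMap v ψ y = ψ y := by
  simp [coneMap, hy]

lemma continuous_coneMap (h : HomeoOn φ ψ (spaceOf K) (closedBall 0 1)) :
    Continuous (coneMap v ψ) := by
  refine Continuous.add (by fun_prop) (continuous_norm_smul_comp_normalize
    (h.continuousOn_symm.mono sphere_subset_closedBall) fun y hy i => ?_)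
  have h1 := h.mapsTo_symm (sphere_subset_closedBall hy)
  rw [abs_of_nonneg (h1.1 i)]
  exact coord_le_one h1 i

lemma single_one_mem_spaceOf {s : Finset ℕ} (hs : s ∈ K) (hv : v ∈ s) :
    (Pi.single v 1 : ℕ → ℝ) ∈ spaceOf K := by
  refine ⟨fun i => ?_, s, hs, fun i hi => ?_, ?_⟩
  · by_cases h : i = v
    · simp [h]
    · simp [h]
  · by_cases h : i = v
    · rwa [h]
    · simp [h] at hi
  · simp [hv, Pi.single_apply]

variable [FiniteDimensional ℝ V]

lemma bijOn_coneMap (hK : IsComplex K) (hN : ∀ s ∈ K, s ⊆ N) (hv : v ∉ N)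
    (h : HomeoOn φ ψ (spaceOf K) (closedBall 0 1)) (hbd : (bdry (finrank ℝ V) K).Nonempty) :
    BijOn (coneMap v ψ) (closedBall 0 1)
      (spaceOf {τ | ∃ σ ∈ bdry (finrank ℝ V) K, τ ⊆ insert v σ}) := by
  have hnorm : ∀ z : V, z ≠ 0 → ‖‖z‖⁻¹ • z‖ = 1 := by
    intro z hz
    rw [norm_smul, norm_inv, norm_norm, inv_mul_cancel₀ (norm_ne_zero_iff.2 hz)]
  have hball : ∀ z : V, ‖z‖ = 1 → ψ z ∈ spaceOf K := fun z hz =>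
    h.mapsTo_symm (mem_closedBall_zero_iff.2 hz.le)
  have hzero : ∀ z : V, ‖z‖ = 1 → ψ z v = 0 := by
    intro z hz
    obtain ⟨-, s, hs, hsup, -⟩ := hball z hz
    exact by_contra fun hne => hv (hN s hs (hsup v hne))
  have hbN : ∀ σ ∈ bdry (finrank ℝ V) K, v ∉ σ := fun σ hσ hvσ =>
    hv (hN σ (bdry_subset hK hσ) hvσ)
  refine ⟨?_, ?_, ?_⟩
  · intro y hy
    rw [mem_closedBall_zero_iff] at hy
    by_cases hy0 : y = 0
    · obtain ⟨σ, hσ⟩ := hbd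
      rw [hy0, coneMap_zero]
      exact single_one_mem_spaceOf (s := insert v σ) ⟨σ, hσ, subset_rfl⟩
        (Finset.mem_insert_self _ _)
    · have h1 := hnorm y hy0
      obtain ⟨σ, hσ, hsup⟩ := exists_mem_bdry_of_norm_eq_one hK hN h h1
      have hsum : ∑ i ∈ σ, ψ (‖y‖⁻¹ • y) i = 1 := by
        rw [← ((mem_spaceOf_iff hN).1 (hball _ h1)).2]
        exact Finset.sum_subset (hN σ (bdry_subset hK hσ)) fun i _ hi =>
          by_contra fun hne => hi (hsup i hne)
      refine ⟨fun i => ?_, insert v σ, ⟨σ, hσ, subset_rfl⟩, fun i hi => ?_, ?_⟩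
      · by_cases hi : i = v
        · rw [hi, coneMap_apply_self (hzero _ h1)]
          linarith
        · rw [coneMap_apply_of_ne hi]
          exact mul_nonneg (norm_nonneg y) ((hball _ h1).1 i)
      · rw [Finset.mem_insert]
        by_cases hiv : i = v
        · exact Or.inl hiv
        · rw [coneMap_apply_of_ne hiv] at hi
          exact Or.inr (hsup i (right_ne_zero_of_mul hi))
      · rw [Finset.sum_insert (hbN σ hσ), coneMap_apply_self (hzero _ h1),
          Finset.sum_congr rfl fun i hi => coneMap_apply_of_ne (ne_of_mem_of_not_mem hi (hbN σ hσ)),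
          ← Finset.mul_sum, hsum]
        ring
  · intro y hy z hz hyz
    have hzero' : ∀ y : V, y ≠ 0 → coneMap v ψ y v = 1 - ‖y‖ := fun y hy =>
      coneMap_apply_self (hzero _ (hnorm y hy))
    have hn : ∀ y : V, coneMap v ψ y v = 1 - ‖y‖ := by
      intro y
      by_cases hy0 : y = 0
      · simp [hy0, coneMap_zero]
      · exact hzero' y hy0
    have hyz1 : ‖y‖ = ‖z‖ := by
      have := congr_fun hyz v
      rw [hn, hn] at this
      linarith
    by_cases hz0 : z = 0
    · rw [hz0, norm_zero, norm_eq_zero] at hyz1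
      rw [hyz1, hz0]
    have hy0 : y ≠ 0 := by rwa [← norm_ne_zero_iff, hyz1, norm_ne_zero_iff]
    have hzn := norm_ne_zero_iff.2 hz0
    have h1 : ψ (‖y‖⁻¹ • y) = ψ (‖z‖⁻¹ • z) := by
      ext i
      by_cases hi : i = v
      · rw [hi, hzero _ (hnorm y hy0), hzero _ (hnorm z hz0)]
      · have := congr_fun hyz i
        rw [coneMap_apply_of_ne hi, coneMap_apply_of_ne hi] at this
        rw [hyz1] at this ⊢
        exact mul_left_cancel₀ hzn this
    have h2 := h.injOn_symm (mem_closedBall_zero_iff.2 (hnorm y hy0).le)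
      (mem_closedBall_zero_iff.2 (hnorm z hz0).le) h1
    rw [hyz1] at h2
    exact smul_right_injective _ (inv_ne_zero hzn) h2
  · rintro g ⟨h0, τ, ⟨σ, hσ, hτ⟩, hsupτ, hsum⟩
    have hvσ := hbN σ hσ
    have hsup : ∀ i, g i ≠ 0 → i ∈ insert v σ := fun i hi => hτ (hsupτ i hi)
    rw [Finset.sum_subset hτ fun i _ hi => by_contra fun hne => hi (hsupτ i hne),
      Finset.sum_insert hvσ] at hsum
    have hsσ : 0 ≤ ∑ i ∈ σ, g i := Finset.sum_nonneg fun i _ => h0 i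
    set r := ∑ i ∈ σ, g i with hr
    by_cases hr0 : r = 0
    · refine ⟨0, by simp, ?_⟩
      rw [coneMap_zero]
      ext i
      by_cases hi : i = v
      · rw [hi, Pi.single_eq_same]
        linarith
      · rw [Pi.single_eq_of_ne hi]
        by_contra hne
        have := (Finset.mem_insert.1 (hsup i (Ne.symm hne))).resolve_left hi
        exact hne ((Finset.sum_eq_zero_iff_of_nonneg fun j _ => h0 j).1 (hr ▸ hr0) i this).symm
    · have hrp : 0 < r := lt_of_le_of_ne hsσ (Ne.symm hr0)
      let x : ℕ → ℝ := r⁻¹ • Function.update g v 0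
      have hxv : x v = 0 := by simp [x]
      have hxi : ∀ i, i ≠ v → x i = r⁻¹ * g i := fun i hi => by simp [x, hi]
      have hxsup : ∀ i, x i ≠ 0 → i ∈ σ := by
        intro i hi
        have hiv : i ≠ v := fun hiv => hi (by rw [hiv, hxv])
        rw [hxi i hiv] at hi
        exact (Finset.mem_insert.1 (hsup i (right_ne_zero_of_mul hi))).resolve_left hiv
      have hx : x ∈ spaceOf K := by
        refine ⟨fun i => ?_, σ, bdry_subset hK hσ, hxsup, ?_⟩
        · by_cases hi : i = v
          · rw [hi, hxv]
          · rw [hxi i hi]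
            exact mul_nonneg (inv_nonneg.2 hrp.le) (h0 i)
        · rw [Finset.sum_congr rfl fun i hi => hxi i fun hiv => hvσ (hiv ▸ hi), ← Finset.mul_sum,
            ← hr, inv_mul_cancel₀ hr0]
      have hx1 := norm_eq_one_of_support_subset_bdry hK hN h hx hσ hxsup
      have hyn : ‖r • φ x‖ = r := by rw [norm_smul, hx1, mul_one, Real.norm_of_nonneg hrp.le]
      have hy : ψ (‖r • φ x‖⁻¹ • r • φ x) = x := by
        rw [hyn, smul_smul, inv_mul_cancel₀ hr0, one_smul, h.left_inv hx]
      have hgv := h0 v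
      refine ⟨r • φ x, mem_closedBall_zero_iff.2 (by rw [hyn]; linarith), ?_⟩
      ext i
      by_cases hi : i = v
      · rw [hi, coneMap_apply_self (by rw [hy, hxv]), hyn]
        linarith
      · rw [coneMap_apply_of_ne hi, hy, hyn, hxi i hi, mul_inv_cancel_left₀ hr0]

lemma nonempty_homeomorph_union {α : Type*} [TopologicalSpace α] [T2Space α] {S P Q : Set α}
    {θ : α → α} (hS : IsClosed S) (hP : IsClosed P) (hc : IsCompact (S ∪ P))
    (hθ : ContinuousOn θ P) (hb : BijOn θ P Q) (hid : ∀ x ∈ S, x ∈ P → θ x = x)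
    (hSQ : S ∩ Q ⊆ P) : Nonempty (↥(S ∪ P) ≃ₜ ↥(S ∪ Q)) := by
  classical
  let H : α → α := fun x => if x ∈ P then θ x else x
  have hHP : ∀ x ∈ P, H x = θ x := fun x hx => if_pos hx
  have hHS : ∀ x ∈ S, H x = x := by
    intro x hx
    by_cases hxP : x ∈ P
    · rw [hHP x hxP, hid x hx hxP]
    · exact if_neg hxP
  have hcont : ContinuousOn H (S ∪ P) :=
    (continuousOn_id.congr hHS).union_of_isClosed (hθ.congr hHP) hS hP
  have hmaps : MapsTo H (S ∪ P) (S ∪ Q) := by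
    rintro x (hx | hx)
    · exact Or.inl (by rwa [hHS x hx])
    · exact Or.inr (by rw [hHP x hx]; exact hb.mapsTo hx)
  have hcross : ∀ x ∈ S, ∀ y ∈ P, x = θ y → x = y := by
    intro x hx y hy hxy
    have hxP : x ∈ P := hSQ ⟨hx, hxy ▸ hb.mapsTo hy⟩
    exact hb.injOn hxP hy (by rw [hid x hx hxP, hxy])
  have hinj : InjOn H (S ∪ P) := by
    rintro x (hx | hx) y (hy | hy) hxy
    · rwa [hHS x hx, hHS y hy] at hxy
    · rw [hHS x hx, hHP y hy] at hxy
      exact hcross x hx y hy hxy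
    · rw [hHP x hx, hHS y hy] at hxy
      exact (hcross y hy x hx hxy.symm).symm
    · rw [hHP x hx, hHP y hy] at hxy
      exact hb.injOn hx hy hxy
  have hsurj : SurjOn H (S ∪ P) (S ∪ Q) := by
    rintro y (hy | hy)
    · exact ⟨y, Or.inl hy, hHS y hy⟩
    · obtain ⟨x, hx, rfl⟩ := hb.surjOn hy
      exact ⟨x, Or.inr hx, hHP x hx⟩
  have : CompactSpace ↥(S ∪ P) := isCompact_iff_compactSpace.1 hc
  have hcr : Continuous (hmaps.restrict H (S ∪ P) (S ∪ Q)) :=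
    hcont.mapsToRestrict hmaps
  exact ⟨hcr.homeoOfEquivCompactToT2 (f := BijOn.equiv H ⟨hmaps, hinj, hsurj⟩)⟩

lemma spaceOf_union (C D : Set (Finset ℕ)) : spaceOf (C ∪ D) = spaceOf C ∪ spaceOf D := by
  ext f
  constructor
  · rintro ⟨h0, s, hs | hs, h⟩
    exacts [Or.inl ⟨h0, s, hs, h⟩, Or.inr ⟨h0, s, hs, h⟩]
  · rintro (⟨h0, s, hs, h⟩ | ⟨h0, s, hs, h⟩)
    exacts [⟨h0, s, Or.inl hs, h⟩, ⟨h0, s, Or.inr hs, h⟩]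

variable {Δ B : Set (Finset ℕ)} {m : ℕ}

lemma IsSphere.exists_homeoOn_coneOver (hN : ∀ s ∈ Δ, s ⊆ N) (hs : IsSphere m Δ) :
    ∃ Φ Ψ, HomeoOn Φ Ψ (coneOver Δ) ({0}ᶜ : Set (EuclideanSpace ℝ (Fin (m + 1)))) := by
  obtain ⟨e⟩ := hs
  obtain ⟨φ, ψ, h⟩ := e.exists_homeoOn
  exact ⟨_, _, h.cone_sphere hN⟩

lemma IsSphere.exists_facet (hΔ : IsComplex Δ) (hN : ∀ s ∈ Δ, s ⊆ N) (hs : IsSphere m Δ)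
    {s : Finset ℕ} (hsΔ : s ∈ Δ) : ∃ F ∈ Δ, s ⊆ F ∧ F.card = m + 1 := by
  obtain ⟨Φ, Ψ, h⟩ := hs.exists_homeoOn_coneOver hN
  obtain ⟨F, hF, hsF, hc⟩ := h.exists_facet hΔ hN
    (by rw [isOpen_compl_singleton.interior_eq]; exact subset_closure)
    (by obtain ⟨y, hy⟩ := exists_ne (0 : EuclideanSpace ℝ (Fin (m + 1))); exact ⟨y, hy⟩) hsΔ
  exact ⟨F, hF, hsF, by simpa using hc⟩

/-- Replacing a full-dimensional ball in a sphere by the cone over its boundary gives a sphere. -/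
theorem IsSphere.replace_ball (hm : 1 ≤ m) (hΔ : IsComplex Δ) (hB : IsComplex B) (hBΔ : B ⊆ Δ)
    (hN : ∀ s ∈ Δ, s ⊆ N) (hv : v ∉ N) (hs : IsSphere m Δ) (hb : IsBall m B) :
    IsSphere m ({τ | ∃ F ∈ Δ, F.card = m + 1 ∧ F ∉ B ∧ τ ⊆ F} ∪
      {τ | ∃ σ ∈ bdry m B, τ ⊆ insert v σ}) := by
  have hNB : ∀ s ∈ B, s ⊆ N := fun s hs => hN s (hBΔ hs)
  obtain ⟨Φ', Ψ', h'⟩ := hs.exists_homeoOn_coneOver hN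
  obtain ⟨eB⟩ := hb
  obtain ⟨φ, ψ, h⟩ := eB.exists_homeoOn
  have hrank : finrank ℝ (EuclideanSpace ℝ (Fin m)) = m := by simp
  have hbij := bijOn_coneMap hB hNB hv h (by
    obtain ⟨y, hy⟩ : ∃ y : EuclideanSpace ℝ (Fin m), ‖y‖ = 1 :=
      ⟨EuclideanSpace.single ⟨0, hm⟩ 1, by simp⟩
    obtain ⟨σ, hσ, -⟩ := exists_mem_bdry_of_norm_eq_one hB hNB h hy
    exact ⟨σ, hσ⟩)
  rw [hrank] at hbij
  set C : Set (Finset ℕ) := {τ | ∃ F ∈ Δ, F.card = m + 1 ∧ F ∉ B ∧ τ ⊆ F} with hC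
  set D : Set (Finset ℕ) := {τ | ∃ σ ∈ bdry m B, τ ⊆ insert v σ} with hD
  have hCN : ∀ s ∈ C, s ⊆ N := by
    rintro s ⟨F, hF, -, -, hsF⟩
    exact hsF.trans (hN F hF)
  have hunion : spaceOf Δ = spaceOf C ∪ spaceOf B := by
    rw [← spaceOf_union]
    apply Subset.antisymm
    · rintro f ⟨h0, s, hsΔ, hf⟩
      obtain ⟨F, hF, hsF, hc⟩ := hs.exists_facet hΔ hN hsΔ
      by_cases hFB : F ∈ B
      · exact ⟨h0, s, Or.inr (hB F hFB s hsF), hf⟩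
      · exact ⟨h0, s, Or.inl ⟨F, hF, hc, hFB, hsF⟩, hf⟩
    · rintro f ⟨h0, s, ⟨F, hF, -, -, hsF⟩ | hsB, hf⟩
      · exact ⟨h0, s, hΔ F hF s hsF, hf⟩
      · exact ⟨h0, s, hBΔ hsB, hf⟩
  obtain ⟨e⟩ := hs
  have hcomp : IsCompact (spaceOf Δ) := by
    have := e.symm.compactSpace
    exact isCompact_iff_compactSpace.2 inferInstance
  obtain ⟨H⟩ := nonempty_homeomorph_union (S := spaceOf C) (P := spaceOf B) (Q := spaceOf D)
    (θ := coneMap v ψ ∘ φ) (isClosed_spaceOf hCN) (isClosed_spaceOf hNB) (hunion ▸ hcomp)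
    ((continuous_coneMap h).comp_continuousOn h.continuousOn)
    (hbij.comp ⟨h.mapsTo, h.injOn, fun y hy => ⟨ψ y, h.mapsTo_symm hy, h.right_inv hy⟩⟩)
    (by
      rintro x ⟨-, s, ⟨F, hF, hFc, hFB, hsF⟩, hsup, -⟩ hxB
      have hx1 := norm_eq_one_of_support_subset_notMem hB hNB hBΔ h h' (by simp) hF hFB hxB
        fun i hi => hsF (hsup i hi)
      rw [Function.comp_apply, coneMap_of_norm_eq_one hx1, h.left_inv hxB])
    (by
      rintro x ⟨⟨h0, s, hsC, hsup, hsum⟩, -, t, ⟨σ, hσ, htσ⟩, hsup', -⟩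
      refine ⟨h0, s ∩ σ, hB σ (bdry_subset hB hσ) _ Finset.inter_subset_right, ?_, ?_⟩
      all_goals
        have hσx : ∀ i, x i ≠ 0 → i ∈ s ∩ σ := fun i hi => Finset.mem_inter.2 ⟨hsup i hi,
          (Finset.mem_insert.1 (htσ (hsup' i hi))).resolve_left fun hiv =>
            hv (hCN s hsC (hiv ▸ hsup i hi))⟩
      · exact hσx
      · rw [← hsum]
        exact Finset.sum_subset Finset.inter_subset_left fun i _ hi =>
          by_contra fun hne => hi (hσx i hne))
  rw [IsSphere, spaceOf_union]
  exact ⟨H.symm.trans ((Homeomorph.setCongr hunion.symm).trans e)⟩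

end Sewing

end

/-- Sewing a new vertex: replacing, inside a `⌊d/2⌋`-neighborly PL `(d-1)`-sphere
`Δ` on vertex set `[n]`, a `(⌊d/2⌋-1)`-neighborly `(⌊d/2⌋-1)`-stacked PL
`(d-1)`-ball `B` by the cone `∂B * {n+1}` yields a `⌊d/2⌋`-neighborly PL
`(d-1)`-sphere on vertex set `[n+1]`. -/
theorem sewing_vertex (d n : ℕ) (hd : 2 ≤ d)
    (Δ B : Set (Finset ℕ)) (hcΔ : IsComplex Δ) (hcB : IsComplex B)
    (hsph : IsSphere (d - 1) Δ) (hvΔ : vertexSet Δ = Set.Icc 1 n)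
    (hnΔ : Nbrly (d / 2) (Set.Icc 1 n) Δ)
    (hBΔ : B ⊆ Δ) (hball : IsBall (d - 1) B)
    (hnB : Nbrly (d / 2 - 1) (Set.Icc 1 n) B)
    (hsB : IsStacked (d / 2 - 1) (d - 1) B) :
    IsComplex ({τ | ∃ F ∈ Δ, F.card = d ∧ F ∉ B ∧ τ ⊆ F} ∪
        {τ | ∃ σ ∈ bdry (d - 1) B, τ ⊆ insert (n + 1) σ}) ∧
      IsSphere (d - 1) ({τ | ∃ F ∈ Δ, F.card = d ∧ F ∉ B ∧ τ ⊆ F} ∪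
        {τ | ∃ σ ∈ bdry (d - 1) B, τ ⊆ insert (n + 1) σ}) ∧
      vertexSet ({τ | ∃ F ∈ Δ, F.card = d ∧ F ∉ B ∧ τ ⊆ F} ∪
        {τ | ∃ σ ∈ bdry (d - 1) B, τ ⊆ insert (n + 1) σ}) = Set.Icc 1 (n + 1) ∧
      Nbrly (d / 2) (Set.Icc 1 (n + 1))
        ({τ | ∃ F ∈ Δ, F.card = d ∧ F ∉ B ∧ τ ⊆ F} ∪
        {τ | ∃ σ ∈ bdry (d - 1) B, τ ⊆ insert (n + 1) σ}) := by
  obtain ⟨m, rfl⟩ : ∃ m, d = m + 1 := ⟨d - 1, by omega⟩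
  rw [Nat.add_sub_cancel] at *
  have hv : ∀ s ∈ Δ, ∀ v ∈ s, v ∈ Set.Icc 1 n := fun s hs v hvs => by
    rw [← hvΔ]
    exact hcΔ s hs {v} (Finset.singleton_subset_iff.2 hvs)
  have hN : ∀ s ∈ Δ, s ⊆ Finset.Icc 1 n := fun s hs v hvs => by simpa using hv s hs v hvs
  have hbd : ∀ σ ∈ bdry m B, ∀ v ∈ σ, v ∈ Set.Icc 1 n := fun σ hσ =>
    hv σ (hBΔ (bdry_subset hcB hσ))
  have hnbr : Nbrly ((m + 1) / 2) (Set.Icc 1 (n + 1))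
      ({τ | ∃ F ∈ Δ, F.card = m + 1 ∧ F ∉ B ∧ τ ⊆ F} ∪
        {τ | ∃ σ ∈ bdry m B, τ ⊆ insert (n + 1) σ}) := by
    intro τ hτ hcard
    by_cases hn : n + 1 ∈ τ
    · right
      have hc := Finset.card_erase_of_mem hn
      have hmem : τ.erase (n + 1) ∈ B := by
        refine hnB _ (fun i hi => ?_) (by omega)
        have hi' := Finset.mem_erase.1 (Finset.mem_coe.1 hi)
        have h1 := hτ (Finset.mem_coe.2 hi'.2)
        exact ⟨h1.1, Nat.lt_succ_iff.1 (lt_of_le_of_ne h1.2 hi'.1)⟩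
      exact ⟨_, hsB _ hmem (by omega), (Finset.insert_erase hn).ge⟩
    · have hmem : τ ∈ Δ := by
        refine hnΔ _ (fun i hi => ?_) hcard
        have h1 := hτ hi
        exact ⟨h1.1, Nat.lt_succ_iff.1 (lt_of_le_of_ne h1.2
          (ne_of_mem_of_not_mem (Finset.mem_coe.1 hi) hn))⟩
      obtain ⟨F, hF, hτF, hFc⟩ := hsph.exists_facet hcΔ hN hmem
      by_cases hFB : F ∈ B
      · exact Or.inr ⟨τ, hsB τ (hcB F hFB τ hτF) (by omega), Finset.subset_insert _ _⟩
      · exact Or.inl ⟨F, hF, hFc, hFB, hτF⟩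
  refine ⟨?_, hsph.replace_ball (by omega) hcΔ hcB hBΔ hN (by simp) hball, ?_, hnbr⟩
  · rintro s (⟨F, hF, hc, hFB, hsF⟩ | ⟨σ, hσ, hsσ⟩) t hts
    · exact Or.inl ⟨F, hF, hc, hFB, hts.trans hsF⟩
    · exact Or.inr ⟨σ, hσ, hts.trans hsσ⟩
  · ext v
    constructor
    · rintro (⟨F, hF, -, -, hvF⟩ | ⟨σ, hσ, hvσ⟩)
      · have := hv F hF v (Finset.singleton_subset_iff.1 hvF)
        exact ⟨this.1, this.2.trans n.le_succ⟩
      · rcases Finset.mem_insert.1 (Finset.singleton_subset_iff.1 hvσ) with rfl | h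
        · exact ⟨by omega, le_rfl⟩
        · have := hbd σ hσ v h
          exact ⟨this.1, this.2.trans n.le_succ⟩
    · intro h
      exact hnbr {v} (by simpa using h) (by rw [Finset.card_singleton]; omega)
end

section
/- For k ≥ 2 and d ∈ {2k-1, 2k}, the number of combinatorially distinct ⌊d/2⌋-neighborly simplicial PL (d-1)-spheres on n labeled vertices is at least 2^{c·n^{k-1}} for some constant c > 0 and all sufficiently large n. -/
/-- The complex generated by a finite family of facets. -/
def faces (K : Finset (Finset ℕ)) : Set (Finset ℕ) := {s | ∃ G ∈ K, s ⊆ G}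

/-- The facets of the boundary of the simplex `F`. -/
def facetsOf (F : Finset ℕ) : Finset (Finset ℕ) := F.image F.erase

theorem mem_facetsOf {F G : Finset ℕ} : G ∈ facetsOf F ↔ ∃ a ∈ F, F.erase a = G := by
  simp [facetsOf]

theorem isComplex_faces (K : Finset (Finset ℕ)) : IsComplex (faces K) :=
  fun _ ⟨G, hG, hs⟩ _ ht => ⟨G, hG, ht.trans hs⟩

/-! ### Bistellar moves and realizations -/

/-- One direction of a bistellar move exchanging the missing face `σ` of `K` with its face `τ`. -/
structure Exchange (K K' : Set (Finset ℕ)) (σ τ : Finset ℕ) : Prop where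
  isComplex : IsComplex K
  keep : ∀ s ∈ K, ¬ τ ⊆ s → s ∈ K'
  swap : ∀ s ∈ K, τ ⊆ s → ∀ t ∈ τ, (s ∪ σ).erase t ∈ K'
  missing : σ ∉ K

/-- The piecewise linear map pushing the star of `τ` across the move. -/
noncomputable def push (σ τ : Finset ℕ) (hτ : τ.Nonempty) (x : ℕ → ℝ) (i : ℕ) : ℝ :=
  x i + τ.inf' hτ x * ((if i ∈ σ then (τ.card : ℝ) / σ.card else 0) - if i ∈ τ then 1 else 0)

theorem continuous_push (σ τ : Finset ℕ) (hτ : τ.Nonempty) : Continuous (push σ τ hτ) := by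
  have h : Continuous fun x : ℕ → ℝ => τ.inf' hτ x :=
    Continuous.finset_inf'_apply hτ fun i _ => continuous_apply i
  unfold push
  fun_prop

theorem Exchange.exists_eq_zero {K K' : Set (Finset ℕ)} {σ τ : Finset ℕ}
    (h : Exchange K K' σ τ) {x : ℕ → ℝ} (hx : x ∈ spaceOf K) : ∃ s ∈ σ, x s = 0 := by
  obtain ⟨h0, s, hs, hsupp, -⟩ := hx
  by_contra! hne
  exact h.missing (h.isComplex s hs σ fun i hi => hsupp i (hne i hi))

theorem Exchange.push_mem {K K' : Set (Finset ℕ)} {σ τ : Finset ℕ} (h : Exchange K K' σ τ)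
    (hσ : σ.Nonempty) (hτ : τ.Nonempty) (hd : Disjoint σ τ) {x : ℕ → ℝ} (hx : x ∈ spaceOf K) :
    push σ τ hτ x ∈ spaceOf K' := by
  obtain ⟨h0, s, hs, hsupp, hsum⟩ := hx
  obtain ⟨t, ht, hmin⟩ := τ.exists_mem_eq_inf' hτ x
  have hnn : 0 ≤ τ.inf' hτ x := by rw [hmin]; exact h0 t
  have hle : ∀ i ∈ τ, τ.inf' hτ x ≤ x i := fun i hi => Finset.inf'_le x hi
  have hnot : ∀ i ∈ τ, i ∉ σ := fun i hi hi' => Finset.disjoint_left.1 hd hi' hi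
  have hσc : (0 : ℝ) < σ.card := by exact_mod_cast hσ.card_pos
  refine ⟨fun i => ?_, ?_⟩
  · unfold push
    by_cases hi : i ∈ τ
    · simp [hi, hnot i hi, hle i hi]
    · simp only [hi, if_false, sub_zero]
      have := h0 i
      split_ifs <;> positivity
  · rcases hnn.eq_or_lt with hz | hpos
    · have hpx : push σ τ hτ x = x := by funext i; simp [push, ← hz]
      rw [hpx]
      refine ⟨s.filter (x · ≠ 0), h.keep _ (h.isComplex s hs _ (Finset.filter_subset _ _)) ?_,
        fun i hi => Finset.mem_filter.2 ⟨hsupp i hi, hi⟩, by rw [Finset.sum_filter_ne_zero, hsum]⟩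
      intro hsub
      exact (Finset.mem_filter.1 (hsub ht)).2 (by rw [← hmin, ← hz])
    · have hτs : τ ⊆ s := fun i hi => hsupp i (hpos.trans_le (hle i hi)).ne'
      refine ⟨(s ∪ σ).erase t, h.swap s hs hτs t ht, fun i hi => ?_, ?_⟩
      · rw [Finset.mem_erase, Finset.mem_union]
        refine ⟨?_, ?_⟩
        · rintro rfl
          exact hi (by simp [push, ht, hnot _ ht, hmin])
        · by_contra! hc
          have hxi : x i = 0 := by by_contra hne; exact hc.1 (hsupp i hne)
          have hiτ : i ∉ τ := fun hiτ => hc.1 (hτs hiτ)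
          exact hi (by simp [push, hc.2, hxi, hiτ])
      · have hpt : push σ τ hτ x t = 0 := by simp [push, ht, hnot _ ht, hmin]
        rw [Finset.sum_erase _ hpt]
        have h1 : ∑ i ∈ s ∪ σ, x i = 1 := by
          rw [← hsum]
          refine (Finset.sum_subset Finset.subset_union_left fun i _ hi => ?_).symm
          by_contra hne
          exact hi (hsupp i hne)
        have e1 : (s ∪ σ) ∩ σ = σ := by ext; simp
        have e2 : (s ∪ σ) ∩ τ = τ := Finset.inter_eq_right.2 (hτs.trans Finset.subset_union_left)
        simp only [push, Finset.sum_add_distrib, ← Finset.mul_sum, Finset.sum_sub_distrib,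
          Finset.sum_ite_mem, e1, e2, Finset.sum_const, nsmul_eq_mul, h1]
        field_simp
        simp

theorem Exchange.push_push {K K' : Set (Finset ℕ)} {σ τ : Finset ℕ} (h : Exchange K K' σ τ)
    (hσ : σ.Nonempty) (hτ : τ.Nonempty) (hd : Disjoint σ τ) {x : ℕ → ℝ} (hx : x ∈ spaceOf K) :
    push τ σ hσ (push σ τ hτ x) = x := by
  have hσc : (0 : ℝ) < σ.card := by exact_mod_cast hσ.card_pos
  have hτc : (0 : ℝ) < τ.card := by exact_mod_cast hτ.card_pos
  have hval : ∀ i ∈ σ, push σ τ hτ x i = x i + τ.inf' hτ x * (τ.card / σ.card) := fun i hi => by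
    simp [push, hi, Finset.disjoint_left.1 hd hi]
  obtain ⟨s, hs, hxs⟩ := h.exists_eq_zero hx
  have hinf : σ.inf' hσ (push σ τ hτ x) = τ.inf' hτ x * (τ.card / σ.card) := by
    apply le_antisymm
    · refine (Finset.inf'_le _ hs).trans_eq ?_
      rw [hval s hs, hxs, zero_add]
    · refine Finset.le_inf' _ _ fun i hi => ?_
      rw [hval i hi]
      linarith [hx.1 i]
  funext i
  rw [push, hinf, push]
  split_ifs <;> field_simp <;> ring

/-- A bistellar move does not change the homeomorphism type of the realization. -/
noncomputable def Exchange.homeomorph {K K' : Set (Finset ℕ)} {σ τ : Finset ℕ}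
    (h : Exchange K K' σ τ) (h' : Exchange K' K τ σ) (hσ : σ.Nonempty) (hτ : τ.Nonempty)
    (hd : Disjoint σ τ) : spaceOf K ≃ₜ spaceOf K' where
  toFun x := ⟨push σ τ hτ x, h.push_mem hσ hτ hd x.2⟩
  invFun y := ⟨push τ σ hσ y, h'.push_mem hτ hσ hd.symm y.2⟩
  left_inv x := Subtype.ext (h.push_push hσ hτ hd x.2)
  right_inv y := Subtype.ext (h'.push_push hτ hσ hd.symm y.2)
  continuous_toFun := ((continuous_push σ τ hτ).comp continuous_subtype_val).subtype_mk _
  continuous_invFun := ((continuous_push τ σ hσ).comp continuous_subtype_val).subtype_mk _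

/-! ### The boundary of a simplex -/

section SimplexBoundary

variable {F : Finset ℕ}

theorem mem_spaceOf_simplex {x : ℕ → ℝ} :
    x ∈ spaceOf (faces (facetsOf F)) ↔
      (∀ i, 0 ≤ x i) ∧ (∀ i ∉ F, x i = 0) ∧ ∑ i ∈ F, x i = 1 ∧ ∃ a ∈ F, x a = 0 := by
  constructor
  · rintro ⟨h0, s, ⟨G, hG, hsG⟩, hsupp, hsum⟩
    obtain ⟨a, ha, rfl⟩ := mem_facetsOf.1 hG
    refine ⟨h0, fun i hi => ?_, ?_, a, ha, ?_⟩
    · by_contra hne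
      exact hi (Finset.mem_of_mem_erase (hsG (hsupp i hne)))
    · rw [← hsum]
      refine (Finset.sum_subset (hsG.trans (Finset.erase_subset _ _)) fun i _ hi => ?_).symm
      by_contra hne
      exact hi (hsupp i hne)
    · by_contra hne
      exact Finset.notMem_erase a F (hsG (hsupp a hne))
  · rintro ⟨h0, hoff, hsum, a, ha, hxa⟩
    refine ⟨h0, F.erase a, ⟨_, mem_facetsOf.2 ⟨a, ha, rfl⟩, subset_rfl⟩, fun i hi => ?_, ?_⟩
    · rw [Finset.mem_erase]
      exact ⟨fun h => hi (h ▸ hxa), by_contra fun h => hi (hoff i h)⟩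
    · rw [Finset.sum_erase _ hxa, hsum]

/-- The unit sphere of the hyperplane of vectors with coordinate sum zero. -/
def sumZeroSphere (F : Finset ℕ) : Set (EuclideanSpace ℝ F) := {y | ∑ i, y i = 0 ∧ ‖y‖ = 1}

/-- The vector from the barycenter of the simplex `F` to the point with coordinates `x`. -/
noncomputable def centered (F : Finset ℕ) (x : ℕ → ℝ) : EuclideanSpace ℝ F :=
  WithLp.toLp 2 fun i => x i - (F.card : ℝ)⁻¹

/-- The smallest coordinate of a vector. -/
noncomputable def minCoord (hF : F.Nonempty) (y : EuclideanSpace ℝ F) : ℝ :=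
  Finset.univ.inf' (Finset.univ_nonempty_iff.2 hF.coe_sort) fun i => y i

/-- Radial projection from the barycenter to the boundary of the simplex `F`. -/
noncomputable def toBoundary (hF : F.Nonempty) (y : EuclideanSpace ℝ F) (i : ℕ) : ℝ :=
  if h : i ∈ F then (y ⟨i, h⟩ - minCoord hF y) / (-(F.card * minCoord hF y)) else 0

theorem minCoord_le (hF : F.Nonempty) (y : EuclideanSpace ℝ F) (i : F) : minCoord hF y ≤ y i :=
  Finset.inf'_le _ (Finset.mem_univ i)

theorem exists_eq_minCoord (hF : F.Nonempty) (y : EuclideanSpace ℝ F) :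
    ∃ i, y i = minCoord hF y := by
  obtain ⟨i, -, hi⟩ := Finset.univ.exists_mem_eq_inf'
    (Finset.univ_nonempty_iff.2 hF.coe_sort) fun i => y i
  exact ⟨i, hi.symm⟩

theorem minCoord_neg (hF : F.Nonempty) {y : EuclideanSpace ℝ F} (hy : y ∈ sumZeroSphere F) :
    minCoord hF y < 0 := by
  by_contra! h
  have hnn : ∀ i ∈ Finset.univ, 0 ≤ y i := fun i _ => h.trans (minCoord_le hF y i)
  have hz := (Finset.sum_eq_zero_iff_of_nonneg hnn).1 hy.1
  have : y = 0 := by ext i; exact hz i (Finset.mem_univ i)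
  have h1 := hy.2
  simp [this] at h1

theorem continuous_minCoord (hF : F.Nonempty) : Continuous (minCoord hF) :=
  Continuous.finset_inf'_apply _ fun i _ => by fun_prop

theorem centered_ne_zero {x : ℕ → ℝ} (hx : x ∈ spaceOf (faces (facetsOf F))) :
    centered F x ≠ 0 := by
  obtain ⟨-, -, -, a, ha, hxa⟩ := mem_spaceOf_simplex.1 hx
  intro h
  have h1 : centered F x ⟨a, ha⟩ = 0 := by rw [h]; rfl
  have h2 : (F.card : ℝ) ≠ 0 := by exact_mod_cast (Finset.card_pos.2 ⟨a, ha⟩).ne'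
  simp [centered, hxa, h2] at h1

theorem normalize_centered_mem (hF : F.Nonempty) {x : ℕ → ℝ}
    (hx : x ∈ spaceOf (faces (facetsOf F))) :
    ‖centered F x‖⁻¹ • centered F x ∈ sumZeroSphere F := by
  have h2 : (F.card : ℝ) ≠ 0 := by exact_mod_cast hF.card_pos.ne'
  refine ⟨?_, norm_smul_inv_norm (𝕜 := ℝ) (centered_ne_zero hx)⟩
  have hs : ∑ i : F, x i = 1 := by
    rw [Finset.sum_coe_sort F x]; exact (mem_spaceOf_simplex.1 hx).2.2.1
  change ∑ i : F, ‖centered F x‖⁻¹ * (x i - (F.card : ℝ)⁻¹) = 0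
  rw [← Finset.mul_sum, Finset.sum_sub_distrib, hs]
  simp [h2]

theorem toBoundary_mem (hF : F.Nonempty) {y : EuclideanSpace ℝ F} (hy : y ∈ sumZeroSphere F) :
    toBoundary hF y ∈ spaceOf (faces (facetsOf F)) := by
  have hμ := minCoord_neg hF hy
  have hN : (0 : ℝ) < F.card := by exact_mod_cast hF.card_pos
  have hW : 0 < -(F.card * minCoord hF y) := by nlinarith
  refine mem_spaceOf_simplex.2 ⟨fun i => ?_, fun i hi => by simp [toBoundary, hi], ?_, ?_⟩
  · unfold toBoundary
    split_ifs with h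
    · exact div_nonneg (sub_nonneg.2 (minCoord_le hF y _)) hW.le
    · exact le_rfl
  · rw [← Finset.sum_coe_sort]
    simp only [toBoundary, Finset.coe_mem, dite_true, Subtype.coe_eta]
    rw [← Finset.sum_div, Finset.sum_sub_distrib, hy.1, div_eq_one_iff_eq hW.ne']
    simp
  · obtain ⟨i, hi⟩ := exists_eq_minCoord hF y
    exact ⟨i, i.2, by simp [toBoundary, hi]⟩

theorem toBoundary_normalize (hF : F.Nonempty) {x : ℕ → ℝ}
    (hx : x ∈ spaceOf (faces (facetsOf F))) :
    toBoundary hF (‖centered F x‖⁻¹ • centered F x) = x := by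
  have hz := norm_pos_iff.2 (centered_ne_zero hx)
  have hN : (0 : ℝ) < F.card := by exact_mod_cast hF.card_pos
  obtain ⟨h0, hoff, -, a, ha, hxa⟩ := mem_spaceOf_simplex.1 hx
  have hval : ∀ i : F, (‖centered F x‖⁻¹ • centered F x) i =
      ‖centered F x‖⁻¹ * (x i - (F.card : ℝ)⁻¹) := fun i => by simp [centered]
  have hμ : minCoord hF (‖centered F x‖⁻¹ • centered F x) =
      -(‖centered F x‖⁻¹ * (F.card : ℝ)⁻¹) := by
    apply le_antisymm
    · refine (minCoord_le hF _ ⟨a, ha⟩).trans_eq ?_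
      rw [hval, hxa]; ring
    · obtain ⟨i, hi⟩ := exists_eq_minCoord hF (‖centered F x‖⁻¹ • centered F x)
      rw [← hi, hval]
      have := mul_nonneg (inv_nonneg.2 hz.le) (h0 i)
      linarith
  funext i
  unfold toBoundary
  split_ifs with h
  · rw [hμ, hval]
    field_simp
    ring
  · exact (hoff i h).symm

theorem normalize_toBoundary (hF : F.Nonempty) {y : EuclideanSpace ℝ F}
    (hy : y ∈ sumZeroSphere F) :
    ‖centered F (toBoundary hF y)‖⁻¹ • centered F (toBoundary hF y) = y := by
  have hμ := minCoord_neg hF hy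
  have hN : (0 : ℝ) < F.card := by exact_mod_cast hF.card_pos
  have hW : 0 < -(F.card * minCoord hF y) := by nlinarith
  have h1 : centered F (toBoundary hF y) = (-(F.card * minCoord hF y))⁻¹ • y := by
    ext i
    simp only [centered, toBoundary, Finset.coe_mem, dite_true, Subtype.coe_eta,
      PiLp.smul_apply, smul_eq_mul]
    have := hμ.ne
    field_simp
    ring
  rw [h1, norm_smul, hy.2, mul_one, Real.norm_of_nonneg (inv_nonneg.2 hW.le), inv_inv, smul_smul,
    mul_inv_cancel₀ hW.ne', one_smul]

/-- The boundary of a simplex is a round sphere. -/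
noncomputable def simplexBoundaryHomeomorph (hF : F.Nonempty) :
    spaceOf (faces (facetsOf F)) ≃ₜ sumZeroSphere F where
  toFun x := ⟨‖centered F x‖⁻¹ • centered F x, normalize_centered_mem hF x.2⟩
  invFun y := ⟨toBoundary hF y, toBoundary_mem hF y.2⟩
  left_inv x := Subtype.ext (toBoundary_normalize hF x.2)
  right_inv y := Subtype.ext (normalize_toBoundary hF y.2)
  continuous_toFun := by
    have hc : Continuous fun x : spaceOf (faces (facetsOf F)) => centered F x := by
      refine (PiLp.continuous_toLp 2 _).comp (continuous_pi fun i => ?_)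
      exact ((continuous_apply (i : ℕ)).comp continuous_subtype_val).sub continuous_const
    exact ((hc.norm.inv₀ fun x => norm_ne_zero_iff.2 (centered_ne_zero x.2)).smul hc).subtype_mk _
  continuous_invFun := by
    refine Continuous.subtype_mk (continuous_pi fun i => ?_) _
    unfold toBoundary
    have hm := (continuous_minCoord hF).comp (continuous_subtype_val (p := (· ∈ sumZeroSphere F)))
    split_ifs with h
    · refine Continuous.div ?_ (by fun_prop) fun y => ?_
      · exact Continuous.sub (by fun_prop) hm
      · have hμ := minCoord_neg hF y.2
        have hN : (0 : ℝ) < F.card := by exact_mod_cast hF.card_pos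
        nlinarith
    · exact continuous_const

theorem nonempty_sumZeroSphere_homeomorph {d : ℕ} (hF : F.card = d + 1) :
    Nonempty (sumZeroSphere F ≃ₜ Metric.sphere (0 : EuclideanSpace ℝ (Fin d)) 1) := by
  let v : EuclideanSpace ℝ F := WithLp.toLp 2 fun _ => 1
  have hv : v ≠ 0 := by
    obtain ⟨a, ha⟩ := Finset.card_pos.1 (by omega : 0 < F.card)
    intro h
    have : v ⟨a, ha⟩ = 0 := by rw [h]; rfl
    simp [v] at this
  have : Fact (Module.finrank ℝ (EuclideanSpace ℝ F) = d + 1) := ⟨by simp [hF]⟩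
  let e := (OrthonormalBasis.fromOrthogonalSpanSingleton (𝕜 := ℝ) d hv).repr
  have hmem : ∀ y : EuclideanSpace ℝ F, y ∈ (ℝ ∙ v)ᗮ ↔ ∑ i, y i = 0 := fun y => by
    rw [Submodule.mem_orthogonal_singleton_iff_inner_right, PiLp.inner_apply]
    simp [v]
  exact ⟨{
    toFun := fun y => ⟨e ⟨y, (hmem y).2 y.2.1⟩, by
      rw [mem_sphere_zero_iff_norm, e.norm_map]
      exact y.2.2⟩
    invFun := fun z => ⟨e.symm z, (hmem _).1 (e.symm z).2, by
      exact (e.symm.norm_map z).trans (mem_sphere_zero_iff_norm.1 z.2)⟩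
    left_inv := fun y => by simp
    right_inv := fun z => by simp
    continuous_toFun := by fun_prop
    continuous_invFun := (continuous_subtype_val.comp
      (e.symm.continuous.comp continuous_subtype_val)).subtype_mk _ }⟩

theorem isSphere_simplexBoundary {d : ℕ} (hF : F.card = d + 2) :
    IsSphere d (faces (facetsOf F)) := by
  obtain ⟨e⟩ := nonempty_sumZeroSphere_homeomorph (F := F) (d := d + 1) hF
  exact ⟨(simplexBoundaryHomeomorph (Finset.card_pos.1 (by omega))).trans e⟩

end SimplexBoundary


/-! ### Spheres built by bistellar moves -/

/-- The bistellar move on the simplex `F` which removes the facets `F \ {s}` with `s ∈ σ` from `K`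
and adds the remaining facets of `F` is possible. -/
structure Flippable (K : Finset (Finset ℕ)) (F σ : Finset ℕ) : Prop where
  ssubset : σ ⊂ F
  mem : ∀ s ∈ σ, F.erase s ∈ K
  missing : ∀ G ∈ K, ¬ σ ⊆ G

/-- Families of `m`-element facets obtained from the empty family by bistellar moves. -/
inductive FlipSphere (m : ℕ) : Finset (Finset ℕ) → Prop
  | empty : FlipSphere m ∅
  | flip {K F σ} : FlipSphere m K → F.card = m + 1 → Flippable K F σ →
      FlipSphere m (symmDiff K (facetsOf F))

section Flips

variable {m : ℕ} {K : Finset (Finset ℕ)} {F σ : Finset ℕ}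

theorem mem_facetsOf_iff_subset {G : Finset ℕ} (h : G.card + 1 = F.card) :
    G ∈ facetsOf F ↔ G ⊆ F := by
  rw [mem_facetsOf]
  constructor
  · rintro ⟨a, -, rfl⟩
    exact Finset.erase_subset _ _
  · intro hG
    obtain ⟨a, ha⟩ := Finset.card_eq_one.1
      (by rw [Finset.card_sdiff_of_subset hG]; omega : (F \ G).card = 1)
    have haF : a ∈ F \ G := by simp [ha]
    refine ⟨a, (Finset.mem_sdiff.1 haF).1, ?_⟩
    ext b
    have := Finset.ext_iff.1 ha b
    simp only [Finset.mem_sdiff, Finset.mem_singleton] at this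
    have hb := @hG b
    rw [Finset.mem_erase]
    tauto

theorem card_of_mem_facetsOf {G : Finset ℕ} (h : G ∈ facetsOf F) : G.card + 1 = F.card := by
  obtain ⟨a, ha, rfl⟩ := mem_facetsOf.1 h
  exact Finset.card_erase_add_one ha

theorem FlipSphere.card_eq (hK : FlipSphere m K) : ∀ G ∈ K, G.card = m := by
  induction hK with
  | empty => simp
  | flip _ hF _ ih =>
    intro G hG
    rcases Finset.mem_symmDiff.1 hG with h | h
    · exact ih G h.1
    · have := card_of_mem_facetsOf h.1
      omega

theorem Flippable.mem_symmDiff_iff (h : Flippable K F σ) {G : Finset ℕ} :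
    G ∈ symmDiff K (facetsOf F) ↔
      (G ∈ K ∧ G ∉ facetsOf F) ∨ ∃ a ∈ F, a ∉ σ ∧ F.erase a = G := by
  rw [Finset.mem_symmDiff]
  refine or_congr_right ⟨?_, ?_⟩
  · rintro ⟨hG, hGK⟩
    obtain ⟨a, ha, rfl⟩ := mem_facetsOf.1 hG
    exact ⟨a, ha, fun has => hGK (h.mem a has), rfl⟩
  · rintro ⟨a, ha, has, rfl⟩
    exact ⟨mem_facetsOf.2 ⟨a, ha, rfl⟩, fun hG => h.missing _ hG fun b hb =>
      Finset.mem_erase.2 ⟨fun hba => has (hba ▸ hb), h.ssubset.1 hb⟩⟩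

theorem even_card_symmDiff {α : Type*} [DecidableEq α] (A B : Finset α) :
    Even (symmDiff A B).card ↔ (Even A.card ↔ Even B.card) := by
  have h1 := Finset.card_inter_add_card_sdiff A B
  have h2 := Finset.card_inter_add_card_sdiff B A
  have h3 : (symmDiff A B).card = (A \ B).card + (B \ A).card :=
    Finset.card_union_of_disjoint disjoint_sdiff_sdiff
  rw [Finset.inter_comm] at h2
  rw [h3]
  simp only [Nat.even_iff]
  omega

theorem even_card_filter_facetsOf {ρ : Finset ℕ} (h : F.card = ρ.card + 2) :
    Even ((facetsOf F).filter (ρ ⊆ ·)).card := by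
  by_cases hρ : ρ ⊆ F
  · have : (facetsOf F).filter (ρ ⊆ ·) = (F \ ρ).image F.erase := by
      ext G
      simp only [Finset.mem_filter, mem_facetsOf, Finset.mem_image, Finset.mem_sdiff]
      constructor
      · rintro ⟨⟨a, ha, rfl⟩, hs⟩
        exact ⟨a, ⟨ha, fun h => Finset.notMem_erase a F (hs h)⟩, rfl⟩
      · rintro ⟨a, ⟨ha, har⟩, rfl⟩
        exact ⟨⟨a, ha, rfl⟩, fun b hb => Finset.mem_erase.2 ⟨fun e => har (e ▸ hb), hρ hb⟩⟩
    rw [this, Finset.card_image_of_injOn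
      ((Finset.erase_injOn F).mono (by simp)),
      Finset.card_sdiff_of_subset hρ]
    exact ⟨1, by omega⟩
  · rw [Finset.filter_eq_empty_iff.2, Finset.card_empty]
    · exact Even.zero
    · intro G hG hs
      obtain ⟨a, ha, rfl⟩ := mem_facetsOf.1 hG
      exact hρ (hs.trans (Finset.erase_subset _ _))

/-- Such a sphere is a minimal cycle, and so is the star of each of its faces relative to the
link boundary. -/
theorem FlipSphere.eq_empty_or_forall_mem (hK : FlipSphere m K) :
    ∀ (f : Finset ℕ) (C : Finset (Finset ℕ)), C ⊆ K → (∀ G ∈ C, f ⊆ G) →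
      (∀ ρ, f ⊆ ρ → ρ.card + 1 = m → Even (C.filter (ρ ⊆ ·)).card) →
      C = ∅ ∨ ∀ G ∈ K, f ⊆ G → G ∈ C := by
  induction hK with
  | empty => intro f C hC _ _; exact Or.inl (Finset.subset_empty.1 hC)
  | @flip K F σ hK hF hfl ih =>
    intro f C hC hf heven
    by_cases hex : ∃ t ∈ F, t ∉ σ ∧ F.erase t ∈ C
    · obtain ⟨t, htF, htσ, htC⟩ := hex
      have hfF : f ⊆ F := (hf _ htC).trans (Finset.erase_subset _ _)
      have claim : ∀ t' ∈ F, t' ∉ σ → f ⊆ F.erase t' → F.erase t' ∈ C := by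
        intro t' ht'F ht'σ hft'
        by_contra hnot
        have hne : t' ≠ t := fun e => hnot (e ▸ htC)
        have hcard : ((F.erase t).erase t').card + 1 = m := by
          have h1 := Finset.card_erase_add_one htF
          have h2 := Finset.card_erase_add_one (Finset.mem_erase.2 ⟨hne, ht'F⟩)
          omega
        have hfρ : f ⊆ (F.erase t).erase t' := fun b hb =>
          Finset.mem_erase.2 ⟨(Finset.mem_erase.1 (hft' hb)).1, hf _ htC hb⟩
        have hσρ : σ ⊆ (F.erase t).erase t' := fun b hb => by
          simp only [Finset.mem_erase]
          exact ⟨fun e => ht'σ (e ▸ hb), fun e => htσ (e ▸ hb), hfl.ssubset.1 hb⟩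
        have hone : C.filter ((F.erase t).erase t' ⊆ ·) = {F.erase t} := by
          ext G
          simp only [Finset.mem_filter, Finset.mem_singleton]
          constructor
          · rintro ⟨hG, hρG⟩
            rcases hfl.mem_symmDiff_iff.1 (hC hG) with h | ⟨a, haF, -, rfl⟩
            · exact absurd (hσρ.trans hρG) (hfl.missing G h.1)
            · by_contra hne'
              have hat : a ≠ t := fun e => hne' (e ▸ rfl)
              have hat' : a ≠ t' := fun e => hnot (e ▸ hG)
              exact Finset.notMem_erase a F (hρG (by simp [hat, hat', haF]))
          · rintro rfl
            exact ⟨htC, Finset.erase_subset _ _⟩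
        have := heven _ hfρ hcard
        rw [hone] at this
        simp at this
      have hsub : symmDiff C ((facetsOf F).filter (f ⊆ ·)) ⊆ K := by
        intro G hG
        rcases Finset.mem_symmDiff.1 hG with ⟨h1, h2⟩ | ⟨h1, h2⟩
        · rcases Finset.mem_symmDiff.1 (hC h1) with h | h
          · exact h.1
          · exact absurd (Finset.mem_filter.2 ⟨h.1, hf G h1⟩) h2
        · obtain ⟨hG1, hfG⟩ := Finset.mem_filter.1 h1
          obtain ⟨a, ha, rfl⟩ := mem_facetsOf.1 hG1
          by_cases haσ : a ∈ σ
          · exact hfl.mem a haσ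
          · exact absurd (claim a ha haσ hfG) h2
      rcases ih f (symmDiff C ((facetsOf F).filter (f ⊆ ·))) hsub
        (fun G hG => by
          rcases Finset.mem_symmDiff.1 hG with h | h
          · exact hf G h.1
          · exact (Finset.mem_filter.1 h.1).2)
        (fun ρ hfρ hρ => by
          have h1 : (symmDiff C ((facetsOf F).filter (f ⊆ ·))).filter (ρ ⊆ ·) =
              symmDiff (C.filter (ρ ⊆ ·)) ((facetsOf F).filter (ρ ⊆ ·)) := by
            ext G
            simp only [Finset.mem_filter, Finset.mem_symmDiff]
            have : ρ ⊆ G → f ⊆ G := hfρ.trans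
            tauto
          rw [h1, even_card_symmDiff]
          exact iff_of_true (heven ρ hfρ hρ) (even_card_filter_facetsOf (by omega))) with h | h
      · have hCB : C = (facetsOf F).filter (f ⊆ ·) := symmDiff_eq_bot.1 h
        have hσf : σ ⊆ f := fun s hs => by
          by_contra hsf
          have h1 : F.erase s ∈ C := by
            rw [hCB, Finset.mem_filter, mem_facetsOf]
            exact ⟨⟨s, hfl.ssubset.1 hs, rfl⟩, Finset.subset_erase.2 ⟨hfF, hsf⟩⟩
          rcases Finset.mem_symmDiff.1 (hC h1) with h2 | h2
          · exact h2.2 (mem_facetsOf.2 ⟨s, hfl.ssubset.1 hs, rfl⟩)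
          · exact h2.2 (hfl.mem s hs)
        refine Or.inr fun G hG hfG => ?_
        rcases Finset.mem_symmDiff.1 hG with h2 | h2
        · exact absurd (hσf.trans hfG) (hfl.missing G h2.1)
        · rw [hCB]
          exact Finset.mem_filter.2 ⟨h2.1, hfG⟩
      · refine Or.inr fun G hG hfG => ?_
        rcases hfl.mem_symmDiff_iff.1 hG with h2 | ⟨a, ha, haσ, rfl⟩
        · rcases Finset.mem_symmDiff.1 (h G h2.1 hfG) with h3 | h3
          · exact h3.1
          · exact absurd (Finset.mem_filter.1 h3.1).1 h2.2
        · exact claim a ha haσ hfG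
    · have hCK : C ⊆ K := fun G hG => by
        rcases hfl.mem_symmDiff_iff.1 (hC hG) with h2 | ⟨a, ha, haσ, rfl⟩
        · exact h2.1
        · exact absurd ⟨a, ha, haσ, hG⟩ hex
      rcases ih f C hCK hf heven with h | h
      · exact Or.inl h
      · by_cases hσf : σ ⊆ f
        · exact Or.inl (Finset.eq_empty_of_forall_notMem fun G hG =>
            hfl.missing G (hCK hG) (hσf.trans (hf G hG)))
        · obtain ⟨s, hs, hsf⟩ := Finset.not_subset.1 hσf
          refine Or.inr fun G hG hfG => ?_
          rcases hfl.mem_symmDiff_iff.1 hG with h2 | ⟨a, ha, haσ, rfl⟩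
          · exact h G h2.1 hfG
          · have h1 := h _ (hfl.mem s hs)
              (Finset.subset_erase.2 ⟨hfG.trans (Finset.erase_subset _ _), hsf⟩)
            have hsF : F.erase s ∈ facetsOf F := mem_facetsOf.2 ⟨s, hfl.ssubset.1 hs, rfl⟩
            rcases Finset.mem_symmDiff.1 (hC h1) with h2 | h2
            · exact absurd hsF h2.2
            · exact absurd (hfl.mem s hs) h2.2

theorem FlipSphere.eq_erase_of_sdiff_subset (hK : FlipSphere m K) (hF : F.card = m + 1)
    (h : Flippable K F σ) {G : Finset ℕ} (hG : G ∈ K) (hτ : F \ σ ⊆ G) :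
    ∃ s ∈ σ, F.erase s = G := by
  have hout : ∀ a ∈ F, F \ σ ⊆ F.erase a → a ∈ σ := fun a ha hs => by
    by_contra haσ
    exact Finset.notMem_erase a F (hs (Finset.mem_sdiff.2 ⟨ha, haσ⟩))
  rcases hK.eq_empty_or_forall_mem (F \ σ) (σ.image F.erase)
    (fun G hG => by
      obtain ⟨s, hs, rfl⟩ := Finset.mem_image.1 hG
      exact h.mem s hs)
    (fun G hG => by
      obtain ⟨s, hs, rfl⟩ := Finset.mem_image.1 hG
      exact Finset.subset_erase.2 ⟨Finset.sdiff_subset, by simp [hs]⟩)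
    (fun ρ hρ hc => by
      have : (σ.image F.erase).filter (ρ ⊆ ·) = (facetsOf F).filter (ρ ⊆ ·) := by
        ext G
        simp only [Finset.mem_filter, Finset.mem_image, mem_facetsOf]
        constructor
        · rintro ⟨⟨a, ha, rfl⟩, hs⟩
          exact ⟨⟨a, h.ssubset.1 ha, rfl⟩, hs⟩
        · rintro ⟨⟨a, ha, rfl⟩, hs⟩
          exact ⟨⟨a, hout a ha (hρ.trans hs), rfl⟩, hs⟩
      rw [this]
      exact even_card_filter_facetsOf (by omega)) with h0 | h1
  · rw [Finset.image_eq_empty] at h0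
    exact absurd (h0 ▸ Finset.empty_subset G) (h.missing G hG)
  · exact Finset.mem_image.1 (h1 G hG hτ)

theorem FlipSphere.not_sdiff_subset (hK : FlipSphere m K) (hF : F.card = m + 1)
    (h : Flippable K F σ) {G : Finset ℕ} (hG : G ∈ symmDiff K (facetsOf F)) : ¬ F \ σ ⊆ G := by
  intro hs
  rcases h.mem_symmDiff_iff.1 hG with h1 | ⟨a, ha, haσ, rfl⟩
  · obtain ⟨s, hsσ, rfl⟩ := hK.eq_erase_of_sdiff_subset hF h h1.1 hs
    exact h1.2 (mem_facetsOf.2 ⟨s, h.ssubset.1 hsσ, rfl⟩)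
  · exact Finset.notMem_erase a F (hs (Finset.mem_sdiff.2 ⟨ha, haσ⟩))

theorem Flippable.mem_faces_of_subset (h : Flippable K F σ) {s : Finset ℕ} (hs : s ⊆ F)
    (hτ : ¬ F \ σ ⊆ s) : s ∈ faces (symmDiff K (facetsOf F)) := by
  obtain ⟨t, ht, hts⟩ := Finset.not_subset.1 hτ
  obtain ⟨htF, htσ⟩ := Finset.mem_sdiff.1 ht
  exact ⟨F.erase t, h.mem_symmDiff_iff.2 (Or.inr ⟨t, htF, htσ, rfl⟩),
    Finset.subset_erase.2 ⟨hs, hts⟩⟩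

theorem Flippable.mem_faces (h : Flippable K F σ) {s : Finset ℕ} (hs : s ∈ faces K)
    (hτ : ¬ F \ σ ⊆ s) : s ∈ faces (symmDiff K (facetsOf F)) := by
  obtain ⟨G, hG, hsG⟩ := hs
  by_cases hGF : G ∈ facetsOf F
  · obtain ⟨a, -, rfl⟩ := mem_facetsOf.1 hGF
    exact h.mem_faces_of_subset (hsG.trans (Finset.erase_subset _ _)) hτ
  · exact ⟨G, Finset.mem_symmDiff.2 (Or.inl ⟨hG, hGF⟩), hsG⟩

theorem FlipSphere.exchange (hK : FlipSphere m K) (hF : F.card = m + 1) (h : Flippable K F σ) :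
    Exchange (faces K) (faces (symmDiff K (facetsOf F))) σ (F \ σ) where
  isComplex := isComplex_faces K
  keep _ hs hτ := h.mem_faces hs hτ
  swap := by
    rintro s ⟨G, hG, hsG⟩ hτs t ht
    obtain ⟨a, -, rfl⟩ := hK.eq_erase_of_sdiff_subset hF h hG (hτs.trans hsG)
    refine h.mem_faces_of_subset ?_ fun hs => Finset.notMem_erase t _ (hs ht)
    exact (Finset.erase_subset _ _).trans
      (Finset.union_subset (hsG.trans (Finset.erase_subset _ _)) h.ssubset.1)
  missing := fun ⟨G, hG, hs⟩ => h.missing G hG hs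

theorem FlipSphere.exchange_symm (hK : FlipSphere m K) (hF : F.card = m + 1)
    (h : Flippable K F σ) :
    Exchange (faces (symmDiff K (facetsOf F))) (faces K) (F \ σ) σ where
  isComplex := isComplex_faces _
  keep := by
    rintro s ⟨G, hG, hsG⟩ hσ
    rcases h.mem_symmDiff_iff.1 hG with h1 | ⟨a, ha, -, rfl⟩
    · exact ⟨G, h1.1, hsG⟩
    · obtain ⟨c, hc, hcs⟩ := Finset.not_subset.1 hσ
      exact ⟨_, h.mem c hc, Finset.subset_erase.2 ⟨hsG.trans (Finset.erase_subset _ _), hcs⟩⟩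
  swap := by
    rintro s ⟨G, hG, hsG⟩ hσs t ht
    rcases h.mem_symmDiff_iff.1 hG with h1 | ⟨a, ha, -, rfl⟩
    · exact absurd (hσs.trans hsG) (h.missing G h1.1)
    · exact ⟨_, h.mem t ht, Finset.erase_subset_erase _
        (Finset.union_subset (hsG.trans (Finset.erase_subset _ _)) Finset.sdiff_subset)⟩
  missing := fun ⟨G, hG, hs⟩ => hK.not_sdiff_subset hF h hG hs

theorem FlipSphere.eq_empty_or_isSphere {d : ℕ} (hK : FlipSphere (d + 1) K) :
    K = ∅ ∨ IsSphere d (faces K) := by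
  induction hK with
  | empty => exact Or.inl rfl
  | @flip K F σ hK hF h ih =>
    right
    rcases σ.eq_empty_or_nonempty with rfl | hσ
    · have : K = ∅ := Finset.eq_empty_of_forall_notMem fun G hG =>
        h.missing G hG (Finset.empty_subset G)
      subst this
      rw [← Finset.bot_eq_empty, bot_symmDiff]
      exact isSphere_simplexBoundary hF
    · obtain ⟨s, hs⟩ := hσ
      rcases ih with rfl | ⟨⟨e⟩⟩
      · exact absurd (h.mem s hs) (Finset.notMem_empty _)
      · exact ⟨((hK.exchange hF h).homeomorph (hK.exchange_symm hF h) ⟨s, hs⟩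
          (Finset.sdiff_nonempty.2 h.ssubset.2) Finset.disjoint_sdiff).symm.trans e⟩

end Flips

/-! ### Unions of disjoint pairs of consecutive integers -/

section Pairs

variable {k b : ℕ} {x y p : Fin k → ℕ}

/-- The lower element of the `i`-th pair coded by `x`. -/
def lo (b : ℕ) (x : Fin k → ℕ) (i : Fin k) : ℕ := b + x i + 2 * i

/-- The union of the disjoint pairs `{lo b x i, lo b x i + 1}`. -/
def pairs (b : ℕ) (x : Fin k → ℕ) : Finset ℕ :=
  Finset.univ.biUnion fun i => {lo b x i, lo b x i + 1}

theorem mem_pairs {z : ℕ} : z ∈ pairs b x ↔ ∃ i, z = lo b x i ∨ z = lo b x i + 1 := by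
  simp [pairs]

theorem lo_mem_pairs (i : Fin k) : lo b x i ∈ pairs b x := mem_pairs.2 ⟨i, Or.inl rfl⟩

theorem lo_add_one_mem_pairs (i : Fin k) : lo b x i + 1 ∈ pairs b x :=
  mem_pairs.2 ⟨i, Or.inr rfl⟩

theorem lo_add_two_le (hx : Monotone x) {i j : Fin k} (h : i < j) :
    lo b x i + 2 ≤ lo b x j := by
  have h1 := hx h.le
  have h2 : (i : ℕ) < j := h
  unfold lo
  omega

theorem lo_le_lo (hx : Monotone x) {i j : Fin k} (h : i ≤ j) : lo b x i ≤ lo b x j := by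
  have h1 := hx h
  have h2 : (i : ℕ) ≤ j := h
  unfold lo
  omega

theorem lo_injective (hx : Monotone x) : Function.Injective (lo b x) := by
  intro i j h
  rcases lt_trichotomy i j with h1 | h1 | h1
  · have := lo_add_two_le (b := b) hx h1; omega
  · exact h1
  · have := lo_add_two_le (b := b) hx h1; omega

theorem lo_ne_lo_add_one (hx : Monotone x) (i j : Fin k) : lo b x i ≠ lo b x j + 1 := by
  rcases lt_trichotomy i j with h1 | rfl | h1
  · have := lo_add_two_le (b := b) hx h1; omega
  · omega
  · have := lo_add_two_le (b := b) hx h1; omega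

theorem card_biUnion_pair (hx : Monotone x) (S : Finset (Fin k)) :
    (S.biUnion fun i => {lo b x i, lo b x i + 1}).card = 2 * S.card := by
  rw [Finset.card_biUnion]
  · simp [mul_comm]
  · intro i _ j _ hij
    have h1 := lo_ne_lo_add_one (b := b) hx i j
    have h2 := lo_ne_lo_add_one (b := b) hx j i
    have h3 := (lo_injective (b := b) hx).ne hij
    simp
    omega

theorem card_pairs (hx : Monotone x) : (pairs b x).card = 2 * k := by
  simp [pairs, card_biUnion_pair hx]

/-- Gale's evenness condition. -/
theorem even_card_filter_lt (hx : Monotone x) {z : ℕ} (hz : z ∉ pairs b x) :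
    Even ((pairs b x).filter (· < z)).card := by
  have : (pairs b x).filter (· < z) =
      (Finset.univ.filter (lo b x · < z)).biUnion fun i => {lo b x i, lo b x i + 1} := by
    ext w
    simp only [Finset.mem_filter, mem_pairs, Finset.mem_biUnion, Finset.mem_univ, true_and,
      Finset.mem_insert, Finset.mem_singleton]
    constructor
    · rintro ⟨⟨i, hi⟩, hw⟩
      exact ⟨i, by omega, hi⟩
    · rintro ⟨i, h, hi⟩
      have : z ≠ lo b x i + 1 := fun e => hz (e ▸ lo_add_one_mem_pairs i)
      exact ⟨⟨i, hi⟩, by omega⟩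
  rw [this, card_biUnion_pair hx]
  exact even_two_mul _

theorem not_between {ρ : Finset ℕ} (hx : Monotone x) (hy : Monotone y) {u v w : ℕ} (huv : u < v)
    (hvw : v < w) (hu : u ∉ ρ) (hv : v ∉ ρ) (hux : insert u ρ = pairs b x)
    (hwy : insert w ρ = pairs b y) : False := by
  have h1 := even_card_filter_lt (b := b) hx (z := v) (by rw [← hux]; simp [hv, huv.ne'])
  have h2 := even_card_filter_lt (b := b) hy (z := v) (by rw [← hwy]; simp [hv, hvw.ne])
  rw [← hux, Finset.filter_insert, if_pos huv, Finset.card_insert_of_notMem (by simp [hu])] at h1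
  rw [← hwy, Finset.filter_insert, if_neg hvw.not_gt] at h2
  rw [Nat.even_add_one] at h1
  exact h1 h2

theorem exists_insert_eq {ρ A : Finset ℕ} (h : ρ ⊆ A) (hc : ρ.card + 1 = A.card) :
    ∃ z ∉ ρ, insert z ρ = A := by
  obtain ⟨z, hz, rfl⟩ := mem_facetsOf.1 ((mem_facetsOf_iff_subset hc).2 h)
  exact ⟨z, Finset.notMem_erase _ _, Finset.insert_erase hz⟩

theorem le_of_uppers_mem_pairs (hx : Monotone x) (hy : Monotone y)
    (h : ∀ i, 0 < x i → lo b x i + 1 ∈ pairs b y) : x ≤ y := by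
  by_contra hnot
  have hne : (Finset.univ.filter fun j => y j < x j).Nonempty := by
    simp only [Pi.le_def, not_forall, not_le] at hnot
    obtain ⟨j, hj⟩ := hnot
    exact ⟨j, by simp [hj]⟩
  obtain ⟨j, hj, hmax⟩ := Finset.exists_max_image _ id hne
  simp only [Finset.mem_filter, Finset.mem_univ, true_and, id] at hj hmax
  obtain ⟨i, hi⟩ := mem_pairs.1 (h j (by omega))
  rcases le_or_gt i j with hij | hij
  · have h1 := lo_le_lo (b := b) hy hij
    unfold lo at *
    omega
  · have h1 : x i ≤ y i := by
      by_contra! h1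
      exact hij.not_ge (hmax i h1)
    have h2 := hx hij.le
    have h3 : (j : ℕ) < i := hij
    unfold lo at hi
    omega

theorem eq_of_pairs_subset (hx : Monotone x) (hy : Monotone y) (h : pairs b x ⊆ pairs b y) :
    x = y := by
  have he : pairs b x = pairs b y := Finset.eq_of_subset_of_card_le h
    (by rw [card_pairs hx, card_pairs hy])
  exact le_antisymm (le_of_uppers_mem_pairs hx hy fun i _ => h (lo_add_one_mem_pairs i))
    (le_of_uppers_mem_pairs hy hx fun i _ => he.ge (lo_add_one_mem_pairs i))

/-- A ridge lies in at most two unions of pairs. -/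
theorem eq_or_eq_of_ridge_subset {x₁ x₂ x₃ : Fin k → ℕ} (h₁ : Monotone x₁) (h₂ : Monotone x₂)
    (h₃ : Monotone x₃) {ρ : Finset ℕ} (hc : ρ.card + 1 = 2 * k) (hρ₁ : ρ ⊆ pairs b x₁)
    (hρ₂ : ρ ⊆ pairs b x₂) (hρ₃ : ρ ⊆ pairs b x₃) (hne : x₁ ≠ x₂) : x₃ = x₁ ∨ x₃ = x₂ := by
  obtain ⟨u, hu, hu'⟩ := exists_insert_eq hρ₁ (by rw [hc, card_pairs h₁])
  obtain ⟨v, hv, hv'⟩ := exists_insert_eq hρ₂ (by rw [hc, card_pairs h₂])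
  obtain ⟨w, hw, hw'⟩ := exists_insert_eq hρ₃ (by rw [hc, card_pairs h₃])
  have huv : u ≠ v := fun e => hne (eq_of_pairs_subset h₁ h₂ (by rw [← hu', ← hv', e]))
  by_contra! h
  have huw : w ≠ u := fun e => h.1 (eq_of_pairs_subset h₃ h₁ (by rw [← hu', ← hw', e]))
  have hvw : w ≠ v := fun e => h.2 (eq_of_pairs_subset h₃ h₂ (by rw [← hv', ← hw', e]))
  rcases lt_or_gt_of_ne huv with h1 | h1 <;> rcases lt_or_gt_of_ne huw with h2 | h2 <;>
    rcases lt_or_gt_of_ne hvw with h3 | h3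
  · exact not_between h₃ h₂ h2 h1 hw hu hw' hv'
  · omega
  · exact not_between h₁ h₂ h2 h3 hu hw hu' hv'
  · exact not_between h₁ h₃ h1 h3 hu hv hu' hw'
  · exact not_between h₃ h₁ h3 h1 hw hv hw' hu'
  · exact not_between h₂ h₁ h3 h2 hv hw hv' hu'
  · omega
  · exact not_between h₂ h₃ h1 h2 hv hu hv' hw'

/-- The predecessor of `x` across the ridge obtained by deleting `lo b x i + 1`. -/
def down (x : Fin k → ℕ) (i l : Fin k) : ℕ := if l ≤ i ∧ x l = x i then x l - 1 else x l

theorem down_le (x : Fin k → ℕ) (i : Fin k) : down x i ≤ x := fun l => by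
  change down x i l ≤ x l
  unfold down; split_ifs <;> omega

theorem le_down_add_one (x : Fin k → ℕ) (i l : Fin k) : x l ≤ down x i l + 1 := by
  unfold down; split_ifs <;> omega

theorem down_self {i : Fin k} : down x i i = x i - 1 := by simp [down]

theorem down_ne {i : Fin k} (h : 0 < x i) : down x i ≠ x := fun e => by
  have := congrFun e i
  rw [down_self] at this
  omega

theorem monotone_down (hx : Monotone x) (i : Fin k) : Monotone (down x i) := by
  intro l l' hl
  have h1 := hx hl
  unfold down
  split_ifs with h2 h3 h3
  · omega
  · omega
  · have h4 : x l ≠ x i := fun e => h2 ⟨hl.trans h3.1, e⟩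
    omega
  · exact h1

theorem erase_upper_subset (hx : Monotone x) {i : Fin k} (h : 0 < x i) :
    (pairs b x).erase (lo b x i + 1) ⊆ pairs b (down x i) := by
  intro z hz
  obtain ⟨hne, hz⟩ := Finset.mem_erase.1 hz
  obtain ⟨l, hl⟩ := mem_pairs.1 hz
  by_cases hd : l ≤ i ∧ x l = x i
  · rcases hl with rfl | rfl
    · refine mem_pairs.2 ⟨l, Or.inr ?_⟩
      simp only [lo, down, if_pos hd]
      omega
    · have hli : l < i := lt_of_le_of_ne hd.1 fun e => hne (by rw [e])
      have hli' : (l : ℕ) < i := hli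
      have hi := i.2
      let l' : Fin k := ⟨l + 1, by omega⟩
      have h1 : l' ≤ i := Fin.le_def.2 (by simp [l']; omega)
      have h2 : x l ≤ x l' := hx (Fin.le_def.2 (by simp [l']))
      have h3 : x l' ≤ x i := hx h1
      have h4 : x l' = x i := by omega
      refine mem_pairs.2 ⟨l', Or.inl ?_⟩
      simp only [lo, down, h1, h4, true_and, if_true, l']
      omega
  · refine mem_pairs.2 ⟨l, ?_⟩
    simpa only [lo, down, if_neg hd] using hl

theorem eq_or_eq_down (hx : Monotone x) (hy : Monotone y) {i : Fin k} (h : 0 < x i)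
    (hs : (pairs b x).erase (lo b x i + 1) ⊆ pairs b y) : y = x ∨ y = down x i := by
  refine eq_or_eq_of_ridge_subset hx (monotone_down hx i) hy ?_ (Finset.erase_subset _ _)
    (erase_upper_subset hx h) hs (down_ne h).symm
  rw [Finset.card_erase_add_one (lo_add_one_mem_pairs i), card_pairs hx]

theorem pairs_succ (x : Fin k → ℕ) : pairs b (x + 1) = pairs (b + 1) x := by
  ext z
  have : ∀ i, lo b (x + 1) i = lo (b + 1) x i := fun i => by simp [lo]; omega
  simp [mem_pairs, this]

theorem exists_subset_pairs {k b n : ℕ} {r : Finset ℕ} (hr : ∀ z ∈ r, b ≤ z ∧ z < b + n)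
    (hk : r.card ≤ k) (hn : 2 * k ≤ n) :
    ∃ x : Fin k → ℕ, Monotone x ∧ (∀ i, x i ≤ n - 2 * k) ∧ r ⊆ pairs b x := by
  induction k generalizing r n with
  | zero =>
    rw [Nat.le_zero, Finset.card_eq_zero] at hk
    exact ⟨fun _ => 0, fun i => i.elim0, fun i => i.elim0, by simp [hk]⟩
  | succ k ih =>
    by_cases hlow : ∀ z ∈ r, z < b + 2 * (k + 1)
    · refine ⟨fun _ => 0, monotone_const, fun _ => Nat.zero_le _, fun z hz => ?_⟩
      have h1 := hlow z hz
      have h2 := hr z hz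
      refine mem_pairs.2 ⟨⟨(z - b) / 2, by omega⟩, ?_⟩
      simp only [lo]
      omega
    · push Not at hlow
      obtain ⟨z, hz, hzl⟩ := hlow
      obtain ⟨M, hM, hmax⟩ := Finset.exists_max_image r id ⟨z, hz⟩
      simp only [id] at hmax
      have hMl := hmax z hz
      have hMr := hr M hM
      obtain ⟨x, hx, hxb, hxr⟩ := ih (r := (r.erase M).erase (M - 1)) (n := M - 1 - b)
        (fun w hw => by
          simp only [Finset.mem_erase] at hw
          have h1 := hmax w hw.2.2
          have h2 := hr w hw.2.2
          omega)
        (by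
          have h1 := Finset.card_erase_add_one hM
          have h2 := Finset.card_erase_le (s := r.erase M) (a := M - 1)
          omega) (by omega)
      refine ⟨Fin.snoc (α := fun _ => ℕ) x (M - 1 - b - 2 * k), ?_, ?_, ?_⟩
      · intro i j hij
        induction j using Fin.lastCases with
        | last =>
          induction i using Fin.lastCases with
          | last => exact le_rfl
          | cast i => simpa using hxb i
        | cast j =>
          induction i using Fin.lastCases with
          | last => exact absurd hij (not_le.2 (Fin.castSucc_lt_last j))
          | cast i => simpa using hx (by simpa using hij)
      · intro i
        induction i using Fin.lastCases with
        | last => simp; omega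
        | cast i =>
          have := hxb i
          simp
          omega
      · intro w hw
        by_cases hwM : w = M ∨ w = M - 1
        · refine mem_pairs.2 ⟨Fin.last k, ?_⟩
          simp only [lo, Fin.snoc_last, Fin.val_last]
          omega
        · push Not at hwM
          obtain ⟨i, hi⟩ := mem_pairs.1 (hxr (by simp [hw, hwM] : w ∈ _))
          refine mem_pairs.2 ⟨i.castSucc, ?_⟩
          simpa [lo] using hi

theorem pairs_lt {N : ℕ} (hx : ∀ i, x i ≤ N) {z : ℕ} (hz : z ∈ pairs b x) :
    b ≤ z ∧ z < b + N + 2 * k := by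
  obtain ⟨i, hi⟩ := mem_pairs.1 hz
  have h1 := hx i
  have h2 := i.2
  unfold lo at hi
  omega

/-- The upper elements of the pairs which can be moved down. -/
def uppers (b : ℕ) (x : Fin k → ℕ) : Finset ℕ :=
  (Finset.univ.filter (0 < x ·)).image (lo b x · + 1)

theorem mem_uppers {z : ℕ} : z ∈ uppers b x ↔ ∃ i, 0 < x i ∧ lo b x i + 1 = z := by
  simp [uppers]

theorem uppers_subset : uppers b x ⊆ pairs b x := fun z hz => by
  obtain ⟨i, -, rfl⟩ := mem_uppers.1 hz
  exact lo_add_one_mem_pairs i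

theorem card_uppers_le : (uppers b x).card ≤ k := by
  refine Finset.card_image_le.trans ((Finset.card_filter_le _ _).trans ?_)
  simp

theorem le_of_uppers_subset (hx : Monotone x) (hy : Monotone y)
    (h : uppers b x ⊆ pairs b y) : x ≤ y :=
  le_of_uppers_mem_pairs hx hy fun i hi => h (mem_uppers.2 ⟨i, hi, rfl⟩)

/-- A finite lower set of monotone functions. -/
structure IsLow (I : Finset (Fin k → ℕ)) : Prop where
  monotone : ∀ p ∈ I, Monotone p
  mem_of_le : ∀ p ∈ I, ∀ q, Monotone q → q ≤ p → q ∈ I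

theorem IsLow.induction {C : Finset (Fin k → ℕ) → Prop} (h0 : C ∅)
    (hs : ∀ I p, IsLow I → IsLow (insert p I) → p ∉ I → C I → C (insert p I))
    (I : Finset (Fin k → ℕ)) (hI : IsLow I) : C I := by
  induction hc : I.card generalizing I with
  | zero => rwa [Finset.card_eq_zero.1 hc]
  | succ c ih =>
    obtain ⟨p, hp⟩ := Finset.exists_maximal (Finset.card_pos.1 (by omega : 0 < I.card))
    have hlow : IsLow (I.erase p) := by
      refine ⟨fun q hq => hI.monotone q (Finset.mem_of_mem_erase hq), fun q hq r hr hrq => ?_⟩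
      obtain ⟨hne, hqI⟩ := Finset.mem_erase.1 hq
      refine Finset.mem_erase.2 ⟨?_, hI.mem_of_le q hqI r hr hrq⟩
      rintro rfl
      exact hne (le_antisymm (hp.2 hqI hrq) hrq)
    have hins : insert p (I.erase p) = I := Finset.insert_erase hp.1
    rw [← hins]
    refine hs _ p hlow (hins.symm ▸ hI) (Finset.notMem_erase _ _) (ih _ hlow ?_)
    rw [Finset.card_erase_of_mem hp.1]
    omega

theorem IsLow.not_le {I : Finset (Fin k → ℕ)} (hI : IsLow I) (hp : Monotone p) (h : p ∉ I)
    (hx : x ∈ I) : ¬ p ≤ x := fun hle => h (hI.mem_of_le x hx p hp hle)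

theorem IsLow.down_mem {I : Finset (Fin k → ℕ)} (hI : IsLow (insert p I)) {i : Fin k}
    (hi : 0 < p i) : down p i ∈ I := by
  have hp := Finset.mem_insert_self p I
  exact Finset.mem_of_mem_insert_of_ne
    (hI.mem_of_le p hp _ (monotone_down (hI.monotone p hp) i) (down_le p i)) (down_ne hi)

open Classical in
/-- All monotone functions bounded by `N`. -/
noncomputable def box (k N : ℕ) : Finset (Fin k → ℕ) :=
  (Finset.Iic fun _ => N).filter Monotone

theorem mem_box {N : ℕ} : x ∈ box k N ↔ (∀ i, x i ≤ N) ∧ Monotone x := by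
  simp [box, Pi.le_def]

theorem isLow_box (k N : ℕ) : IsLow (box k N) where
  monotone _ hp := (mem_box.1 hp).2
  mem_of_le _ hp _ hq hqp := mem_box.2 ⟨fun i => (hqp i).trans ((mem_box.1 hp).1 i), hq⟩

end Pairs

/-! ### Flipping lower sets of pair unions -/

section Stages

variable {k b m : ℕ} {x y p : Fin k → ℕ} {Y : Finset ℕ}

open Finset in
theorem odd_card_filter_insert {α : Type*} [DecidableEq α] {I : Finset α} {a : α} (h : a ∉ I)
    (P : α → Prop) [DecidablePred P] :
    Odd #{x ∈ insert a I | P x} ↔ Xor (Odd #{x ∈ I | P x}) (P a) := by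
  rw [filter_insert]
  split_ifs with hP
  · rw [card_insert_of_notMem (by simp [h]), Nat.odd_add_one]
    simp [Xor, hP]
  · simp [Xor, hP]

theorem card_union_pairs (hx : Monotone x) (hd : Disjoint Y (pairs b x)) :
    (Y ∪ pairs b x).card = Y.card + 2 * k := by
  rw [Finset.card_union_of_disjoint hd, card_pairs hx]

theorem erase_mem_facetsOf_iff (hx : Monotone x) (hy : Monotone y)
    (hdx : Disjoint Y (pairs b x)) (hdy : Disjoint Y (pairs b y)) {s : ℕ} (hs : s ∈ pairs b x) :
    (Y ∪ pairs b x).erase s ∈ facetsOf (Y ∪ pairs b y) ↔ (pairs b x).erase s ⊆ pairs b y := by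
  rw [mem_facetsOf_iff_subset (by rw [Finset.card_erase_add_one (Finset.mem_union_right _ hs),
    card_union_pairs hx hdx, card_union_pairs hy hdy])]
  constructor
  · intro h z hz
    obtain ⟨hne, hz⟩ := Finset.mem_erase.1 hz
    exact (Finset.mem_union.1 (h (Finset.mem_erase.2 ⟨hne, Finset.mem_union_right _ hz⟩))).resolve_left
      fun hY => Finset.disjoint_left.1 hdx hY hz
  · intro h z hz
    obtain ⟨hne, hz⟩ := Finset.mem_erase.1 hz
    rcases Finset.mem_union.1 hz with hz | hz
    · exact Finset.mem_union_left _ hz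
    · exact Finset.mem_union_right _ (h (Finset.mem_erase.2 ⟨hne, hz⟩))

theorem erase_upper_mem_facetsOf_iff (hx : Monotone x) (hy : Monotone y)
    (hdx : Disjoint Y (pairs b x)) (hdy : Disjoint Y (pairs b y)) {i : Fin k} (hi : 0 < x i) :
    (Y ∪ pairs b x).erase (lo b x i + 1) ∈ facetsOf (Y ∪ pairs b y) ↔ y = x ∨ y = down x i := by
  rw [erase_mem_facetsOf_iff hx hy hdx hdy (lo_add_one_mem_pairs i)]
  constructor
  · exact eq_or_eq_down hx hy hi
  · rintro (rfl | rfl)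
    · exact Finset.erase_subset _ _
    · exact erase_upper_subset hx hi

theorem subset_of_mem_facetsOf {F G : Finset ℕ} (h : G ∈ facetsOf F) : G ⊆ F := by
  obtain ⟨a, -, rfl⟩ := mem_facetsOf.1 h
  exact Finset.erase_subset _ _

theorem le_of_uppers_subset_union (hx : Monotone x) (hy : Monotone y)
    (hdx : Disjoint Y (pairs b x)) (h : uppers b x ⊆ Y ∪ pairs b y) : x ≤ y :=
  le_of_uppers_subset (b := b) hx hy fun _ hz => (Finset.mem_union.1 (h hz)).resolve_left
    fun hY => Finset.disjoint_left.1 hdx hY (uppers_subset hz)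

theorem filter_eq_singleton {α : Type*} [DecidableEq α] {I : Finset α} {a : α} (ha : a ∈ I)
    {P : α → Prop} [DecidablePred P] (h : ∀ x ∈ I, P x ↔ x = a) : I.filter P = {a} := by
  ext x
  simp only [Finset.mem_filter, Finset.mem_singleton]
  constructor
  · exact fun hx => (h x hx.1).1 hx.2
  · rintro rfl
    exact ⟨ha, (h x ha).2 rfl⟩

theorem exists_of_odd_card_filter {α : Type*} {I : Finset α} {P : α → Prop} [DecidablePred P]
    (h : Odd (I.filter P).card) : ∃ x ∈ I, P x := by
  obtain ⟨x, hx⟩ := Finset.card_pos.1 h.pos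
  exact ⟨x, Finset.mem_filter.1 hx⟩

open Finset in
/-- The boundary of the ball whose facets are the joins of the simplex `Y` with the pair unions
coded by a lower set is obtained by bistellar moves. -/
theorem exists_flipSphere_of_isLow (hY : ∀ v ∈ Y, v < b) (hk : 1 ≤ k) (hm : m + 1 = 2 * k + #Y)
    (I : Finset (Fin k → ℕ)) (hI : IsLow I) :
    ∃ K, FlipSphere m K ∧
      (∀ G, G ∈ K ↔ Odd #{x ∈ I | G ∈ facetsOf (Y ∪ pairs b x)}) ∧
      ∀ x ∈ I, ∀ s ⊆ Y ∪ pairs b x, #s < k + #Y → s ∈ faces K := by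
  have hd : ∀ x : Fin k → ℕ, Disjoint Y (pairs b x) := fun x => by
    rw [disjoint_left]
    intro z hz hz'
    obtain ⟨i, hi⟩ := mem_pairs.1 hz'
    have := hY z hz
    unfold lo at hi
    omega
  refine IsLow.induction (C := fun I => ∃ K, FlipSphere m K ∧
      (∀ G, G ∈ K ↔ Odd #{x ∈ I | G ∈ facetsOf (Y ∪ pairs b x)}) ∧
      ∀ x ∈ I, ∀ s ⊆ Y ∪ pairs b x, #s < k + #Y → s ∈ faces K)
    ⟨∅, .empty, by simp, by simp⟩ ?_ I hI
  rintro I p hI hI' hpI ⟨K, hK, hmem, hface⟩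
  have hp : Monotone p := hI'.monotone p (mem_insert_self _ _)
  have hF : #(Y ∪ pairs b p) = m + 1 := by rw [card_union_pairs hp (hd p)]; omega
  have hsub : uppers b p ⊆ Y ∪ pairs b p := uppers_subset.trans subset_union_right
  have hup := card_uppers_le (b := b) (x := p)
  have hfl : Flippable K (Y ∪ pairs b p) (uppers b p) := by
    refine ⟨⟨hsub, fun h => ?_⟩, fun s hs => ?_, fun G hG hs => ?_⟩
    · have := card_le_card h
      omega
    · obtain ⟨i, hi, rfl⟩ := mem_uppers.1 hs
      rw [hmem, filter_eq_singleton (hI'.down_mem hi), card_singleton]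
      · exact odd_one
      · intro x hx
        rw [erase_upper_mem_facetsOf_iff hp (hI.monotone x hx) (hd p) (hd x) hi]
        exact or_iff_right fun e => hpI (e ▸ hx)
    · obtain ⟨x, hx, hGx⟩ := exists_of_odd_card_filter ((hmem G).1 hG)
      exact hI.not_le hp hpI hx (le_of_uppers_subset_union hp (hI.monotone x hx) (hd p)
        (hs.trans (subset_of_mem_facetsOf hGx)))
  have hτ : ∀ s : Finset ℕ, #s < k + #Y → ¬ (Y ∪ pairs b p) \ uppers b p ⊆ s := by
    intro s hs h
    have h1 := card_le_card h
    rw [card_sdiff_of_subset hsub] at h1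
    omega
  refine ⟨_, hK.flip hF hfl, fun G => ?_, fun x hx s hs hsc => ?_⟩
  · rw [odd_card_filter_insert hpI, mem_symmDiff, hmem]
    rfl
  · rcases mem_insert.1 hx with rfl | hx
    · exact hfl.mem_faces_of_subset hs (hτ s hsc)
    · exact hfl.mem_faces (hface x hx s hs hsc) (hτ s hsc)

/-- The elements of `I` whose diagonal successor is not in `I`. -/
def front (I : Finset (Fin k → ℕ)) : Finset (Fin k → ℕ) := I.filter (· + 1 ∉ I)

theorem mem_front {I : Finset (Fin k → ℕ)} : x ∈ front I ↔ x ∈ I ∧ x + 1 ∉ I := by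
  simp [front]

theorem xor_prop_assoc (A N P : Prop) : Xor (Xor A N) P ↔ Xor A (Xor N P) := by
  by_cases A <;> by_cases N <;> by_cases P <;> simp [Xor, *]

theorem xor_xor_xor_cancel (A N P Q : Prop) :
    Xor (Xor (Xor A (Xor N Q)) P) Q ↔ Xor A (Xor N P) := by
  by_cases A <;> by_cases N <;> by_cases P <;> by_cases Q <;> simp [Xor, *]

set_option maxHeartbeats 1000000 in
open Finset in
/-- Inserting the new vertex `v` into the sphere `Δ` by flips along the pair unions coded by a
lower set preserves the faces with at most `k` vertices. -/
theorem exists_flipSphere_insert {Δ : Finset (Finset ℕ)} {B : Finset (Fin k → ℕ)} {v : ℕ}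
    (hk : 1 ≤ k) (hΔ : FlipSphere (2 * k) Δ) (hvΔ : ∀ G ∈ Δ, v ∉ G)
    (hB : ∀ x ∈ B, pairs (b + 1) x ∈ Δ) (I : Finset (Fin k → ℕ)) (hI : IsLow I) : I ⊆ B →
    ∃ K, FlipSphere (2 * k) K ∧
      (∀ G, G ∈ K ↔ Xor (G ∈ Δ) (Odd #{x ∈ front I | G ∈ facetsOf ({v} ∪ pairs (b + 1) x)})) ∧
      (∀ s ∈ faces Δ, #s ≤ k → s ∈ faces K) ∧
      ∀ x ∈ I, ∀ r ⊆ pairs (b + 1) x, #r < k → insert v r ∈ faces K := by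
  have hd : ∀ x ∈ B, Disjoint {v} (pairs (b + 1) x) := fun x hx =>
    disjoint_singleton_left.2 (hvΔ _ (hB x hx))
  revert I
  refine IsLow.induction (fun _ => ⟨Δ, hΔ, by simp [front, Xor], fun s hs _ => hs, by simp⟩) ?_
  intro I p hI hI' hpI ih hIB
  have hpB : p ∈ B := hIB (mem_insert_self _ _)
  have hIB' : I ⊆ B := (subset_insert _ _).trans hIB
  obtain ⟨K, hK, hmem, hfΔ, hfv⟩ := ih hIB'
  have hp : Monotone p := hI'.monotone p (mem_insert_self _ _)
  have hne1 : ∀ x : Fin k → ℕ, x + 1 ≠ x := fun x e => by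
    have := congrFun e ⟨0, hk⟩
    simp at this
  have hvp : v ∉ pairs (b + 1) p := hvΔ _ (hB p hpB)
  have hdp := hd p hpB
  have hF : #({v} ∪ pairs (b + 1) p) = 2 * k + 1 := by
    rw [card_union_pairs hp hdp, card_singleton, add_comm]
  have hsub : {v} ∪ uppers (b + 1) p ⊆ {v} ∪ pairs (b + 1) p :=
    union_subset_union subset_rfl uppers_subset
  have hup := card_uppers_le (b := b + 1) (x := p)
  have hfront : front I ⊆ I := filter_subset _ _
  have hv_notMem : ∀ {G : Finset ℕ}, v ∈ G → G ∉ Δ := fun hG h => hvΔ _ h hG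
  have hfl : Flippable K ({v} ∪ pairs (b + 1) p) ({v} ∪ uppers (b + 1) p) := by
    refine ⟨⟨hsub, fun h => ?_⟩, fun s hs => ?_, fun G hG hs => ?_⟩
    · have h1 := card_le_card h
      have h2 := card_union_le {v} (uppers (b + 1) p)
      rw [card_singleton] at h2
      omega
    · rcases mem_union.1 hs with hs | hs
      · rw [mem_singleton.1 hs]
        have he : ({v} ∪ pairs (b + 1) p).erase v = pairs (b + 1) p := by
          rw [← insert_eq, erase_insert hvp]
        rw [he, hmem]
        refine Or.inl ⟨hB p hpB, fun hodd => ?_⟩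
        obtain ⟨x, hx, hGx⟩ := exists_of_odd_card_filter hodd
        have hxI := hfront hx
        refine hpI (eq_of_pairs_subset (b := b + 1) hp (hI.monotone x hxI) (fun z hz => ?_) ▸ hxI)
        refine (mem_union.1 (subset_of_mem_facetsOf hGx hz)).resolve_left fun h => ?_
        exact hvp (mem_singleton.1 h ▸ hz)
      · obtain ⟨i, hi, rfl⟩ := mem_uppers.1 hs
        rw [hmem]
        refine Or.inr ⟨?_, hv_notMem ?_⟩
        · have hdI := hI'.down_mem hi
          rw [filter_eq_singleton (a := down p i), card_singleton]
          · exact odd_one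
          · exact mem_front.2 ⟨hdI, fun h => hI.not_le hp hpI h (le_down_add_one p i)⟩
          · intro x hx
            have hxI := hfront hx
            rw [erase_upper_mem_facetsOf_iff hp (hI.monotone x hxI) hdp (hd x (hIB' hxI)) hi]
            exact or_iff_right fun e => hpI (e ▸ hxI)
        · refine mem_erase.2 ⟨fun e => hvp ?_, by simp⟩
          rw [e]
          exact lo_add_one_mem_pairs i
    · have hvG : v ∈ G := hs (by simp)
      rcases (hmem G).1 hG with h | h
      · exact hv_notMem hvG h.1
      · obtain ⟨x, hx, hGx⟩ := exists_of_odd_card_filter h.1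
        have hxI := hfront hx
        exact hI.not_le hp hpI hxI (le_of_uppers_subset_union hp (hI.monotone x hxI) hdp
          ((subset_union_right.trans hs).trans (subset_of_mem_facetsOf hGx)))
  have hτ : ({v} ∪ pairs (b + 1) p) \ ({v} ∪ uppers (b + 1) p) =
      pairs (b + 1) p \ uppers (b + 1) p := by
    ext z
    have : z = v → z ∉ pairs (b + 1) p := fun e => e ▸ hvp
    simp only [mem_sdiff, mem_union, mem_singleton]
    tauto
  have hτc : #(pairs (b + 1) p \ uppers (b + 1) p) = 2 * k - #(uppers (b + 1) p) := by
    rw [card_sdiff_of_subset uppers_subset, card_pairs hp]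
  have hK₁ := hK.flip hF hfl
  have hfv₁ : ∀ x ∈ insert p I, ∀ r ⊆ pairs (b + 1) x, #r < k →
      insert v r ∈ faces (symmDiff K (facetsOf ({v} ∪ pairs (b + 1) p))) := by
    intro x hx r hr hrc
    have hnot : ¬ ({v} ∪ pairs (b + 1) p) \ ({v} ∪ uppers (b + 1) p) ⊆ insert v r := by
      rw [hτ]
      intro h
      have h1 := card_le_card (fun z hz => (mem_insert.1 (h hz)).resolve_left fun e =>
        hvp (e ▸ (mem_sdiff.1 hz).1) : pairs (b + 1) p \ uppers (b + 1) p ⊆ r)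
      omega
    rcases mem_insert.1 hx with rfl | hx
    · exact hfl.mem_faces_of_subset
        (by rw [insert_eq]; exact union_subset_union subset_rfl hr) hnot
    · exact hfl.mem_faces (hfv x hx r hr hrc) hnot
  have hp_front : p ∉ front I := fun h => hpI (hfront h)
  have hp1 : p + 1 ∉ I := fun h => hI.not_le hp hpI h fun _ => Nat.le_succ _
  by_cases hpos : ∀ i, 0 < p i
  · obtain ⟨q, rfl⟩ : ∃ q, p = q + 1 := ⟨fun i => p i - 1, funext fun i => by
      have := hpos i
      simp
      omega⟩
    have hq : Monotone q := fun i j hij => by simpa using hp hij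
    have hqI : q ∈ I := mem_of_mem_insert_of_ne
      (hI'.mem_of_le _ (mem_insert_self _ _) q hq fun _ => Nat.le_succ _) (hne1 q).symm
    have hqB := hIB' hqI
    have hvq : v ∉ pairs (b + 1) q := hvΔ _ (hB q hqB)
    have hq_front : q ∈ front I := mem_front.2 ⟨hqI, hpI⟩
    have hfront' : front (insert (q + 1) I) = insert (q + 1) ((front I).erase q) := by
      ext x
      have h1 : x + 1 = q + 1 ↔ x = q := add_left_inj 1
      simp only [mem_front, mem_insert, mem_erase, h1]
      constructor
      · rintro ⟨h | h, h2⟩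
        · exact Or.inl h
        · tauto
      · rintro (rfl | h)
        · exact ⟨Or.inl rfl, by simp [hne1, hp1]⟩
        · tauto
    have hτ' : pairs (b + 1) (q + 1) \ uppers (b + 1) (q + 1) =
        univ.image (lo (b + 1) (q + 1)) := by
      ext z
      simp only [mem_sdiff, mem_pairs, mem_uppers, mem_image, mem_univ, true_and]
      constructor
      · rintro ⟨⟨i, rfl | rfl⟩, h⟩
        · exact ⟨i, rfl⟩
        · exact absurd ⟨i, hpos i, rfl⟩ h
      · rintro ⟨i, rfl⟩
        refine ⟨⟨i, Or.inl rfl⟩, ?_⟩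
        rintro ⟨j, -, hj⟩
        exact lo_ne_lo_add_one hp i j hj.symm
    have hlo : ∀ i, lo (b + 1) (q + 1) i = lo (b + 1) q i + 1 := fun i => by simp [lo]; omega
    have hlo' : ∀ i, lo b (q + 1) i = lo (b + 1) q i := fun i => by simp [lo]; omega
    have hF₂ : #({v} ∪ pairs (b + 1) q) = 2 * k + 1 := by
      rw [card_union_pairs hq (hd q hqB), card_singleton, add_comm]
    have hσF : univ.image (lo (b + 1) (q + 1)) ⊆ {v} ∪ pairs (b + 1) q := by
      intro z hz
      obtain ⟨i, -, rfl⟩ := mem_image.1 hz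
      rw [hlo]
      exact mem_union_right _ (lo_add_one_mem_pairs i)
    have hvσ : v ∉ univ.image (lo (b + 1) (q + 1)) := fun h => by
      obtain ⟨i, -, hi⟩ := mem_image.1 h
      exact hvp (hi ▸ lo_mem_pairs i)
    have hfl₂ : Flippable (symmDiff K (facetsOf ({v} ∪ pairs (b + 1) (q + 1))))
        ({v} ∪ pairs (b + 1) q) (univ.image (lo (b + 1) (q + 1))) := by
      refine ⟨⟨hσF, fun h => hvσ (h (by simp))⟩, fun s hs => ?_, fun G hG hs => ?_⟩
      · obtain ⟨i, -, rfl⟩ := mem_image.1 hs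
        rw [hlo]
        have hiff : ∀ y ∈ insert (q + 1) (front I),
            ({v} ∪ pairs (b + 1) q).erase (lo (b + 1) q i + 1) ∈
              facetsOf ({v} ∪ pairs (b + 1) y) ↔ y = q := by
          intro y hy
          have hyI : y ∈ insert (q + 1) I := insert_subset_insert _ hfront hy
          have hym := hI'.monotone y hyI
          rw [erase_mem_facetsOf_iff hq hym (hd q hqB) (hd y (hIB hyI)) (lo_add_one_mem_pairs i)]
          constructor
          · intro h
            rw [← pairs_succ, ← pairs_succ, ← hlo'] at h
            rcases eq_or_eq_down hp (hym.add_const 1) (hpos i) h with h | h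
            · exact add_left_injective 1 h
            · have hy1 : y + 1 ∈ I := (congrArg (· ∈ I) h).mpr (hI'.down_mem (hpos i))
              rcases mem_insert.1 hy with rfl | hy
              · exact absurd hy1 hp1
              · exact absurd hy1 (mem_front.1 hy).2
          · rintro rfl
            exact erase_subset _ _
        have hvG : v ∈ ({v} ∪ pairs (b + 1) q).erase (lo (b + 1) q i + 1) := by
          refine mem_erase.2 ⟨fun e => hvq ?_, by simp⟩
          rw [e]
          exact lo_add_one_mem_pairs i
        refine mem_symmDiff.2 (Or.inl ⟨(hmem _).2 (Or.inr ⟨?_, hv_notMem hvG⟩), fun h => ?_⟩)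
        · rw [filter_eq_singleton hq_front fun x hx => hiff x (mem_insert_of_mem hx),
            card_singleton]
          exact odd_one
        · exact hne1 q ((hiff _ (mem_insert_self _ _)).1 h)
      · refine hK.not_sdiff_subset hF hfl hG ?_
        rwa [hτ, hτ']
    have hvτ : v ∈ ({v} ∪ pairs (b + 1) q) \ univ.image (lo (b + 1) (q + 1)) := by
      simp only [mem_sdiff, hvσ, not_false_eq_true, and_true]
      simp
    refine ⟨_, hK₁.flip hF₂ hfl₂, fun G => ?_, fun s hs hsc => ?_, fun x hx r hr hrc => ?_⟩
    · rw [hfront', odd_card_filter_insert (fun h => hp_front (mem_of_mem_erase h)), mem_symmDiff,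
        mem_symmDiff, hmem]
      have h1 := odd_card_filter_insert (notMem_erase q (front I))
        (fun x => G ∈ facetsOf ({v} ∪ pairs (b + 1) x))
      rw [insert_erase hq_front] at h1
      rw [h1]
      exact xor_xor_xor_cancel _ _ _ _
    · have hvs : v ∉ s := fun h => by
        obtain ⟨G, hG, hsG⟩ := hs
        exact hvΔ G hG (hsG h)
      by_cases hτs : ({v} ∪ pairs (b + 1) (q + 1)) \ ({v} ∪ uppers (b + 1) (q + 1)) ⊆ s
      · rw [hτ] at hτs
        have he := eq_of_subset_of_card_le hτs (by omega)
        rw [← he, hτ']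
        exact hfl₂.mem_faces_of_subset hσF fun h => hvσ (h hvτ)
      · exact hfl₂.mem_faces (hfl.mem_faces (hfΔ s hs hsc) hτs) fun h => hvs (h hvτ)
    · refine hfl₂.mem_faces (hfv₁ x hx r hr hrc) fun h => ?_
      have h1 := card_le_card h
      rw [card_sdiff_of_subset hσF, hF₂] at h1
      have h2 := card_image_le (s := univ) (f := lo (b + 1) (q + 1))
      have h3 := card_insert_le v r
      rw [card_univ, Fintype.card_fin] at h2
      omega
  · push Not at hpos
    obtain ⟨j, hj⟩ := hpos
    have hfront' : front (insert p I) = insert p (front I) := by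
      ext x
      have h1 : x + 1 ≠ p := fun e => by
        have := congrFun e j
        simp at this
        omega
      simp only [mem_front, mem_insert, h1, false_or]
      constructor
      · tauto
      · rintro (rfl | h)
        · exact ⟨Or.inl rfl, hp1⟩
        · tauto
    have hup' : #(uppers (b + 1) p) < k := by
      refine card_image_le.trans_lt ?_
      calc #{i | 0 < p i} < #(univ : Finset (Fin k)) :=
            card_lt_card (filter_ssubset.2 ⟨j, mem_univ _, by omega⟩)
        _ = k := by simp
    refine ⟨_, hK₁, fun G => ?_, fun s hs hsc => ?_, hfv₁⟩
    · rw [hfront', odd_card_filter_insert hp_front, mem_symmDiff, hmem]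
      exact xor_prop_assoc _ _ _
    · refine hfl.mem_faces (hfΔ s hs hsc) fun h => ?_
      rw [hτ] at h
      have := card_le_card h
      omega

end Stages

/-! ### Many spheres -/

section Counting

variable {k N T : ℕ} {x : Fin k → ℕ}

open Finset

/-- The positive monotone functions with sum `T` bounded by `N`. -/
noncomputable def level (k N T : ℕ) : Finset (Fin k → ℕ) :=
  {x ∈ box k N | (∀ i, 0 < x i) ∧ ∑ i, x i = T}

/-- A lower set containing exactly the elements of `S` among those of `level k N T`. -/
noncomputable def lowSet (N T : ℕ) (S : Finset (Fin k → ℕ)) : Finset (Fin k → ℕ) :=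
  {x ∈ box k N | (∃ i, x i = 0) ∨ ∑ i, x i < T} ∪ S

theorem mem_level : x ∈ level k N T ↔ x ∈ box k N ∧ (∀ i, 0 < x i) ∧ ∑ i, x i = T := by
  simp [level]

theorem mem_lowSet {S : Finset (Fin k → ℕ)} :
    x ∈ lowSet N T S ↔ (x ∈ box k N ∧ ((∃ i, x i = 0) ∨ ∑ i, x i < T)) ∨ x ∈ S := by
  simp [lowSet]

theorem lowSet_subset_box {S : Finset (Fin k → ℕ)} (hS : S ⊆ level k N T) :
    lowSet N T S ⊆ box k N := by
  intro x hx
  rcases mem_lowSet.1 hx with h | h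
  · exact h.1
  · exact (mem_level.1 (hS h)).1

theorem isLow_lowSet {S : Finset (Fin k → ℕ)} (hS : S ⊆ level k N T) :
    IsLow (lowSet N T S) where
  monotone p hp := (mem_box.1 (lowSet_subset_box hS hp)).2
  mem_of_le p hp q hq hqp := by
    have hqb := (isLow_box k N).mem_of_le p (lowSet_subset_box hS hp) q hq hqp
    have hle : ∑ i, q i ≤ ∑ i, p i := sum_le_sum fun i _ => hqp i
    rw [mem_lowSet]
    rcases mem_lowSet.1 hp with ⟨-, ⟨i, hi⟩ | h⟩ | h
    · exact Or.inl ⟨hqb, Or.inl ⟨i, Nat.le_zero.1 (hi ▸ hqp i)⟩⟩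
    · exact Or.inl ⟨hqb, Or.inr (hle.trans_lt h)⟩
    · have hT := (mem_level.1 (hS h)).2.2
      by_cases hqe : q = p
      · exact Or.inr (hqe ▸ h)
      · refine Or.inl ⟨hqb, Or.inr ?_⟩
        obtain ⟨i, hi⟩ := Function.ne_iff.1 hqe
        rw [← hT]
        exact sum_lt_sum (fun i _ => hqp i) ⟨i, mem_univ i, lt_of_le_of_ne (hqp i) hi⟩

theorem mem_lowSet_iff_of_mem_level {S : Finset (Fin k → ℕ)} (hx : x ∈ level k N T) :
    x ∈ lowSet N T S ↔ x ∈ S := by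
  obtain ⟨-, hpos, hT⟩ := mem_level.1 hx
  rw [mem_lowSet]
  refine or_iff_right ?_
  rintro ⟨-, ⟨i, hi⟩ | h⟩
  · exact (hpos i).ne' hi
  · omega

theorem exists_subset_pairs_of_zero {b n : ℕ} {r : Finset ℕ} (hr : ∀ z ∈ r, b ≤ z ∧ z < b + n)
    (hk : #r < k) (hn : 2 * k ≤ n) :
    ∃ x ∈ box k (n - 2 * k), (∃ i, x i = 0) ∧ r ⊆ pairs b x := by
  obtain ⟨x, hx, hxN, hxr⟩ := exists_subset_pairs (k := k) (b := b) (n := n) (r := insert b r)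
    (fun z hz => by
      rcases mem_insert.1 hz with rfl | hz
      · omega
      · exact hr z hz)
    ((card_insert_le _ _).trans hk) hn
  obtain ⟨i, hi⟩ := mem_pairs.1 (hxr (mem_insert_self _ _))
  refine ⟨x, mem_box.2 ⟨hxN, hx⟩, ⟨i, ?_⟩, (subset_insert _ _).trans hxr⟩
  unfold lo at hi
  omega

theorem exists_pow_le_card_level {m : ℕ} (hk : 1 ≤ k) (hm : 1 ≤ m) (hN : 2 * k * m ≤ N) :
    ∃ T, m ^ (k - 1) ≤ #(level k N T) := by
  obtain ⟨j, rfl⟩ : ∃ j, k = j + 1 := ⟨k - 1, by omega⟩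
  let f : (Fin j → Fin m) → Fin (j + 1) → ℕ := fun y =>
    Fin.snoc (α := fun _ => ℕ) (fun l => 1 + l * m + y l) (2 * (j + 1) * m - ∑ l, (y l : ℕ))
  have hsum : ∀ y : Fin j → Fin m, ∑ l, (y l : ℕ) ≤ j * m := fun y => by
    calc ∑ l, (y l : ℕ) ≤ ∑ _l : Fin j, m := sum_le_sum fun l _ => (y l).2.le
      _ = j * m := by simp
  have hbd : ∀ (y : Fin j → Fin m) (l : Fin j), 1 + l * m + y l ≤ j * m := fun y l => by
    have h1 := (y l).2
    have h2 : (l + 1) * m ≤ j * m := Nat.mul_le_mul_right m l.2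
    have h3 : ((l : ℕ) + 1) * m = l * m + m := by ring
    omega
  have hlast : ∀ y : Fin j → Fin m, j * m < 2 * (j + 1) * m - ∑ l, (y l : ℕ) := fun y => by
    have h1 := hsum y
    have h2 : 2 * (j + 1) * m = 2 * (j * m) + 2 * m := by ring
    omega
  refine ⟨∑ l : Fin j, (1 + l * m) + 2 * (j + 1) * m, ?_⟩
  have hcard : #(univ : Finset (Fin j → Fin m)) = m ^ (j + 1 - 1) := by simp
  rw [← hcard]
  refine card_le_card_of_injOn f (fun y _ => ?_) fun y _ y' _ h => ?_
  · refine mem_level.2 ⟨mem_box.2 ⟨fun i => ?_, fun i i' hi => ?_⟩, fun i => ?_, ?_⟩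
    · induction i using Fin.lastCases with
      | last => simp only [f, Fin.snoc_last]; omega
      | cast i =>
        have h1 := hbd y i
        have h2 := hlast y
        simp only [f, Fin.snoc_castSucc]
        omega
    · induction i' using Fin.lastCases with
      | last =>
        induction i using Fin.lastCases with
        | last => exact le_rfl
        | cast i => simpa only [f, Fin.snoc_castSucc, Fin.snoc_last] using (hbd y i).trans (hlast y).le
      | cast i' =>
        induction i using Fin.lastCases with
        | last => exact absurd hi (not_le.2 (Fin.castSucc_lt_last i'))
        | cast i =>
          simp only [f, Fin.snoc_castSucc]
          rcases (Fin.castSucc_le_castSucc_iff.1 hi).eq_or_lt with rfl | hlt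
          · exact le_rfl
          · have h1 := (y i).2
            have h2 : ((i : ℕ) + 1) * m ≤ i' * m := Nat.mul_le_mul_right m hlt
            have h3 : ((i : ℕ) + 1) * m = i * m + m := by ring
            omega
    · induction i using Fin.lastCases with
      | last =>
        have := hlast y
        simp only [f, Fin.snoc_last]
        omega
      | cast i => simp only [f, Fin.snoc_castSucc]; omega
    · rw [Fin.sum_univ_castSucc]
      simp only [f, Fin.snoc_castSucc, Fin.snoc_last, sum_add_distrib (g := fun l => (y l : ℕ))]
      have := hlast y
      omega
  · funext l
    have := congrFun h l.castSucc
    simp only [f, Fin.snoc_castSucc] at this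
    exact Fin.ext (by omega)

end Counting

section Assembly

open Finset

theorem FlipSphere.mem_of_mem_faces {m : ℕ} {K : Finset (Finset ℕ)} (hK : FlipSphere m K)
    {G : Finset ℕ} (h : G ∈ faces K) (hG : #G = m) : G ∈ K := by
  obtain ⟨H, hH, hGH⟩ := h
  rwa [eq_of_subset_of_card_le hGH (by rw [hG, hK.card_eq H hH])]

theorem finite_complexes (d s n : ℕ) :
    Finite {Δ : Set (Finset ℕ) // IsComplex Δ ∧ IsSphere d Δ ∧
      vertexSet Δ = Set.Icc 1 n ∧ Nbrly s (Set.Icc 1 n) Δ} := by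
  refine ((Icc 1 n).powerset.finite_toSet.finite_subsets.subset ?_).to_subtype
  rintro Δ ⟨hΔ, -, hv, -⟩ s hs
  rw [coe_powerset]
  intro z hz
  have : z ∈ vertexSet Δ := hΔ s hs {z} (singleton_subset_iff.2 hz)
  rwa [hv, ← coe_Icc] at this

theorem two_pow_card_le {α : Type*} [DecidableEq α] {d n : ℕ} (hd : 2 ≤ d) (P : Finset α)
    (g : α → Finset ℕ)
    (h : ∀ S ⊆ P, ∃ K, FlipSphere d K ∧ (∀ G ∈ K, G ⊆ Icc 1 n) ∧
      Nbrly (d / 2) (Set.Icc 1 n) (faces K) ∧ ∀ x ∈ P, (g x ∈ K ↔ x ∉ S)) :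
    2 ^ #P ≤ Nat.card {Δ : Set (Finset ℕ) // IsComplex Δ ∧ IsSphere (d - 1) Δ ∧
      vertexSet Δ = Set.Icc 1 n ∧ Nbrly (d / 2) (Set.Icc 1 n) Δ} := by
  choose! K hK hsub hnb hmem using h
  have hsphere : ∀ S ⊆ P, IsComplex (faces (K S)) ∧ IsSphere (d - 1) (faces (K S)) ∧
      vertexSet (faces (K S)) = Set.Icc 1 n ∧ Nbrly (d / 2) (Set.Icc 1 n) (faces (K S)) := by
    intro S hS
    refine ⟨isComplex_faces _, ?_, ?_, hnb S hS⟩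
    · have h1 := hK S hS
      rw [show d = d - 1 + 1 by omega] at h1
      refine h1.eq_empty_or_isSphere.resolve_left fun he => ?_
      obtain ⟨G, hG, -⟩ := hnb S hS ∅ (by simp) (by simp)
      simp [he] at hG
    · ext v
      constructor
      · rintro ⟨G, hG, hvG⟩
        have := hsub S hS G hG (singleton_subset_iff.1 hvG)
        rwa [← coe_Icc]
      · intro hv
        exact hnb S hS {v} (by simpa using hv) (by simp; omega)
  have := finite_complexes (d - 1) (d / 2) n
  have hinj : Function.Injective fun S : P.powerset =>
      (⟨faces (K S), hsphere S (mem_powerset.1 S.2)⟩ :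
        {Δ : Set (Finset ℕ) // IsComplex Δ ∧ IsSphere (d - 1) Δ ∧
          vertexSet Δ = Set.Icc 1 n ∧ Nbrly (d / 2) (Set.Icc 1 n) Δ}) := by
    rintro ⟨S, hS⟩ ⟨S', hS'⟩ he
    rw [mem_powerset] at hS hS'
    have he' : faces (K S) = faces (K S') := congrArg Subtype.val he
    have hKK : ∀ G, G ∈ K S ↔ G ∈ K S' := fun G =>
      ⟨fun hG => (hK S' hS').mem_of_mem_faces (he' ▸ ⟨G, hG, subset_rfl⟩)
          ((hK S hS).card_eq G hG),
        fun hG => (hK S hS).mem_of_mem_faces (he'.symm ▸ ⟨G, hG, subset_rfl⟩)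
          ((hK S' hS').card_eq G hG)⟩
    refine Subtype.ext (Finset.ext fun x => ?_)
    by_cases hx : x ∈ P
    · rw [← not_iff_not, ← hmem S hS x hx, ← hmem S' hS' x hx, hKK]
    · exact iff_of_false (fun h => hx (hS h)) fun h => hx (hS' h)
  have h1 := Nat.card_le_card_of_injective _ hinj
  rwa [Nat.card_eq_fintype_card, Fintype.card_coe, card_powerset] at h1

theorem exists_odd_dim_sphere {k n T : ℕ} (hk : 2 ≤ k) (hn : 2 * k ≤ n)
    {S : Finset (Fin k → ℕ)} (hS : S ⊆ level k (n - 2 * k) T) :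
    ∃ K, FlipSphere (2 * k - 1) K ∧ (∀ G ∈ K, G ⊆ Icc 1 n) ∧
      Nbrly ((2 * k - 1) / 2) (Set.Icc 1 n) (faces K) ∧
      ∀ x ∈ level k (n - 2 * k) T,
        ((pairs 1 x).erase (lo 1 x ⟨0, by omega⟩ + 1) ∈ K ↔ x ∉ S) := by
  have hI := isLow_lowSet hS
  obtain ⟨K, hK, hmem, hface⟩ := exists_flipSphere_of_isLow (k := k) (b := 1) (Y := ∅)
    (m := 2 * k - 1) (by simp) (by omega) (by simp; omega) _ hI
  simp only [empty_union, card_empty, add_zero] at hmem hface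
  refine ⟨K, hK, fun G hG z hz => ?_, fun τ hτ hτc => ?_, fun x hx => ?_⟩
  · obtain ⟨x, hx, hGx⟩ := exists_of_odd_card_filter ((hmem G).1 hG)
    have h1 := (mem_box.1 (lowSet_subset_box hS hx)).1
    have h2 := pairs_lt h1 (subset_of_mem_facetsOf hGx hz)
    rw [mem_Icc]
    omega
  · obtain ⟨x, hx, hx0, hxτ⟩ := exists_subset_pairs_of_zero (k := k) (b := 1) (n := n) (r := τ)
      (fun z hz => by
        have := hτ hz
        rw [Set.mem_Icc] at this
        omega) (by omega) hn
    exact hface x (mem_lowSet.2 (Or.inl ⟨hx, Or.inl hx0⟩)) τ hxτ (by omega)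
  · obtain ⟨hxb, hpos, hT⟩ := mem_level.1 hx
    have hxm := (mem_box.1 hxb).2
    let i : Fin k := ⟨0, by omega⟩
    have hdown : down x i ∈ lowSet (n - 2 * k) T S := by
      refine mem_lowSet.2 (Or.inl ⟨(isLow_box _ _).mem_of_le x hxb _ (monotone_down hxm i)
        (down_le x i), Or.inr ?_⟩)
      rw [← hT]
      refine sum_lt_sum (fun j _ => down_le x i j) ⟨i, mem_univ i, ?_⟩
      rw [down_self]
      have := hpos i
      omega
    have hfilter : {y ∈ lowSet (n - 2 * k) T S | (pairs 1 x).erase (lo 1 x i + 1) ∈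
        facetsOf (pairs 1 y)} = {y ∈ lowSet (n - 2 * k) T S | y = x ∨ y = down x i} := by
      refine filter_congr fun y hy => ?_
      simpa using erase_upper_mem_facetsOf_iff (Y := ∅) (b := 1) hxm (hI.monotone y hy) (by simp)
        (by simp) (hpos i)
    rw [hmem, hfilter, filter_or, card_union_of_disjoint, filter_eq', filter_eq', if_pos hdown,
      ← mem_lowSet_iff_of_mem_level (S := S) hx]
    · split_ifs with h <;> simp [h]
    · rw [disjoint_filter]
      rintro y - rfl
      exact (down_ne (hpos i)).symm

theorem pairs_subset_insert {k : ℕ} {x : Fin k → ℕ} (hx : Monotone x) :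
    pairs 1 x ⊆ {1} ∪ pairs 2 fun i => x i - 1 := by
  intro z hz
  obtain ⟨i, hi⟩ := mem_pairs.1 hz
  unfold lo at hi
  rcases Nat.eq_zero_or_pos (x i) with h0 | h0
  · by_cases hz2 : z = 2 + 2 * i
    · exact mem_union_right _ (mem_pairs.2 ⟨i, Or.inl (by simp only [lo]; omega)⟩)
    · by_cases hi0 : (i : ℕ) = 0
      · exact mem_union_left _ (mem_singleton.2 (by omega))
      · have hi2 := i.2
        let j : Fin k := ⟨i - 1, by omega⟩
        have hj : x j ≤ x i := hx (Fin.le_def.2 (by simp [j]))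
        refine mem_union_right _ (mem_pairs.2 ⟨j, Or.inr ?_⟩)
        simp only [lo, j] at hj ⊢
        omega
  · refine mem_union_right _ (mem_pairs.2 ⟨i, ?_⟩)
    simp only [lo]
    omega

theorem eq_of_pairs_subset_insert {k : ℕ} {x y y' : Fin k → ℕ} (hx : Monotone x)
    (hy : Monotone y) (hy' : Monotone y') (h : pairs 1 x ⊆ {1} ∪ pairs 2 y)
    (h' : pairs 1 x ⊆ {1} ∪ pairs 2 y') : y = y' := by
  have herase : ∀ {y : Fin k → ℕ}, pairs 1 x ⊆ {1} ∪ pairs 2 y →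
      (pairs 1 x).erase 1 ⊆ pairs 1 (y + 1) := by
    intro y h z hz
    obtain ⟨hne, hz⟩ := mem_erase.1 hz
    rw [pairs_succ]
    exact (mem_union.1 (h hz)).resolve_left fun h1 => hne (mem_singleton.1 h1)
  have hym : Monotone (y + 1) := hy.add_const 1
  have hym' : Monotone (y' + 1) := hy'.add_const 1
  by_cases h1 : 1 ∈ pairs 1 x
  · obtain ⟨i, hi⟩ := mem_pairs.1 h1
    have hne : ∀ y : Fin k → ℕ, y + 1 ≠ x := fun y e => by
      have := congrFun e i
      simp only [Pi.add_apply, Pi.one_apply] at this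
      unfold lo at hi
      omega
    have hc : #((pairs 1 x).erase 1) + 1 = 2 * k := by
      rw [card_erase_add_one h1, card_pairs hx]
    have := (eq_or_eq_of_ridge_subset (b := 1) hx hym hym' hc (erase_subset _ _) (herase h)
      (herase h') (hne y).symm).resolve_left (hne y')
    exact (add_left_injective 1 this).symm
  · rw [erase_eq_of_notMem h1] at herase
    exact add_left_injective 1 ((eq_of_pairs_subset hx hym (herase h)).symm.trans
      (eq_of_pairs_subset hx hym' (herase h')))

/-- A neighborly sphere with facets `pairs 1 x`, to be used as a starting point. -/
theorem exists_base_sphere {k n : ℕ} (hk : 2 ≤ k) (hn : 2 * k + 2 ≤ n) :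
    ∃ Δ, FlipSphere (2 * k) Δ ∧ (∀ G ∈ Δ, ∀ z ∈ G, 1 ≤ z ∧ z < n) ∧
      (∀ s : Finset ℕ, (∀ z ∈ s, 1 ≤ z ∧ z < n) → #s ≤ k → s ∈ faces Δ) ∧
      ∀ x ∈ box k (n - 1 - 2 * k), pairs 1 x ∈ Δ := by
  obtain ⟨Δ, hΔ, hmem, hface⟩ := exists_flipSphere_of_isLow (k := k) (b := 2) (Y := {1})
    (m := 2 * k) (by simp) (by omega) (by simp) _ (isLow_box k (n - 2 - 2 * k))
  have hd : ∀ x : Fin k → ℕ, Disjoint {1} (pairs 2 x) := fun x => by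
    rw [disjoint_singleton_left, mem_pairs]
    rintro ⟨i, hi⟩
    unfold lo at hi
    omega
  refine ⟨Δ, hΔ, fun G hG z hz => ?_, fun s hs hsc => ?_, fun x hx => ?_⟩
  · obtain ⟨x, hx, hGx⟩ := exists_of_odd_card_filter ((hmem G).1 hG)
    rcases mem_union.1 (subset_of_mem_facetsOf hGx hz) with h | h
    · rw [mem_singleton] at h
      omega
    · have := pairs_lt (mem_box.1 hx).1 h
      omega
  · obtain ⟨x, hx, hxN, hxs⟩ := exists_subset_pairs (k := k) (b := 2) (n := n - 2)
      (r := s.erase 1) (fun z hz => by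
        obtain ⟨h1, h2⟩ := mem_erase.1 hz
        have := hs z h2
        omega) ((card_erase_le).trans hsc) (by omega)
    refine hface x (mem_box.2 ⟨hxN, hx⟩) s ?_ (by simp; omega)
    rwa [← insert_eq, subset_insert_iff]
  · obtain ⟨hxN, hxm⟩ := mem_box.1 hx
    have hym : Monotone fun i => x i - 1 := fun i j hij => Nat.sub_le_sub_right (hxm hij) 1
    have hyb : (fun i => x i - 1) ∈ box k (n - 2 - 2 * k) := mem_box.2 ⟨fun i => by
      have := hxN i
      omega, hym⟩
    rw [hmem, filter_eq_singleton hyb, card_singleton]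
    · exact odd_one
    · intro y hy
      have hy2 := (mem_box.1 hy).2
      rw [mem_facetsOf_iff_subset
        (by rw [card_pairs hxm, card_union_pairs hy2 (hd y), card_singleton, add_comm])]
      constructor
      · exact fun h => eq_of_pairs_subset_insert hxm hy2 hym h (pairs_subset_insert hxm)
      · rintro rfl
        exact pairs_subset_insert hxm

theorem exists_even_dim_sphere {k n T : ℕ} (hk : 2 ≤ k) (hn : 2 * k + 2 ≤ n)
    {S : Finset (Fin k → ℕ)} (hS : S ⊆ level k (n - 1 - 2 * k) T) :
    ∃ K, FlipSphere (2 * k) K ∧ (∀ G ∈ K, G ⊆ Icc 1 n) ∧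
      Nbrly (2 * k / 2) (Set.Icc 1 n) (faces K) ∧
      ∀ x ∈ level k (n - 1 - 2 * k) T, (pairs 1 x ∈ K ↔ x ∉ S) := by
  have hI := isLow_lowSet hS
  obtain ⟨Δ, hΔ, hΔn, hΔf, hΔp⟩ := exists_base_sphere hk hn
  obtain ⟨K, hK, hmem, hface, hfacev⟩ := exists_flipSphere_insert (b := 0) (v := n) (by omega) hΔ
    (fun G hG h => (hΔn G hG n h).2.ne rfl) hΔp _ hI (lowSet_subset_box hS)
  simp only [zero_add] at hmem hfacev
  have hfront : front (lowSet (n - 1 - 2 * k) T S) ⊆ box k (n - 1 - 2 * k) :=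
    (filter_subset _ _).trans (lowSet_subset_box hS)
  refine ⟨K, hK, fun G hG z hz => ?_, fun τ hτ hτc => ?_, fun x hx => ?_⟩
  · rw [mem_Icc]
    rcases (hmem G).1 hG with h | h
    · have := hΔn G h.1 z hz
      omega
    · obtain ⟨x, hx, hGx⟩ := exists_of_odd_card_filter h.1
      rcases mem_union.1 (subset_of_mem_facetsOf hGx hz) with h1 | h1
      · rw [mem_singleton] at h1
        omega
      · have := hΔn _ (hΔp x (hfront hx)) z h1
        omega
  · have hτ' : ∀ z ∈ τ, 1 ≤ z ∧ z ≤ n := fun z hz => hτ hz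
    rw [Nat.mul_div_cancel_left _ two_pos] at hτc
    by_cases hnτ : n ∈ τ
    · have hc := card_erase_add_one hnτ
      obtain ⟨x, hx, hx0, hxτ⟩ := exists_subset_pairs_of_zero (k := k) (b := 1) (n := n - 1)
        (r := τ.erase n) (fun z hz => by
          obtain ⟨h1, h2⟩ := mem_erase.1 hz
          have := hτ' z h2
          omega) (by omega) (by omega)
      have := hfacev x (mem_lowSet.2 (Or.inl ⟨hx, Or.inl hx0⟩)) _ hxτ (by omega)
      rwa [insert_erase hnτ] at this
    · refine hface τ (hΔf τ (fun z hz => ?_) hτc) hτc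
      have h1 := hτ' z hz
      have h2 : z ≠ n := fun e => hnτ (e ▸ hz)
      omega
  · obtain ⟨hxb, hpos, hT⟩ := mem_level.1 hx
    have hxm := (mem_box.1 hxb).2
    have hn_notMem : ∀ y ∈ box k (n - 1 - 2 * k), n ∉ pairs 1 y := fun y hy h =>
      (hΔn _ (hΔp y hy) n h).2.ne rfl
    have hfilter : {y ∈ front (lowSet (n - 1 - 2 * k) T S) | pairs 1 x ∈
        facetsOf ({n} ∪ pairs 1 y)} = {y ∈ front (lowSet (n - 1 - 2 * k) T S) | y = x} := by
      refine filter_congr fun y hy => ?_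
      have hyb := hfront hy
      have hym := (mem_box.1 hyb).2
      rw [mem_facetsOf_iff_subset (by rw [card_pairs hxm, card_union_pairs hym
        (disjoint_singleton_left.2 (hn_notMem y hyb)), card_singleton, add_comm])]
      constructor
      · intro h
        refine (eq_of_pairs_subset (b := 1) hxm hym fun z hz => ?_).symm
        refine (mem_union.1 (h hz)).resolve_left fun h1 => hn_notMem x hxb ?_
        rwa [mem_singleton.1 h1] at hz
      · rintro rfl
        exact subset_union_right
    have hsucc : x + 1 ∉ lowSet (n - 1 - 2 * k) T S := by
      have hsum : T < ∑ i, (x + 1) i := by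
        rw [← hT]
        exact sum_lt_sum (fun i _ => Nat.le_succ _) ⟨⟨0, by omega⟩, mem_univ _, Nat.lt_succ_self _⟩
      rw [mem_lowSet]
      rintro (⟨-, ⟨i, hi⟩ | h⟩ | h)
      · exact absurd hi (Nat.succ_ne_zero _)
      · omega
      · have := (mem_level.1 (hS h)).2.2
        omega
    have hxf : x ∈ front (lowSet (n - 1 - 2 * k) T S) ↔ x ∈ S := by
      rw [mem_front, mem_lowSet_iff_of_mem_level hx]
      exact and_iff_left hsucc
    rw [hmem, hfilter, filter_eq', ← hxf]
    have h1 := hΔp x hxb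
    split_ifs with h <;> simp [h, h1, Xor]

end Assembly

/-- Main theorem: for `k ≥ 2` and `d ∈ {2k-1, 2k}`, there are at least
`2^{c n^{k-1}}` distinct `⌊d/2⌋`-neighborly simplicial PL `(d-1)`-spheres on `n`
labeled vertices, for some `c > 0` and all large `n`. -/
theorem many_neighborly_spheres (k d : ℕ) (hk : 2 ≤ k)
    (hd : d = 2 * k - 1 ∨ d = 2 * k) :
    ∃ c : ℝ, 0 < c ∧ ∃ N : ℕ, ∀ n : ℕ, N ≤ n →
      (2 : ℝ) ^ (c * (n : ℝ) ^ (k - 1)) ≤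
        Nat.card {Δ : Set (Finset ℕ) // IsComplex Δ ∧ IsSphere (d - 1) Δ ∧
          vertexSet Δ = Set.Icc 1 n ∧ Nbrly (d / 2) (Set.Icc 1 n) Δ} := by
  refine ⟨(1 / (8 * k : ℝ)) ^ (k - 1), by positivity, 8 * k, fun n hn => ?_⟩
  set m := n / (4 * k) with hm
  have hm1 : 1 ≤ m := (Nat.one_le_div_iff (by omega)).2 (by omega)
  have hmn : 4 * k * m ≤ n := Nat.mul_div_le n (4 * k)
  have hnm : n ≤ 8 * k * m := by
    have : n < 4 * k * (m + 1) := Nat.lt_mul_div_succ n (by omega)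
    nlinarith
  suffices h : 2 ^ m ^ (k - 1) ≤ Nat.card {Δ : Set (Finset ℕ) // IsComplex Δ ∧ IsSphere (d - 1) Δ ∧
      vertexSet Δ = Set.Icc 1 n ∧ Nbrly (d / 2) (Set.Icc 1 n) Δ} by
    have hexp : (1 / (8 * k : ℝ)) ^ (k - 1) * (n : ℝ) ^ (k - 1) ≤ ((m ^ (k - 1) : ℕ) : ℝ) := by
      rw [← mul_pow, Nat.cast_pow]
      gcongr
      rw [one_div_mul_eq_div, div_le_iff₀ (by positivity), mul_comm]
      exact_mod_cast hnm
    calc (2 : ℝ) ^ ((1 / (8 * k : ℝ)) ^ (k - 1) * (n : ℝ) ^ (k - 1))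
        ≤ (2 : ℝ) ^ ((m ^ (k - 1) : ℕ) : ℝ) := Real.rpow_le_rpow_of_exponent_le one_le_two hexp
      _ = ((2 ^ m ^ (k - 1) : ℕ) : ℝ) := by rw [Real.rpow_natCast]; push_cast; rfl
      _ ≤ _ := by exact_mod_cast h
  have hkm : 4 * k * m = 2 * (2 * k * m) := by ring
  rcases hd with rfl | rfl
  · obtain ⟨T, hT⟩ := exists_pow_le_card_level (k := k) (N := n - 2 * k) (by omega) hm1 (by omega)
    exact (Nat.pow_le_pow_right two_pos hT).trans
      (two_pow_card_le (by omega) _ _ fun S hS => exists_odd_dim_sphere hk (by omega) hS)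
  · obtain ⟨T, hT⟩ := exists_pow_le_card_level (k := k) (N := n - 1 - 2 * k) (by omega) hm1
      (by omega)
    exact (Nat.pow_le_pow_right two_pos hT).trans
      (two_pow_card_le (by omega) _ _ fun S hS => exists_even_dim_sphere hk (by omega) hS)
end
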